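/- arXiv:2001.05903 — 3 statements merged into one kernel-verified Lean document; each statement's English description precedes it below -/
import Mathlib

section
/- Uniform Köthe duality in the finite setting (Theorem 1.1(ii)): For every pair (p,r) with either 1 < p ≤ ∞ and 1 ≤ r < ∞, or p = r ∈ {1, ∞}, there exists a constant C = C(p,r) such that for every finite outer measure setting (X, μ, ω) and every nonnegative function f on X, (1/C) sup{ ‖fg‖_{L^1(X,ω)} : g ≥ 0, ‖g‖_{L^{p'}(ℓ^{r'})} = 1 } ≤ ‖f‖_{L^p(ℓ^r)} ≤ C sup{ ‖fg‖_{L^1(X,ω)} : g ≥ 0, ‖g‖_{L^{p'}(ℓ^{r'})} = 1 }, where p', r' are the Hölder conjugate exponents. The constant C is independent of X, μ and ω. -/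
open MeasureTheory Set
open scoped ENNReal

noncomputable section

/-- The outer `ℓ^r` size in the finite setting: for `r < ∞`,
`ℓ^r(f)(A) = (μ(A)⁻¹ Σ_{x∈A} ω(x) f(x)^r)^{1/r}`; for `r = ∞` the sup of `f` on `A`. -/
def ellF {X : Type} (μ : Set X → ℝ≥0∞) (ω : X → ℝ≥0∞)
    (r : ℝ≥0∞) (f : X → ℝ≥0∞) (A : Set X) : ℝ≥0∞ :=
  if r = ∞ then ⨆ x ∈ A, f x
  else ((μ A)⁻¹ * ∑' x : A, ω x.1 * f x.1 ^ r.toReal) ^ r.toReal⁻¹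

/-- The outer `L^∞(ℓ^r)` quasi-norm in the finite setting. -/
def supF {X : Type} (μ : Set X → ℝ≥0∞) (ω : X → ℝ≥0∞)
    (r : ℝ≥0∞) (f : X → ℝ≥0∞) : ℝ≥0∞ :=
  ⨆ A : Set X, ellF μ ω r f A

/-- The super level measure `μ(ℓ^r(f) > λ)` in the finite setting. -/
def slF {X : Type} (μ : Set X → ℝ≥0∞) (ω : X → ℝ≥0∞)
    (r : ℝ≥0∞) (f : X → ℝ≥0∞) (lam : ℝ≥0∞) : ℝ≥0∞ :=
  ⨅ (A : Set X) (_ : supF μ ω r (Aᶜ.indicator f) ≤ lam), μ A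

/-- The outer `L^p(ℓ^r)` quasi-norm in the finite setting. -/
def LpF {X : Type} (μ : Set X → ℝ≥0∞) (ω : X → ℝ≥0∞)
    (p r : ℝ≥0∞) (f : X → ℝ≥0∞) : ℝ≥0∞ :=
  if p = ∞ then supF μ ω r f
  else (∫⁻ l in Ioi (0:ℝ),
      ENNReal.ofReal (p.toReal * l ^ (p.toReal - 1)) *
        slF μ ω r f (ENNReal.ofReal l)) ^ p.toReal⁻¹

/-- The Hölder conjugate exponent: `1/p + 1/p' = 1`, with `1' = ∞` and `∞' = 1`. -/
def conjE (p : ℝ≥0∞) : ℝ≥0∞ := (1 - p⁻¹)⁻¹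

/-- The hypotheses on the set function `μ` of a finite outer measure setting. -/
structure IsFiniteOuter {X : Type} (μ : Set X → ℝ≥0∞) : Prop where
  empty : μ ∅ = 0
  mono : ∀ A B : Set X, A ⊆ B → μ A ≤ μ B
  union_le : ∀ A B : Set X, μ (A ∪ B) ≤ μ A + μ B
  singleton : ∀ x : X, 0 < μ {x} ∧ μ {x} < ∞

namespace IsFiniteOuter

variable {X : Type} {μ : Set X → ℝ≥0∞}

theorem ne_top (hμ : IsFiniteOuter μ) (B : Finset X) : μ B ≠ ∞ := by
  classical
  induction B using Finset.induction_on with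
  | empty => simp [hμ.empty]
  | insert x s _ ih =>
    rw [Finset.coe_insert, Set.insert_eq]
    exact ne_top_of_le_ne_top (ENNReal.add_ne_top.2 ⟨(hμ.singleton x).2.ne, ih⟩)
      (hμ.union_le _ _)

theorem ne_zero (hμ : IsFiniteOuter μ) {A : Set X} (hA : A.Nonempty) : μ A ≠ 0 := by
  obtain ⟨x, hx⟩ := hA
  exact ((hμ.singleton x).1.trans_le (hμ.mono _ _ (Set.singleton_subset_iff.2 hx))).ne'

/-- Among the nonempty subsets of `S` there is one of maximal density. -/
theorem exists_max_density (hμ : IsFiniteOuter μ) {v : X → ℝ≥0∞} (hv : ∀ x, v x ≠ ∞)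
    {S : Finset X} (hS : S.Nonempty) :
    ∃ A ⊆ S, A.Nonempty ∧ ∃ τ : ℝ≥0∞, τ ≠ ∞ ∧ ∑ x ∈ A, v x = τ * μ A ∧
      ∀ B ⊆ S, ∑ x ∈ B, v x ≤ τ * μ B := by
  classical
  obtain ⟨A, hA, hmax⟩ := Finset.exists_max_image (S.powerset.filter Finset.Nonempty)
    (fun B => (∑ x ∈ B, v x) / μ B) ⟨S, by simpa using hS⟩
  simp only [Finset.mem_filter, Finset.mem_powerset] at hA hmax
  have h0 : ∀ B : Finset X, B.Nonempty → μ (B : Set X) ≠ 0 := fun B hB =>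
    hμ.ne_zero (by exact_mod_cast hB)
  refine ⟨A, hA.1, hA.2, (∑ x ∈ A, v x) / μ A, ?_, ?_, ?_⟩
  · exact ENNReal.div_ne_top (ENNReal.sum_ne_top.2 fun x _ => hv x) (h0 A hA.2)
  · exact (ENNReal.div_mul_cancel (h0 A hA.2) (hμ.ne_top A)).symm
  · intro B hB
    rcases B.eq_empty_or_nonempty with rfl | hBn
    · simp
    · exact (ENNReal.div_le_iff (h0 B hBn) (hμ.ne_top B)).1 (hmax B ⟨hB, hBn⟩)

/-- Greedy selection relative to a subset `S`. The function `t` is constant on each selected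
block, where it equals the density of the block. -/
theorem exists_selection_on (hμ : IsFiniteOuter μ) {v : X → ℝ≥0∞} (hv : ∀ x, v x ≠ ∞)
    (S : Finset X) :
    ∃ t : X → ℝ≥0∞, (∀ x, t x ≠ ∞) ∧
      (∀ M, (∀ B ⊆ S, ∑ x ∈ B, v x ≤ M * μ B) → ∀ x ∈ S, t x ≤ M) ∧
      (∀ s, ∀ B ⊆ S, (∀ x ∈ B, t x ≤ s) → ∑ x ∈ B, v x ≤ s * μ B) ∧
      (∀ s, μ (S.filter fun x => s < t x : Finset X) ≤
        ∑ x ∈ S.filter fun x => s < t x, v x / t x) := by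
  classical
  induction S using Finset.strongInduction with
  | H S ih =>
  rcases S.eq_empty_or_nonempty with rfl | hS
  · refine ⟨fun _ => 0, by simp, by simp, ?_, by simp [hμ.empty]⟩
    intro s B hB _
    simp [Finset.subset_empty.1 hB]
  obtain ⟨A, hAS, hA, τ, hτ, hAτ, hmax⟩ := hμ.exists_max_density hv hS
  obtain ⟨t, ht, htM, ht1, ht2⟩ := ih (S \ A) (Finset.sdiff_ssubset hAS hA)
  have hA0 : μ (A : Set X) ≠ 0 := hμ.ne_zero (by exact_mod_cast hA)
  refine ⟨fun x => if x ∈ A then τ else t x, ?_, ?_, ?_, ?_⟩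
  · intro x
    dsimp only
    split_ifs
    exacts [hτ, ht x]
  · intro M hM x hx
    dsimp only
    split_ifs with hxA
    · have := hM A hAS
      rw [hAτ] at this
      exact (ENNReal.mul_le_mul_iff_left hA0 (hμ.ne_top A)).1 this
    · exact htM M (fun B hB => hM B (hB.trans Finset.sdiff_subset)) x
        (Finset.mem_sdiff.2 ⟨hx, hxA⟩)
  · intro s B hB hs
    by_cases h : ∃ x ∈ B, x ∈ A
    · obtain ⟨x, hxB, hxA⟩ := h
      have := hs x hxB
      simp only [if_pos hxA] at this
      exact (hmax B hB).trans (by gcongr)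
    · push Not at h
      refine ht1 s B (fun x hx => Finset.mem_sdiff.2 ⟨hB hx, h x hx⟩) fun x hx => ?_
      simpa [h x hx] using hs x hx
  · intro s
    rcases le_or_gt τ s with h | h
    · have : (S.filter fun x => s < if x ∈ A then τ else t x) = ∅ := by
        refine Finset.filter_eq_empty_iff.2 fun x hx => not_lt.2 ?_
        split_ifs with hxA
        · exact h
        · exact (htM τ (fun B hB => hmax B (hB.trans Finset.sdiff_subset)) x
            (Finset.mem_sdiff.2 ⟨hx, hxA⟩)).trans h
      rw [this]
      simp [hμ.empty]
    · have hsplit : (S.filter fun x => s < if x ∈ A then τ else t x) =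
          A ∪ (S \ A).filter fun x => s < t x := by
        ext x
        by_cases hxA : x ∈ A
        · simp [hxA, hAS hxA, h]
        · simp [hxA]
      have hdisj : Disjoint A ((S \ A).filter fun x => s < t x) :=
        Finset.disjoint_left.2 fun x hx hx' => by simp [hx] at hx'
      have hτ0 : τ ≠ 0 := (bot_le.trans_lt h).ne'
      rw [hsplit, Finset.sum_union hdisj, Finset.coe_union]
      refine (hμ.union_le _ _).trans (add_le_add ?_ ((ht2 s).trans ?_))
      · have : ∑ x ∈ A, v x / (if x ∈ A then τ else t x) = ∑ x ∈ A, v x * τ⁻¹ :=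
          Finset.sum_congr rfl fun x hx => by rw [if_pos hx, div_eq_mul_inv]
        rw [this, ← Finset.sum_mul, hAτ, mul_right_comm, ENNReal.mul_inv_cancel hτ0 hτ, one_mul]
      · refine Finset.sum_le_sum fun x hx => ?_
        simp only [Finset.mem_filter, Finset.mem_sdiff] at hx
        simp only [if_neg hx.1.2, le_refl]

/-- Greedy selection on a finite outer measure space. -/
theorem exists_selection [Fintype X] (hμ : IsFiniteOuter μ) {v : X → ℝ≥0∞}
    (hv : ∀ x, v x ≠ ∞) :
    ∃ t : X → ℝ≥0∞, (∀ x, t x ≠ ∞) ∧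
      (∀ s, ∀ B : Finset X, (∀ x ∈ B, t x ≤ s) → ∑ x ∈ B, v x ≤ s * μ B) ∧
      (∀ s, μ {x | s < t x} ≤ ∑ x, if s < t x then v x / t x else 0) := by
  obtain ⟨t, ht, -, h1, h2⟩ := hμ.exists_selection_on hv Finset.univ
  refine ⟨t, ht, fun s B => h1 s B (Finset.subset_univ B), fun s => ?_⟩
  simpa [Finset.sum_filter] using h2 s

theorem sum_le_four_mul_lintegral_Ioc (hμ : IsFiniteOuter μ) {v : X → ℝ≥0∞}
    (hv : ∀ x, v x ≠ ∞) {h : ℝ → ℝ≥0∞} (hanti : ∀ a b, 0 < a → a ≤ b → h b ≤ h a)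
    (hH : ∀ l, 0 < l → ∃ H : Finset X, μ H ≤ h l ∧
      ∀ B : Finset X, Disjoint B H → ∑ x ∈ B, v x ≤ ENNReal.ofReal l * μ B)
    (S : Finset X) : ∀ L : ℝ, 0 ≤ L → (∀ B ⊆ S, ∑ x ∈ B, v x ≤ ENNReal.ofReal L * μ B) →
      ∑ x ∈ S, v x ≤ 4 * ∫⁻ l in Ioc 0 (L / 2), h l := by
  classical
  induction S using Finset.strongInduction with
  | H S ih =>
  intro L hL0 hL
  rcases S.eq_empty_or_nonempty with rfl | hS
  · simp
  obtain ⟨A, hAS, hA, τ', hτ', hAτ, hmax⟩ := hμ.exists_max_density hv hS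
  have hA0 : μ (A : Set X) ≠ 0 := hμ.ne_zero (by exact_mod_cast hA)
  obtain ⟨τ, hτ0, rfl⟩ : ∃ τ : ℝ, 0 ≤ τ ∧ ENNReal.ofReal τ = τ' :=
    ⟨τ'.toReal, ENNReal.toReal_nonneg, ENNReal.ofReal_toReal hτ'⟩
  have hτL : τ ≤ L := by
    have := hL A hAS
    rw [hAτ] at this
    exact (ENNReal.ofReal_le_ofReal_iff hL0).1
      ((ENNReal.mul_le_mul_iff_left hA0 (hμ.ne_top A)).1 this)
  rcases hτ0.eq_or_lt with rfl | hτpos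
  · have := hmax S subset_rfl
    rw [ENNReal.ofReal_zero, zero_mul] at this
    exact this.trans bot_le
  obtain ⟨H, hHh, hHB⟩ := hH (τ / 2) (by positivity)
  have hne : (S ∩ H).Nonempty := by
    by_contra hcon
    have hdis : Disjoint A H := by
      rw [Finset.not_nonempty_iff_eq_empty, ← Finset.disjoint_iff_inter_eq_empty] at hcon
      exact hcon.mono_left hAS
    have := hHB A hdis
    rw [hAτ] at this
    have := (ENNReal.ofReal_le_ofReal_iff (by positivity)).1
      ((ENNReal.mul_le_mul_iff_left hA0 (hμ.ne_top A)).1 this)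
    linarith
  have h1 : ∑ x ∈ S \ H, v x ≤ 4 * ∫⁻ l in Ioc 0 (τ / 4), h l := by
    have := ih (S \ H) (by
      refine Finset.ssubset_iff_subset_ne.2 ⟨Finset.sdiff_subset, fun he => ?_⟩
      obtain ⟨x, hx⟩ := hne
      rw [Finset.mem_inter] at hx
      have hx1 := hx.1
      rw [← he] at hx1
      exact (Finset.mem_sdiff.1 hx1).2 hx.2) (τ / 2) (by positivity)
      (fun B hB => hHB B (Finset.disjoint_of_subset_left hB Finset.sdiff_disjoint))
    rwa [show τ / 2 / 2 = τ / 4 by ring] at this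
  have h2 : ∑ x ∈ S ∩ H, v x ≤ 4 * ∫⁻ l in Ioc (τ / 4) (τ / 2), h l := by
    calc ∑ x ∈ S ∩ H, v x ≤ ENNReal.ofReal τ * μ (S ∩ H : Finset X) :=
          hmax _ Finset.inter_subset_left
      _ ≤ ENNReal.ofReal τ * h (τ / 2) := by
          gcongr
          refine (hμ.mono _ _ ?_).trans hHh
          exact_mod_cast Finset.inter_subset_right
      _ = 4 * ∫⁻ _ in Ioc (τ / 4) (τ / 2), h (τ / 2) := by
          rw [setLIntegral_const, Real.volume_Ioc, mul_comm (h _), ← mul_assoc]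
          congr 1
          rw [show (4 : ℝ≥0∞) = ENNReal.ofReal 4 by norm_num,
            ← ENNReal.ofReal_mul (by norm_num)]
          congr 1
          ring
      _ ≤ _ := by
          gcongr 4 * ?_
          refine setLIntegral_mono' measurableSet_Ioc fun l hl => ?_
          exact hanti _ _ (lt_trans (by positivity) hl.1) hl.2
  calc ∑ x ∈ S, v x = ∑ x ∈ S \ H, v x + ∑ x ∈ S ∩ H, v x := by
        rw [add_comm, Finset.sum_inter_add_sum_sdiff]
    _ ≤ 4 * (∫⁻ l in Ioc 0 (τ / 4), h l) + 4 * ∫⁻ l in Ioc (τ / 4) (τ / 2), h l :=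
        add_le_add h1 h2
    _ = 4 * ∫⁻ l in Ioc 0 (τ / 2), h l := by
        rw [← mul_add, ← lintegral_union measurableSet_Ioc
          (Set.Ioc_disjoint_Ioc_of_le le_rfl), Set.Ioc_union_Ioc_eq_Ioc] <;> linarith
    _ ≤ _ := by
        gcongr 4 * ?_
        exact lintegral_mono_set (Set.Ioc_subset_Ioc_right (by linarith))

/-- A sum is controlled by the integral of the measures of sets off which it has small density. -/
theorem sum_le_four_mul_lintegral [Fintype X] (hμ : IsFiniteOuter μ) {v : X → ℝ≥0∞}
    {h : ℝ → ℝ≥0∞} (hanti : ∀ a b, 0 < a → a ≤ b → h b ≤ h a)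
    (hH : ∀ l, 0 < l → ∃ H : Finset X, μ H ≤ h l ∧
      ∀ B : Finset X, Disjoint B H → ∑ x ∈ B, v x ≤ ENNReal.ofReal l * μ B) :
    ∑ x, v x ≤ 4 * ∫⁻ l in Ioi 0, h l := by
  by_cases hv : ∀ x, v x ≠ ∞
  · rcases (Finset.univ : Finset X).eq_empty_or_nonempty with he | hne
    · simp [he]
    obtain ⟨A, -, -, τ, hτ, -, hmax⟩ := hμ.exists_max_density hv hne
    refine (hμ.sum_le_four_mul_lintegral_Ioc hv hanti hH Finset.univ τ.toReal
      ENNReal.toReal_nonneg fun B hB => ?_).trans ?_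
    · rw [ENNReal.ofReal_toReal hτ]
      exact hmax B hB
    · gcongr 4 * ?_
      exact lintegral_mono_set Set.Ioc_subset_Ioi_self
  · push Not at hv
    obtain ⟨x, hx⟩ := hv
    have hle : ∀ l, 0 < l → μ {x} ≤ h l := by
      intro l hl
      obtain ⟨H, hHh, hHB⟩ := hH l hl
      refine le_trans (hμ.mono _ _ ?_) hHh
      rw [Set.singleton_subset_iff, Finset.mem_coe]
      by_contra hxH
      have := hHB {x} (Finset.disjoint_singleton_left.2 hxH)
      rw [Finset.sum_singleton, hx, Finset.coe_singleton, top_le_iff] at this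
      exact ENNReal.mul_ne_top ENNReal.ofReal_ne_top (hμ.singleton x).2.ne this
    have : ∫⁻ l in Ioi (0 : ℝ), h l = ∞ := by
      rw [← top_le_iff]
      calc ∞ = ∫⁻ _ in Ioi (0 : ℝ), μ {x} := by
            rw [setLIntegral_const, Real.volume_Ioi, ENNReal.mul_top (hμ.singleton x).1.ne']
        _ ≤ _ := setLIntegral_mono' measurableSet_Ioi fun l hl => hle l hl
    rw [this, ENNReal.mul_top (by norm_num)]
    exact le_top

end IsFiniteOuter

/-- If the mass of `v` on the sublevel sets of `t` grows at most linearly, then the moments of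
`t` of order larger than `-1` obey the corresponding power bound. -/
theorem exists_const_sum_mul_rpow_le {β : ℝ} (hβ : -1 < β) :
    ∃ c : ℝ, 0 < c ∧ ∀ (X : Type) (v t : X → ℝ≥0∞) (M : ℝ≥0∞), (∀ x, t x ≠ ∞) →
      ∀ A : Finset X, (∀ σ, ∀ B ⊆ A, (∀ x ∈ B, t x ≤ σ) → ∑ x ∈ B, v x ≤ σ * M) →
      ∀ s, (∀ x ∈ A, t x ≤ s) →
        ∑ x ∈ A, v x * t x ^ β ≤ ENNReal.ofReal c * s ^ (β + 1) * M := by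
  classical
  set δ : ℝ := (1 / 2) ^ (β + 1) with hδ
  have hδ0 : 0 < δ := by positivity
  have hδ1 : δ < 1 := Real.rpow_lt_one (by norm_num) (by norm_num) (by linarith)
  have hc0 : 0 < 2 / (1 - δ) := div_pos two_pos (by linarith)
  refine ⟨2 / (1 - δ), hc0, fun X v t M ht A => ?_⟩
  induction A using Finset.strongInduction with
  | H A ih =>
  intro hA s hs
  rcases A.eq_empty_or_nonempty with rfl | hAn
  · simp
  obtain ⟨y, hyA, hy⟩ := Finset.exists_max_image A t hAn
  rcases eq_or_ne (t y) 0 with hy0 | hy0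
  · have h0 := hA 0 A subset_rfl fun x hx => hy0 ▸ hy x hx
    rw [zero_mul, nonpos_iff_eq_zero, Finset.sum_eq_zero_iff] at h0
    rw [Finset.sum_eq_zero fun x hx => by rw [h0 x hx, zero_mul]]
    exact bot_le
  have hysplit : t y ^ β * t y = t y ^ (β + 1) := by
    rw [ENNReal.rpow_add _ _ hy0 (ht y), ENNReal.rpow_one]
  have hlt : t y / 2 < t y := ENNReal.half_lt_self hy0 (ht y)
  have h1 : ∑ x ∈ A.filter (fun x => t x ≤ t y / 2), v x * t x ^ β ≤
      ENNReal.ofReal (2 / (1 - δ)) * (ENNReal.ofReal δ * t y ^ (β + 1)) * M := by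
    have hhalf : (t y / 2) ^ (β + 1) = ENNReal.ofReal δ * t y ^ (β + 1) := by
      rw [div_eq_mul_inv, ENNReal.mul_rpow_of_nonneg _ _ (by linarith), mul_comm, hδ,
        ← ENNReal.ofReal_rpow_of_pos (by norm_num)]
      congr 2
      rw [one_div, ENNReal.ofReal_inv_of_pos two_pos]
      norm_num
    rw [← hhalf]
    refine ih (A.filter fun x => t x ≤ t y / 2) (Finset.filter_ssubset.2 ⟨y, hyA, not_le.2 hlt⟩)
      (fun σ B hB => hA σ B
      (hB.trans (Finset.filter_subset _ _))) _ fun x hx => (Finset.mem_filter.1 hx).2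
  have h2 : ∑ x ∈ A.filter (fun x => ¬ t x ≤ t y / 2), v x * t x ^ β ≤
      2 * t y ^ (β + 1) * M := by
    have hpt : ∀ x ∈ A.filter (fun x => ¬ t x ≤ t y / 2), t x ^ β ≤ 2 * t y ^ β := by
      intro x hx
      obtain ⟨hxA, hx⟩ := Finset.mem_filter.1 hx
      rcases le_or_gt 0 β with hb | hb
      · calc t x ^ β ≤ t y ^ β := ENNReal.rpow_le_rpow (hy x hxA) hb
          _ ≤ 2 * t y ^ β := le_mul_of_one_le_left' (by norm_num)
      · have h3 : (t x ^ β) ≤ (t y / 2) ^ β := by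
          rw [← neg_neg β, ENNReal.rpow_neg, ENNReal.rpow_neg _ (-β), ENNReal.inv_le_inv]
          exact ENNReal.rpow_le_rpow (not_le.1 hx).le (by linarith)
        refine h3.trans ?_
        rw [div_eq_mul_inv, ENNReal.mul_rpow_of_ne_top (ht y) (by norm_num), mul_comm,
          ENNReal.inv_rpow, ← ENNReal.rpow_neg]
        gcongr
        calc (2 : ℝ≥0∞) ^ (-β) ≤ 2 ^ (1 : ℝ) :=
              ENNReal.rpow_le_rpow_of_exponent_le (by norm_num) (by linarith)
          _ = 2 := ENNReal.rpow_one 2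
    calc _ ≤ ∑ x ∈ A.filter (fun x => ¬ t x ≤ t y / 2), v x * (2 * t y ^ β) :=
          Finset.sum_le_sum fun x hx => by gcongr; exact hpt x hx
      _ = (∑ x ∈ A.filter (fun x => ¬ t x ≤ t y / 2), v x) * (2 * t y ^ β) := by
          rw [Finset.sum_mul]
      _ ≤ (t y * M) * (2 * t y ^ β) := by
          gcongr
          exact hA _ _ (Finset.filter_subset _ _) fun x hx => hy x (Finset.mem_filter.1 hx).1
      _ = _ := by rw [← hysplit]; ring
  calc ∑ x ∈ A, v x * t x ^ β
      ≤ ENNReal.ofReal (2 / (1 - δ)) * (ENNReal.ofReal δ * t y ^ (β + 1)) * M +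
          2 * t y ^ (β + 1) * M := by
        rw [← Finset.sum_filter_add_sum_filter_not A (fun x => t x ≤ t y / 2)]
        exact add_le_add h1 h2
    _ = (ENNReal.ofReal (2 / (1 - δ)) * ENNReal.ofReal δ + ENNReal.ofReal 2) *
          t y ^ (β + 1) * M := by
        rw [show ENNReal.ofReal 2 = 2 by norm_num]; ring
    _ = ENNReal.ofReal (2 / (1 - δ)) * t y ^ (β + 1) * M := by
        rw [← ENNReal.ofReal_mul hc0.le, ← ENNReal.ofReal_add (by positivity) two_pos.le]
        congr 3
        have : (1 - δ) ≠ 0 := by linarith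
        field_simp
        ring
    _ ≤ _ := by
        gcongr
        · linarith
        · exact hs y hyA

section Sizes

variable {X : Type} {μ : Set X → ℝ≥0∞} {ω : X → ℝ≥0∞}

theorem supF_top_le_iff {f : X → ℝ≥0∞} {α : ℝ≥0∞} :
    supF μ ω ∞ f ≤ α ↔ ∀ x, f x ≤ α := by
  simp only [supF, ellF, if_true, iSup_le_iff]
  exact ⟨fun h x => h {x} x rfl, fun h _ x _ => h x⟩

theorem supF_le_iff [Fintype X] (hμ : IsFiniteOuter μ) {r : ℝ≥0∞} (hr0 : r ≠ 0) (hr : r ≠ ∞)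
    {f : X → ℝ≥0∞} {α : ℝ≥0∞} :
    supF μ ω r f ≤ α ↔
      ∀ B : Finset X, ∑ x ∈ B, ω x * f x ^ r.toReal ≤ α ^ r.toReal * μ B := by
  classical
  have key : ∀ B : Finset X, ellF μ ω r f B ≤ α ↔
      ∑ x ∈ B, ω x * f x ^ r.toReal ≤ α ^ r.toReal * μ B := by
    intro B
    rw [ellF, if_neg hr, ENNReal.rpow_inv_le_iff (ENNReal.toReal_pos hr0 hr),
      Finset.tsum_subtype' B fun x => ω x * f x ^ r.toReal]
    rcases B.eq_empty_or_nonempty with rfl | hB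
    · simp [hμ.empty]
    · rw [ENNReal.inv_mul_le_iff (hμ.ne_zero (by exact_mod_cast hB)) (hμ.ne_top B), mul_comm]
  rw [supF, iSup_le_iff]
  refine ⟨fun h B => (key B).1 (h B), fun h A => ?_⟩
  have := (key A.toFinset).2 (h _)
  rwa [Set.coe_toFinset] at this

theorem supF_zero [Fintype X] (hμ : IsFiniteOuter μ) {r : ℝ≥0∞} (hr0 : r ≠ 0) :
    supF μ ω r (fun _ => 0) = 0 := by
  rw [← nonpos_iff_eq_zero]
  by_cases hr : r = ∞
  · subst hr
    exact supF_top_le_iff.2 fun _ => le_rfl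
  · refine (supF_le_iff hμ hr0 hr).2 fun B => ?_
    simp [ENNReal.zero_rpow_of_pos (ENNReal.toReal_pos hr0 hr)]

/-- To bound the size of a restricted function it suffices to test subsets of the restriction. -/
theorem supF_indicator_le [Fintype X] (hμ : IsFiniteOuter μ) {r : ℝ≥0∞} (hr0 : r ≠ 0)
    (hr : r ≠ ∞) {f : X → ℝ≥0∞} {α : ℝ≥0∞} {A : Set X}
    (h : ∀ B : Finset X, (∀ x ∈ B, x ∉ A) →
      ∑ x ∈ B, ω x * f x ^ r.toReal ≤ α ^ r.toReal * μ B) :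
    supF μ ω r (Aᶜ.indicator f) ≤ α := by
  classical
  refine (supF_le_iff hμ hr0 hr).2 fun B => ?_
  calc ∑ x ∈ B, ω x * Aᶜ.indicator f x ^ r.toReal
      = ∑ x ∈ B.filter (· ∉ A), ω x * f x ^ r.toReal := by
        rw [Finset.sum_filter]
        refine Finset.sum_congr rfl fun x _ => ?_
        by_cases hx : x ∈ A
        · simp [hx, ENNReal.zero_rpow_of_pos (ENNReal.toReal_pos hr0 hr)]
        · simp [hx]
    _ ≤ α ^ r.toReal * μ (B.filter (· ∉ A) : Finset X) :=
        h _ fun x hx => (Finset.mem_filter.1 hx).2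
    _ ≤ α ^ r.toReal * μ B := by
        gcongr
        exact hμ.mono _ _ (by exact_mod_cast Finset.filter_subset _ _)

theorem supF_const_mul {r : ℝ≥0∞} (hr0 : r ≠ 0) (c : ℝ≥0∞) (f : X → ℝ≥0∞) :
    supF μ ω r (fun x => c * f x) = c * supF μ ω r f := by
  rw [supF, supF, ENNReal.mul_iSup]
  congr 1
  ext A
  by_cases hr : r = ∞
  · simp only [ellF, hr, if_true, ENNReal.mul_iSup]
  · have hR := ENNReal.toReal_pos hr0 hr
    simp only [ellF, if_neg hr, ENNReal.mul_rpow_of_nonneg _ _ hR.le, mul_left_comm (ω _),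
      ENNReal.tsum_mul_left, mul_left_comm (μ A)⁻¹]
    rw [ENNReal.mul_rpow_of_nonneg _ _ (inv_nonneg.2 hR.le), ENNReal.rpow_rpow_inv hR.ne']

theorem slF_le {r : ℝ≥0∞} {f : X → ℝ≥0∞} {lam : ℝ≥0∞} {A : Set X}
    (h : supF μ ω r (Aᶜ.indicator f) ≤ lam) : slF μ ω r f lam ≤ μ A :=
  iInf₂_le A h

theorem slF_anti {r : ℝ≥0∞} {f : X → ℝ≥0∞} {a b : ℝ≥0∞} (hab : a ≤ b) :
    slF μ ω r f b ≤ slF μ ω r f a :=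
  le_iInf₂ fun _ hA => slF_le (hA.trans hab)

theorem exists_slF_eq [Fintype X] (hμ : IsFiniteOuter μ) {r : ℝ≥0∞} (hr0 : r ≠ 0)
    (f : X → ℝ≥0∞) (lam : ℝ≥0∞) :
    ∃ A : Set X, supF μ ω r (Aᶜ.indicator f) ≤ lam ∧ μ A = slF μ ω r f lam := by
  classical
  obtain ⟨A, hA, hmin⟩ := Finset.exists_min_image
    (Finset.univ.filter fun A : Set X => supF μ ω r (Aᶜ.indicator f) ≤ lam) μ ⟨univ, by
      simp [supF_zero (ω := ω) hμ hr0]⟩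
  have hA' := (Finset.mem_filter.1 hA).2
  refine ⟨A, hA', le_antisymm (le_iInf₂ fun B hB => hmin B ?_) (slF_le hA')⟩
  exact Finset.mem_filter.2 ⟨Finset.mem_univ _, hB⟩

theorem slF_const_mul {r : ℝ≥0∞} (hr0 : r ≠ 0) {c : ℝ≥0∞} (hc0 : c ≠ 0) (hc : c ≠ ∞)
    (f : X → ℝ≥0∞) (lam : ℝ≥0∞) :
    slF μ ω r (fun x => c * f x) (c * lam) = slF μ ω r f lam := by
  have : ∀ A : Set X, Aᶜ.indicator (fun x => c * f x) = fun x => c * Aᶜ.indicator f x := by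
    intro A
    ext x
    by_cases hx : x ∈ A <;> simp [hx]
  simp only [slF, this, supF_const_mul hr0 c, ENNReal.mul_le_mul_iff_right hc0 hc]

/-- Change of variables `λ = (l / a) ^ P`. -/
theorem lintegral_comp_mul_rpow_inv {P a : ℝ} (hP : 0 < P) (ha : 0 < a) (φ : ℝ → ℝ≥0∞) :
    ∫⁻ l in Ioi (0 : ℝ), φ (a * l ^ P⁻¹) =
      ENNReal.ofReal (a ^ (-P)) *
        ∫⁻ l in Ioi (0 : ℝ), ENNReal.ofReal (P * l ^ (P - 1)) * φ l := by
  have himg : (fun l : ℝ => a ^ (-P) * l ^ P) '' Ioi 0 = Ioi 0 := by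
    ext y
    constructor
    · rintro ⟨l, hl, rfl⟩
      have hl : 0 < l := hl
      exact mem_Ioi.2 (by positivity)
    · intro hy
      have hy : 0 < y := hy
      refine ⟨a * y ^ P⁻¹, mem_Ioi.2 (by positivity), ?_⟩
      dsimp only
      rw [Real.mul_rpow ha.le (by positivity), Real.rpow_inv_rpow hy.le hP.ne', ← mul_assoc,
        ← Real.rpow_add ha, neg_add_cancel, Real.rpow_zero, one_mul]
  have hinj : InjOn (fun l : ℝ => a ^ (-P) * l ^ P) (Ioi 0) := by
    intro x hx y hy hxy
    have hx : 0 < x := hx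
    have hy : 0 < y := hy
    exact (Real.rpow_left_inj hx.le hy.le hP.ne').1
      (mul_left_cancel₀ (Real.rpow_pos_of_pos ha _).ne' hxy)
  have hder : ∀ x ∈ Ioi (0 : ℝ), HasDerivWithinAt (fun l : ℝ => a ^ (-P) * l ^ P)
      (a ^ (-P) * (P * x ^ (P - 1))) (Ioi 0) x := fun x hx =>
    ((Real.hasDerivAt_rpow_const (Or.inl (ne_of_gt hx))).const_mul _).hasDerivWithinAt
  have hcv := lintegral_image_eq_lintegral_abs_deriv_mul measurableSet_Ioi hder hinj
    (fun l => φ (a * l ^ P⁻¹))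
  rw [himg] at hcv
  rw [hcv, ← lintegral_const_mul' _ _ ENNReal.ofReal_ne_top]
  refine setLIntegral_congr_fun measurableSet_Ioi fun l hl => ?_
  have hl : 0 < l := hl
  have h1 : a * (a ^ (-P) * l ^ P) ^ P⁻¹ = l := by
    rw [Real.mul_rpow (by positivity) (by positivity), ← Real.rpow_mul ha.le,
      Real.rpow_rpow_inv hl.le hP.ne', neg_mul, mul_inv_cancel₀ hP.ne', Real.rpow_neg_one,
      mul_inv_cancel_left₀ ha.ne']
  simp only [h1]
  rw [abs_of_pos (by positivity), ENNReal.ofReal_mul (by positivity), mul_assoc]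

theorem LpF_rpow {p r : ℝ≥0∞} (hp0 : p ≠ 0) (hp : p ≠ ∞) (f : X → ℝ≥0∞) :
    LpF μ ω p r f ^ p.toReal = ∫⁻ l in Ioi (0 : ℝ),
      ENNReal.ofReal (p.toReal * l ^ (p.toReal - 1)) * slF μ ω r f (ENNReal.ofReal l) := by
  rw [LpF, if_neg hp, ENNReal.rpow_inv_rpow (ENNReal.toReal_pos hp0 hp).ne']

theorem lintegral_slF {p r : ℝ≥0∞} (hp0 : p ≠ 0) (hp : p ≠ ∞) {a : ℝ} (ha : 0 < a)
    (f : X → ℝ≥0∞) :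
    ∫⁻ l in Ioi (0 : ℝ), slF μ ω r f (ENNReal.ofReal (a * l ^ p.toReal⁻¹)) =
      ENNReal.ofReal (a ^ (-p.toReal)) * LpF μ ω p r f ^ p.toReal := by
  rw [LpF_rpow hp0 hp, lintegral_comp_mul_rpow_inv (ENNReal.toReal_pos hp0 hp) ha
    (fun l => slF μ ω r f (ENNReal.ofReal l))]

theorem LpF_const_mul {p r : ℝ≥0∞} (hp0 : p ≠ 0) (hr0 : r ≠ 0) {c : ℝ≥0∞} (hc0 : c ≠ 0)
    (hc : c ≠ ∞) (f : X → ℝ≥0∞) :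
    LpF μ ω p r (fun x => c * f x) = c * LpF μ ω p r f := by
  by_cases hp : p = ∞
  · simp only [LpF, if_pos hp, supF_const_mul hr0 c]
  obtain ⟨a, rfl⟩ : ∃ a : ℝ, ENNReal.ofReal a = c := ⟨c.toReal, ENNReal.ofReal_toReal hc⟩
  have ha : 0 < a := by simpa using hc0
  have hP := ENNReal.toReal_pos hp0 hp
  rw [← (ENNReal.rpow_left_injective hP.ne').eq_iff, ENNReal.mul_rpow_of_nonneg _ _ hP.le]
  have h1 := lintegral_slF (μ := μ) (ω := ω) (r := r) hp0 hp ha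
    (fun x => ENNReal.ofReal a * f x)
  have h2 := lintegral_slF (μ := μ) (ω := ω) (r := r) hp0 hp one_pos f
  simp only [ENNReal.ofReal_mul ha.le, slF_const_mul hr0 hc0 hc] at h1
  simp only [one_mul, Real.one_rpow, ENNReal.ofReal_one] at h2
  rw [h2] at h1
  rw [h1, ← mul_assoc, ENNReal.ofReal_rpow_of_pos ha, ← ENNReal.ofReal_mul (by positivity),
    ← Real.rpow_add ha, add_neg_cancel, Real.rpow_zero, ENNReal.ofReal_one, one_mul]

end Sizes

theorem lintegral_slF_le_one {X : Type} {μ : Set X → ℝ≥0∞} {ω : X → ℝ≥0∞}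
    (hμ : IsFiniteOuter μ) {p r : ℝ≥0∞} (hp0 : p ≠ 0)
    {f : X → ℝ≥0∞} {F : ℝ} (hF0 : 0 < F) (hF : LpF μ ω p r f ≤ ENNReal.ofReal F) :
    ∫⁻ l in Ioi (0 : ℝ), slF μ ω r f (ENNReal.ofReal (F * l ^ (p⁻¹).toReal)) ≤ 1 := by
  by_cases hp : p = ∞
  · subst hp
    rw [LpF, if_pos rfl] at hF
    have : slF μ ω r f (ENNReal.ofReal F) = 0 := by
      rw [← nonpos_iff_eq_zero, ← hμ.empty]
      exact slF_le (by simpa using hF)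
    simp [this]
  · rw [ENNReal.toReal_inv, lintegral_slF hp0 hp hF0, Real.rpow_neg hF0.le]
    have hP := ENNReal.toReal_pos hp0 hp
    calc ENNReal.ofReal (F ^ p.toReal)⁻¹ * LpF μ ω p r f ^ p.toReal
        ≤ ENNReal.ofReal (F ^ p.toReal)⁻¹ * ENNReal.ofReal F ^ p.toReal := by gcongr
      _ = 1 := by
        rw [ENNReal.ofReal_rpow_of_pos hF0, ← ENNReal.ofReal_mul (by positivity),
          inv_mul_cancel₀ (by positivity), ENNReal.ofReal_one]

section Holder

variable {X : Type} [Fintype X] {μ : Set X → ℝ≥0∞} {ω : X → ℝ≥0∞}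

theorem sum_mul_le_of_size_le (hμ : IsFiniteOuter μ) (hω : ∀ x, 0 < ω x ∧ ω x < ∞)
    {r s : ℝ≥0∞} (hrs : r⁻¹ + s⁻¹ = 1) {f g : X → ℝ≥0∞} {α β : ℝ≥0∞}
    (hf : supF μ ω r f ≤ α) (hg : supF μ ω s g ≤ β) (B : Finset X) :
    ∑ x ∈ B, ω x * (f x * g x) ≤ α * β * μ B := by
  have hconj : ENNReal.HolderConjugate r s := ENNReal.holderConjugate_iff.2 hrs
  rcases eq_or_ne r ∞ with rfl | hr
  · obtain rfl : s = 1 := by simpa using hrs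
    have hg' := (supF_le_iff hμ one_ne_zero ENNReal.one_ne_top).1 hg B
    simp only [ENNReal.toReal_one, ENNReal.rpow_one] at hg'
    calc ∑ x ∈ B, ω x * (f x * g x) ≤ ∑ x ∈ B, α * (ω x * g x) := by
          refine Finset.sum_le_sum fun x _ => ?_
          rw [mul_left_comm]
          gcongr
          exact supF_top_le_iff.1 hf x
      _ ≤ α * (β * μ B) := by rw [← Finset.mul_sum]; gcongr
      _ = _ := (mul_assoc _ _ _).symm
  rcases eq_or_ne s ∞ with rfl | hs
  · obtain rfl : r = 1 := by simpa using hrs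
    have hf' := (supF_le_iff hμ one_ne_zero ENNReal.one_ne_top).1 hf B
    simp only [ENNReal.toReal_one, ENNReal.rpow_one] at hf'
    calc ∑ x ∈ B, ω x * (f x * g x) ≤ ∑ x ∈ B, ω x * f x * β := by
          refine Finset.sum_le_sum fun x _ => ?_
          rw [← mul_assoc]
          gcongr
          exact supF_top_le_iff.1 hg x
      _ ≤ α * μ B * β := by rw [← Finset.sum_mul]; gcongr
      _ = _ := mul_right_comm _ _ _
  have hRS : r.toReal.HolderConjugate s.toReal := ENNReal.HolderConjugate.toReal_of_ne_top hr hs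
  have hr0 : r ≠ 0 := by rintro rfl; exact hRS.ne_zero rfl
  have hs0 : s ≠ 0 := by rintro rfl; exact hRS.symm.ne_zero rfl
  have hsplit : ∀ (w : ℝ≥0∞), w ≠ 0 → w ≠ ∞ → w ^ r.toReal⁻¹ * w ^ s.toReal⁻¹ = w :=
    fun w h0 h1 => by
      rw [← ENNReal.rpow_add _ _ h0 h1, hRS.inv_add_inv_eq_one, ENNReal.rpow_one]
  rcases B.eq_empty_or_nonempty with rfl | hB
  · simp
  calc ∑ x ∈ B, ω x * (f x * g x)
      = ∑ x ∈ B, (ω x ^ r.toReal⁻¹ * f x) * (ω x ^ s.toReal⁻¹ * g x) := by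
        refine Finset.sum_congr rfl fun x _ => ?_
        rw [mul_mul_mul_comm, hsplit _ (hω x).1.ne' (hω x).2.ne]
    _ ≤ (∑ x ∈ B, (ω x ^ r.toReal⁻¹ * f x) ^ r.toReal) ^ (1 / r.toReal) *
          (∑ x ∈ B, (ω x ^ s.toReal⁻¹ * g x) ^ s.toReal) ^ (1 / s.toReal) :=
        ENNReal.inner_le_Lp_mul_Lq B _ _ hRS
    _ = (∑ x ∈ B, ω x * f x ^ r.toReal) ^ r.toReal⁻¹ *
          (∑ x ∈ B, ω x * g x ^ s.toReal) ^ s.toReal⁻¹ := by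
        simp only [one_div, ENNReal.mul_rpow_of_nonneg _ _ hRS.nonneg,
          ENNReal.mul_rpow_of_nonneg _ _ hRS.symm.nonneg, ENNReal.rpow_inv_rpow hRS.ne_zero,
          ENNReal.rpow_inv_rpow hRS.symm.ne_zero]
    _ ≤ (α ^ r.toReal * μ B) ^ r.toReal⁻¹ * (β ^ s.toReal * μ B) ^ s.toReal⁻¹ :=
        mul_le_mul'
          (ENNReal.rpow_le_rpow ((supF_le_iff hμ hr0 hr).1 hf B) hRS.inv_nonneg)
          (ENNReal.rpow_le_rpow ((supF_le_iff hμ hs0 hs).1 hg B) hRS.symm.inv_nonneg)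
    _ = α * β * μ B := by
        rw [ENNReal.mul_rpow_of_nonneg _ _ hRS.inv_nonneg,
          ENNReal.mul_rpow_of_nonneg _ _ hRS.symm.inv_nonneg, ENNReal.rpow_rpow_inv hRS.ne_zero,
          ENNReal.rpow_rpow_inv hRS.symm.ne_zero, mul_mul_mul_comm,
          hsplit _ (hμ.ne_zero (by exact_mod_cast hB)) (hμ.ne_top B)]

/-- Outer Hölder inequality for the pairing on `X`. -/
theorem sum_mul_le_of_LpF_le (hμ : IsFiniteOuter μ) (hω : ∀ x, 0 < ω x ∧ ω x < ∞)
    {p q r s : ℝ≥0∞} (hpq : p⁻¹ + q⁻¹ = 1) (hrs : r⁻¹ + s⁻¹ = 1) {f g : X → ℝ≥0∞} {F G : ℝ}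
    (hF0 : 0 < F) (hG0 : 0 < G) (hF : LpF μ ω p r f ≤ ENNReal.ofReal F)
    (hG : LpF μ ω q s g ≤ ENNReal.ofReal G) :
    ∑ x, ω x * (f x * g x) ≤ 8 * (ENNReal.ofReal F * ENNReal.ofReal G) := by
  classical
  have hp0 : p ≠ 0 := by rintro rfl; simp at hpq
  have hq0 : q ≠ 0 := by rintro rfl; simp at hpq
  have hr0 : r ≠ 0 := by rintro rfl; simp at hrs
  have hs0 : s ≠ 0 := by rintro rfl; simp at hrs
  have hexp : (p⁻¹).toReal + (q⁻¹).toReal = 1 := by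
    rw [← ENNReal.toReal_add (by simpa using hp0) (by simpa using hq0), hpq, ENNReal.toReal_one]
  set K : ℝ≥0∞ := ENNReal.ofReal F * ENNReal.ofReal G with hK
  have hK0 : K ≠ 0 := by simp [hK, hF0, hG0]
  have hKt : K ≠ ∞ := ENNReal.mul_ne_top ENNReal.ofReal_ne_top ENNReal.ofReal_ne_top
  have hmono : ∀ c : ℝ, 0 < c → ∀ e : ℝ, 0 ≤ e → ∀ a b : ℝ, 0 < a → a ≤ b →
      ENNReal.ofReal (c * a ^ e) ≤ ENNReal.ofReal (c * b ^ e) := by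
    intro c hc e he a b ha hab
    gcongr
  have hmeas : Measurable fun l : ℝ =>
      slF μ ω r f (ENNReal.ofReal (F * max l 0 ^ (p⁻¹).toReal)) := by
    refine Antitone.measurable fun a b hab => slF_anti ?_
    gcongr
  have main := hμ.sum_le_four_mul_lintegral (v := fun x => K⁻¹ * (ω x * (f x * g x)))
    (h := fun l => slF μ ω r f (ENNReal.ofReal (F * l ^ (p⁻¹).toReal)) +
      slF μ ω s g (ENNReal.ofReal (G * l ^ (q⁻¹).toReal)))
    (fun a b ha hab => add_le_add
      (slF_anti (hmono F hF0 _ ENNReal.toReal_nonneg a b ha hab))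
      (slF_anti (hmono G hG0 _ ENNReal.toReal_nonneg a b ha hab))) ?_
  · have h_int : ∫⁻ l in Ioi (0 : ℝ),
        (slF μ ω r f (ENNReal.ofReal (F * l ^ (p⁻¹).toReal)) +
          slF μ ω s g (ENNReal.ofReal (G * l ^ (q⁻¹).toReal))) ≤ 2 := by
      rw [lintegral_add_left' ((hmeas.aemeasurable).congr ?_)]
      · calc _ ≤ (1 : ℝ≥0∞) + 1 :=
              add_le_add (lintegral_slF_le_one hμ hp0 hF0 hF)
                (lintegral_slF_le_one hμ hq0 hG0 hG)
          _ = 2 := by norm_num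
      · filter_upwards [ae_restrict_mem measurableSet_Ioi] with l hl
        rw [max_eq_left (le_of_lt hl)]
    rw [← Finset.mul_sum] at main
    have h8 := main.trans (mul_le_mul_right h_int 4)
    rw [ENNReal.inv_mul_le_iff hK0 hKt] at h8
    refine h8.trans_eq ?_
    rw [mul_comm]
    norm_num
  · intro l hl
    obtain ⟨A, hA, hAe⟩ := exists_slF_eq (ω := ω) hμ hr0 f
      (ENNReal.ofReal (F * l ^ (p⁻¹).toReal))
    obtain ⟨A', hA', hAe'⟩ := exists_slF_eq (ω := ω) hμ hs0 g
      (ENNReal.ofReal (G * l ^ (q⁻¹).toReal))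
    refine ⟨(A ∪ A').toFinset, ?_, fun B hB => ?_⟩
    · rw [Set.coe_toFinset, ← hAe, ← hAe']
      exact hμ.union_le _ _
    · rw [← Finset.mul_sum, ENNReal.inv_mul_le_iff hK0 hKt]
      have hnot : ∀ x ∈ B, x ∉ A ∧ x ∉ A' := by
        intro x hx
        have := Finset.disjoint_left.1 hB hx
        simpa using this
      have h1 := sum_mul_le_of_size_le hμ hω hrs hA hA' B
      have h2 : ∑ x ∈ B, ω x * (f x * g x) =
          ∑ x ∈ B, ω x * (Aᶜ.indicator f x * A'ᶜ.indicator g x) :=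
        Finset.sum_congr rfl fun x hx => by simp [(hnot x hx).1, (hnot x hx).2]
      rw [h2]
      refine h1.trans_eq ?_
      rw [ENNReal.ofReal_mul hF0.le, ENNReal.ofReal_mul hG0.le, mul_mul_mul_comm, ← hK,
        ← ENNReal.ofReal_mul (by positivity), ← Real.rpow_add hl, hexp, Real.rpow_one, mul_assoc]

theorem sum_mul_le_LpF (hμ : IsFiniteOuter μ) (hω : ∀ x, 0 < ω x ∧ ω x < ∞)
    {p q r s : ℝ≥0∞} (hpq : p⁻¹ + q⁻¹ = 1) (hrs : r⁻¹ + s⁻¹ = 1) {f g : X → ℝ≥0∞}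
    (hf : LpF μ ω p r f ≠ ∞) (hg : LpF μ ω q s g ≠ ∞) :
    ∑ x, ω x * (f x * g x) ≤ 8 * (LpF μ ω p r f * LpF μ ω q s g) := by
  set a := LpF μ ω p r f
  set b := LpF μ ω q s g
  have key : ∀ ε : ℝ, 0 < ε → ∑ x, ω x * (f x * g x) ≤
      8 * ((a + ENNReal.ofReal ε) * (b + ENNReal.ofReal ε)) := by
    intro ε hε
    have h : ∀ c : ℝ≥0∞, c ≠ ∞ → ENNReal.ofReal (c.toReal + ε) = c + ENNReal.ofReal ε := by
      intro c hc
      rw [ENNReal.ofReal_add ENNReal.toReal_nonneg hε.le, ENNReal.ofReal_toReal hc]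
    have := sum_mul_le_of_LpF_le hμ hω hpq hrs (f := f) (g := g)
      (F := a.toReal + ε) (G := b.toReal + ε) (by positivity) (by positivity)
      (by rw [h a hf]; exact le_self_add) (by rw [h b hg]; exact le_self_add)
    rwa [h a hf, h b hg] at this
  have hlim : Filter.Tendsto
      (fun ε : ℝ => 8 * ((a + ENNReal.ofReal ε) * (b + ENNReal.ofReal ε)))
      (nhdsWithin 0 (Ioi 0)) (nhds (8 * ((a + ENNReal.ofReal 0) * (b + ENNReal.ofReal 0)))) := by
    have h0 : ∀ c : ℝ≥0∞, Filter.Tendsto (fun ε : ℝ => c + ENNReal.ofReal ε)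
        (nhdsWithin 0 (Ioi 0)) (nhds (c + ENNReal.ofReal 0)) := fun c =>
      ((continuous_const.add ENNReal.continuous_ofReal).tendsto 0).mono_left nhdsWithin_le_nhds
    refine ENNReal.Tendsto.const_mul (ENNReal.Tendsto.mul (h0 a) (Or.inr ?_) (h0 b) (Or.inr ?_))
      (Or.inr (by norm_num))
    · simpa using hg
    · simpa using hf
  simp only [ENNReal.ofReal_zero, add_zero] at hlim
  exact ge_of_tendsto hlim (by filter_upwards [self_mem_nhdsWithin] with ε hε using key ε hε)

end Holder

/-- Every `f` of nonzero outer norm has a function `g` that almost attains the dual pairing, with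
constant `C` independent of the setting. -/
def HasDualWitness (p r q s C : ℝ≥0∞) : Prop :=
  ∀ (X : Type) (_ : Fintype X) (μ : Set X → ℝ≥0∞) (ω : X → ℝ≥0∞), IsFiniteOuter μ →
    (∀ x, 0 < ω x ∧ ω x < ∞) → ∀ f : X → ℝ≥0∞, (∀ x, f x ≠ ∞) → LpF μ ω p r f ≠ 0 →
      LpF μ ω p r f ≠ ∞ ∧ ∃ g : X → ℝ≥0∞, ∑ x, ω x * (f x * g x) ≠ 0 ∧ LpF μ ω q s g ≠ ∞ ∧
        LpF μ ω p r f * LpF μ ω q s g ≤ C * ∑ x, ω x * (f x * g x)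

section Witness

variable {X : Type} {μ : Set X → ℝ≥0∞} {ω : X → ℝ≥0∞}

theorem lintegral_sum_levels_le [Fintype X] {v t : X → ℝ≥0∞} {κ : ℝ} (hκ : 0 < κ)
    (ht : ∀ x, t x ≠ ∞) (hv : ∀ x, t x = 0 → v x = 0) :
    ∫⁻ l in Ioi (0 : ℝ), (∑ x, if ENNReal.ofReal (l ^ κ⁻¹) < t x then v x / t x else 0) ≤
      ∑ x, v x * t x ^ (κ - 1) := by
  have htκ : ∀ x, t x ^ κ ≠ ∞ := fun x => ENNReal.rpow_ne_top_of_nonneg hκ.le (ht x)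
  calc _ ≤ ∫⁻ l in Ioi (0 : ℝ),
          ∑ x, (Ioc 0 (t x ^ κ).toReal).indicator (fun _ => v x / t x) l := by
        refine setLIntegral_mono' measurableSet_Ioi fun l hl => Finset.sum_le_sum fun x _ => ?_
        have hl : 0 < l := hl
        split_ifs with h
        · rw [Set.indicator_of_mem]
          refine ⟨hl, (ENNReal.ofReal_le_iff_le_toReal (htκ x)).1 ?_⟩
          have := ENNReal.rpow_le_rpow h.le hκ.le
          rwa [ENNReal.ofReal_rpow_of_pos (by positivity), Real.rpow_inv_rpow hl.le hκ.ne']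
            at this
        · exact bot_le
    _ = ∑ x, ∫⁻ l in Ioi (0 : ℝ),
          (Ioc 0 (t x ^ κ).toReal).indicator (fun _ => v x / t x) l :=
        lintegral_finsetSum _ fun x _ => measurable_const.indicator measurableSet_Ioc
    _ ≤ _ := by
        refine Finset.sum_le_sum fun x _ => ?_
        calc _ ≤ ∫⁻ l, (Ioc 0 (t x ^ κ).toReal).indicator (fun _ => v x / t x) l :=
              setLIntegral_le_lintegral _ _
          _ = v x / t x * t x ^ κ := by
              rw [lintegral_indicator measurableSet_Ioc, setLIntegral_const, Real.volume_Ioc,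
                sub_zero, ENNReal.ofReal_toReal (htκ x)]
          _ ≤ v x * t x ^ (κ - 1) := by
              rcases eq_or_ne (t x) 0 with h0 | h0
              · simp [hv x h0]
              · rw [ENNReal.rpow_sub _ _ h0 (ht x), ENNReal.rpow_one, div_eq_mul_inv,
                  div_eq_mul_inv, mul_assoc, mul_comm (t x)⁻¹]

theorem LpF_le_of_levels {q s : ℝ≥0∞} (hq0 : q ≠ 0) (hq : q ≠ ∞) {N : ℝ≥0∞} {E : ℝ → Set X}
    (hN : ∫⁻ l in Ioi (0 : ℝ), μ (E l) ≤ N) {a : ℝ} (ha : 0 < a) {φ : X → ℝ≥0∞}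
    (h : ∀ l, 0 < l →
      supF μ ω s ((E l)ᶜ.indicator φ) ≤ ENNReal.ofReal (a * l ^ q.toReal⁻¹)) :
    LpF μ ω q s φ ≤ ENNReal.ofReal a * N ^ q.toReal⁻¹ := by
  have hQ := ENNReal.toReal_pos hq0 hq
  have h1 : ENNReal.ofReal (a ^ (-q.toReal)) * LpF μ ω q s φ ^ q.toReal ≤ N := by
    rw [← lintegral_slF hq0 hq ha]
    exact (setLIntegral_mono' measurableSet_Ioi fun l hl => slF_le (h l hl)).trans hN
  have haQ : 0 < a ^ q.toReal := by positivity
  rw [Real.rpow_neg ha.le, ENNReal.ofReal_inv_of_pos haQ,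
    ENNReal.inv_mul_le_iff (by simpa using haQ) ENNReal.ofReal_ne_top,
    ← ENNReal.ofReal_rpow_of_pos ha, ← ENNReal.le_rpow_inv_iff hQ,
    ENNReal.mul_rpow_of_nonneg _ _ (inv_nonneg.2 hQ.le), ENNReal.rpow_rpow_inv hQ.ne'] at h1
  exact h1

theorem exists_levels [Fintype X] (hμ : IsFiniteOuter μ) (hω : ∀ x, 0 < ω x ∧ ω x < ∞)
    {p r : ℝ≥0∞} (hp0 : p ≠ 0) (hp : p ≠ ∞) (hr0 : r ≠ 0) (hr : r ≠ ∞) {f : X → ℝ≥0∞}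
    (hf : ∀ x, f x ≠ ∞) :
    ∃ t : X → ℝ≥0∞, (∀ x, t x ≠ ∞) ∧ (∀ x, t x = 0 → ω x * f x ^ r.toReal = 0) ∧
      (∀ s, ∀ B : Finset X, (∀ x ∈ B, t x ≤ s) →
        ∑ x ∈ B, ω x * f x ^ r.toReal ≤ s * μ B) ∧
      (∫⁻ l in Ioi (0 : ℝ), μ {x | ENNReal.ofReal (l ^ (p.toReal / r.toReal)⁻¹) < t x} ≤
        ∑ x, ω x * f x ^ r.toReal * t x ^ (p.toReal / r.toReal - 1)) ∧
      LpF μ ω p r f ≤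
        (∑ x, ω x * f x ^ r.toReal * t x ^ (p.toReal / r.toReal - 1)) ^ p.toReal⁻¹ := by
  have hP := ENNReal.toReal_pos hp0 hp
  have hR := ENNReal.toReal_pos hr0 hr
  obtain ⟨t, ht, h1, h2⟩ := hμ.exists_selection (v := fun x => ω x * f x ^ r.toReal)
    fun x => ENNReal.mul_ne_top (hω x).2.ne (ENNReal.rpow_ne_top_of_nonneg hR.le (hf x))
  have hv : ∀ x, t x = 0 → ω x * f x ^ r.toReal = 0 := by
    intro x hx
    simpa using h1 0 {x} (by simp [hx])
  have hN := (lintegral_mono fun l => h2 (ENNReal.ofReal (l ^ (p.toReal / r.toReal)⁻¹))).trans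
    (lintegral_sum_levels_le (div_pos hP hR) ht hv)
  refine ⟨t, ht, hv, h1, hN, ?_⟩
  have := LpF_le_of_levels (ω := ω) (s := r) (φ := f) hp0 hp hN one_pos fun l hl => ?_
  · simpa using this
  · refine supF_indicator_le hμ hr0 hr fun B hB => ?_
    have hB' := h1 (ENNReal.ofReal (l ^ (p.toReal / r.toReal)⁻¹)) B
      fun x hx => not_lt.1 (hB x hx)
    refine hB'.trans_eq ?_
    rw [one_mul, ENNReal.ofReal_rpow_of_pos (by positivity), ← Real.rpow_mul hl.le, inv_div,
      div_eq_inv_mul]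

/-- A function supported on `A` of size at most `K` has `L^1` norm at most `K * μ A`. -/
theorem LpF_one_le [Fintype X] (hμ : IsFiniteOuter μ) {s : ℝ≥0∞} (hs0 : s ≠ 0)
    {g : X → ℝ≥0∞} {A : Set X} {K : ℝ≥0∞} (hK : K ≠ ∞) (hA : ∀ x, x ∉ A → g x = 0)
    (hg : supF μ ω s g ≤ K) : LpF μ ω 1 s g ≤ K * μ A := by
  have hsup : supF μ ω s (Aᶜ.indicator g) = 0 := by
    rw [← supF_zero (ω := ω) hμ hs0]
    congr 1
    ext x
    by_cases hx : x ∈ A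
    · simp [hx]
    · simp [hx, hA x hx]
  rw [LpF, if_neg ENNReal.one_ne_top]
  simp only [ENNReal.toReal_one, sub_self, Real.rpow_zero, mul_one, ENNReal.ofReal_one, one_mul,
    inv_one, ENNReal.rpow_one]
  calc ∫⁻ l in Ioi (0 : ℝ), slF μ ω s g (ENNReal.ofReal l)
      ≤ ∫⁻ l in Ioi (0 : ℝ), (Ioc 0 K.toReal).indicator (fun _ => μ A) l := by
        refine setLIntegral_mono' measurableSet_Ioi fun l hl => ?_
        by_cases hlK : l ≤ K.toReal
        · rw [Set.indicator_of_mem (Set.mem_Ioc.2 ⟨hl, hlK⟩)]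
          exact slF_le (by rw [hsup]; exact bot_le)
        · have : slF μ ω s g (ENNReal.ofReal l) ≤ μ ∅ := by
            refine slF_le ?_
            rw [Set.compl_empty, Set.indicator_univ]
            exact hg.trans ((ENNReal.le_ofReal_iff_toReal_le hK (le_of_lt hl)).2
              (not_le.1 hlK).le)
          rw [hμ.empty] at this
          exact this.trans bot_le
    _ ≤ ∫⁻ l, (Ioc 0 K.toReal).indicator (fun _ => μ A) l := setLIntegral_le_lintegral _ _
    _ = K * μ A := by
        rw [lintegral_indicator measurableSet_Ioc, setLIntegral_const, Real.volume_Ioc,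
          sub_zero, ENNReal.ofReal_toReal hK, mul_comm]

end Witness

theorem hasDualWitness_one_one : HasDualWitness 1 1 ∞ ∞ 1 := by
  intro X _ μ ω hμ hω f hf hf0
  obtain ⟨t, -, -, -, -, hle⟩ := exists_levels hμ hω one_ne_zero ENNReal.one_ne_top one_ne_zero
    ENNReal.one_ne_top hf
  simp only [ENNReal.toReal_one, div_one, sub_self, ENNReal.rpow_zero, mul_one, ENNReal.rpow_one,
    inv_one] at hle
  have hfin : ∑ x, ω x * f x ≠ ∞ :=
    ENNReal.sum_ne_top.2 fun x _ => ENNReal.mul_ne_top (hω x).2.ne (hf x)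
  have hg : LpF μ ω ∞ ∞ (fun _ => 1) ≤ 1 := by
    rw [LpF, if_pos rfl]
    exact supF_top_le_iff.2 fun _ => le_rfl
  refine ⟨ne_top_of_le_ne_top hfin hle, fun _ => 1, ?_, ne_top_of_le_ne_top ENNReal.one_ne_top hg,
    ?_⟩
  · simp only [mul_one]
    exact fun h => hf0 (nonpos_iff_eq_zero.1 (hle.trans_eq h))
  · simp only [mul_one, one_mul]
    exact (mul_le_mul' hle hg).trans_eq (mul_one _)

theorem hasDualWitness_top_top : HasDualWitness ∞ ∞ 1 1 1 := by
  classical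
  intro X _ μ ω hμ hω f hf hf0
  rw [LpF, if_pos rfl] at hf0 ⊢
  rcases isEmpty_or_nonempty X with hX | hX
  · exact absurd (nonpos_iff_eq_zero.1 (supF_top_le_iff.2 fun x => isEmptyElim x)) hf0
  obtain ⟨y, -, hy⟩ := Finset.exists_max_image Finset.univ f Finset.univ_nonempty
  have hle : supF μ ω ∞ f ≤ f y := supF_top_le_iff.2 fun x => hy x (Finset.mem_univ x)
  have hy0 : f y ≠ 0 := fun h => hf0 (nonpos_iff_eq_zero.1 (hle.trans_eq h))
  have hμy := hμ.singleton y
  have hg : LpF μ ω 1 1 (Pi.single y 1) ≤ ω y := by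
    have := LpF_one_le (ω := ω) (s := 1) (g := Pi.single y 1) (A := {y}) (K := ω y / μ {y}) hμ
      one_ne_zero (ENNReal.div_ne_top (hω y).2.ne hμy.1.ne')
      (fun x hx => Pi.single_eq_of_ne hx 1) ?_
    · rwa [ENNReal.div_mul_cancel hμy.1.ne' hμy.2.ne] at this
    · refine (supF_le_iff hμ one_ne_zero ENNReal.one_ne_top).2 fun B => ?_
      simp only [ENNReal.toReal_one, ENNReal.rpow_one, Pi.single_apply, mul_ite, mul_one, mul_zero,
        Finset.sum_ite_eq']
      split_ifs with hyB
      · calc ω y = ω y / μ {y} * μ {y} := (ENNReal.div_mul_cancel hμy.1.ne' hμy.2.ne).symm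
          _ ≤ _ := by
            gcongr
            exact hμ.mono _ _ (by simpa using hyB)
      · exact bot_le
  have hP : ∑ x, ω x * (f x * (Pi.single y 1 : X → ℝ≥0∞) x) = ω y * f y := by
    simp [Pi.single_apply]
  refine ⟨ne_top_of_le_ne_top (hf y) hle, Pi.single y 1, ?_,
    ne_top_of_le_ne_top (hω y).2.ne hg, ?_⟩
  · rw [hP]
    exact mul_ne_zero (hω y).1.ne' hy0
  · rw [hP, one_mul, mul_comm (ω y)]
    exact mul_le_mul' hle hg

theorem mul_rpow_sub_one {R : ℝ} (hR : 1 ≤ R) (x : ℝ≥0∞) : x * x ^ (R - 1) = x ^ R := by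
  calc x * x ^ (R - 1) = x ^ (1 : ℝ) * x ^ (R - 1) := by rw [ENNReal.rpow_one]
    _ = x ^ R := by
      rw [← ENNReal.rpow_add_of_nonneg _ _ zero_le_one (by linarith), add_sub_cancel]

theorem one_le_toReal_of_inv_add_inv {r s : ℝ≥0∞} (hrs : r⁻¹ + s⁻¹ = 1) (hr : r ≠ ∞) :
    1 ≤ r.toReal := by
  have : 1 ≤ r := by
    rw [← ENNReal.inv_le_one, ← hrs]
    exact le_self_add
  simpa using ENNReal.toReal_mono hr this

theorem hasDualWitness_top {r s : ℝ≥0∞} (hr : r ≠ ∞) (hrs : r⁻¹ + s⁻¹ = 1) :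
    HasDualWitness ∞ r 1 s 1 := by
  classical
  intro X _ μ ω hμ hω f hf hf0
  rw [LpF, if_pos rfl] at hf0 ⊢
  have hconj : ENNReal.HolderConjugate r s := ENNReal.holderConjugate_iff.2 hrs
  have hr0 : r ≠ 0 := by rintro rfl; simp at hrs
  have hs0 : s ≠ 0 := by rintro rfl; simp at hrs
  have hR := ENNReal.toReal_pos hr0 hr
  have hR1 := one_le_toReal_of_inv_add_inv hrs hr
  rcases isEmpty_or_nonempty X with hX | hX
  · refine absurd (nonpos_iff_eq_zero.1 ((supF_le_iff hμ hr0 hr).2 fun B => ?_)) hf0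
    simp [Finset.eq_empty_of_isEmpty B]
  obtain ⟨A, -, hA, τ, hτ, hAτ, hmax⟩ := hμ.exists_max_density
    (v := fun x => ω x * f x ^ r.toReal)
    (fun x => ENNReal.mul_ne_top (hω x).2.ne (ENNReal.rpow_ne_top_of_nonneg hR.le (hf x)))
    Finset.univ_nonempty
  have hle : supF μ ω r f ≤ τ ^ r.toReal⁻¹ := by
    refine (supF_le_iff hμ hr0 hr).2 fun B => ?_
    rw [ENNReal.rpow_inv_rpow hR.ne']
    exact hmax B (Finset.subset_univ B)
  have hτ0 : τ ≠ 0 := by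
    rintro rfl
    rw [ENNReal.zero_rpow_of_pos (inv_pos.2 hR)] at hle
    exact hf0 (nonpos_iff_eq_zero.1 hle)
  have hθ : 0 ≤ 1 - r.toReal⁻¹ := sub_nonneg.2 (inv_le_one_of_one_le₀ hR1)
  set g : X → ℝ≥0∞ := fun x => if x ∈ A then f x ^ (r.toReal - 1) else 0 with hgdef
  have hsup : supF μ ω s g ≤ τ ^ (1 - r.toReal⁻¹) := by
    rcases eq_or_ne s ∞ with rfl | hs
    · obtain rfl : r = 1 := by simpa using hrs
      refine supF_top_le_iff.2 fun x => ?_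
      simp only [hgdef, ENNReal.toReal_one, sub_self, inv_one, ENNReal.rpow_zero]
      split_ifs <;> simp
    · have hRS : r.toReal.HolderConjugate s.toReal :=
        ENNReal.HolderConjugate.toReal_of_ne_top hr hs
      refine (supF_le_iff hμ hs0 hs).2 fun B => ?_
      rw [hRS.one_sub_inv, ENNReal.rpow_inv_rpow hRS.symm.ne_zero]
      refine le_trans (Finset.sum_le_sum fun x _ => ?_) (hmax B (Finset.subset_univ B))
      gcongr
      simp only [hgdef]
      split_ifs
      · rw [← ENNReal.rpow_mul, hRS.sub_one_mul_conj]
      · rw [ENNReal.zero_rpow_of_pos hRS.symm.pos]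
        exact bot_le
  have hθτ : τ ^ (1 - r.toReal⁻¹) ≠ ∞ := ENNReal.rpow_ne_top_of_nonneg hθ hτ
  have hg : LpF μ ω 1 s g ≤ τ ^ (1 - r.toReal⁻¹) * μ A :=
    LpF_one_le hμ hs0 hθτ (fun x hx => if_neg hx) hsup
  have hP : ∑ x, ω x * (f x * g x) = τ * μ A := by
    rw [← hAτ, ← Finset.sum_filter_add_sum_filter_not Finset.univ (· ∈ A),
      Finset.sum_eq_zero (s := Finset.univ.filter fun x => ¬ x ∈ A), add_zero]
    · rw [Finset.filter_mem_eq_inter, Finset.univ_inter]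
      refine Finset.sum_congr rfl fun x hx => ?_
      simp only [hgdef, if_pos hx, mul_rpow_sub_one hR1]
    · intro x hx
      simp [hgdef, (Finset.mem_filter.1 hx).2]
  refine ⟨ne_top_of_le_ne_top (ENNReal.rpow_ne_top_of_nonneg (inv_nonneg.2 hR.le) hτ) hle, g, ?_,
    ne_top_of_le_ne_top (ENNReal.mul_ne_top hθτ (hμ.ne_top A)) hg, ?_⟩
  · rw [hP]
    exact mul_ne_zero hτ0 (hμ.ne_zero (by exact_mod_cast hA))
  · rw [hP, one_mul]
    refine (mul_le_mul' hle hg).trans_eq ?_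
    rw [← mul_assoc, ← ENNReal.rpow_add _ _ hτ0 hτ, add_sub_cancel, ENNReal.rpow_one]

/-- The dual function `t ^ (p / r - 1) * f ^ (r - 1)` has size at most a multiple of
`l ^ (1 / q)` off the level set `{t > l ^ (r / p)}`. -/
theorem exists_const_supF_dual_le {p q r s : ℝ≥0∞} (hp : p ≠ ∞) (hq : q ≠ ∞)
    (hr : r ≠ ∞) (hpq : p⁻¹ + q⁻¹ = 1) (hrs : r⁻¹ + s⁻¹ = 1) :
    ∃ a : ℝ, 0 < a ∧ ∀ (X : Type) (_ : Fintype X) (μ : Set X → ℝ≥0∞) (ω : X → ℝ≥0∞),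
      IsFiniteOuter μ → ∀ f t : X → ℝ≥0∞, (∀ x, t x ≠ ∞) →
      (∀ σ, ∀ B : Finset X, (∀ x ∈ B, t x ≤ σ) →
        ∑ x ∈ B, ω x * f x ^ r.toReal ≤ σ * μ B) →
      ∀ l : ℝ, 0 < l →
        supF μ ω s ({x | ENNReal.ofReal (l ^ (p.toReal / r.toReal)⁻¹) < t x}ᶜ.indicator
          fun x => t x ^ (p.toReal / r.toReal - 1) * f x ^ (r.toReal - 1)) ≤
        ENNReal.ofReal (a * l ^ q.toReal⁻¹) := by
  have hcpq : ENNReal.HolderConjugate p q := ENNReal.holderConjugate_iff.2 hpq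
  have hcrs : ENNReal.HolderConjugate r s := ENNReal.holderConjugate_iff.2 hrs
  have hPQ : p.toReal.HolderConjugate q.toReal := ENNReal.HolderConjugate.toReal_of_ne_top hp hq
  have hP := hPQ.pos
  have hP1 := hPQ.lt
  rcases eq_or_ne s ∞ with rfl | hs
  · obtain rfl : r = 1 := by simpa using hrs
    refine ⟨1, one_pos, fun X _ μ ω hμ f t ht h1 l hl => supF_top_le_iff.2 fun x => ?_⟩
    simp only [ENNReal.toReal_one, div_one, sub_self, ENNReal.rpow_zero, mul_one, one_mul]
    by_cases hx : ENNReal.ofReal (l ^ p.toReal⁻¹) < t x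
    · rw [Set.indicator_of_notMem (by simpa using hx)]
      exact bot_le
    · rw [Set.indicator_of_mem (by simpa using hx)]
      refine (ENNReal.rpow_le_rpow (not_lt.1 hx) hPQ.sub_one_pos.le).trans_eq ?_
      rw [ENNReal.ofReal_rpow_of_pos (by positivity), ← Real.rpow_mul hl.le, ← hPQ.one_sub_inv]
      congr 2
      field_simp
  have hRS : r.toReal.HolderConjugate s.toReal := ENNReal.HolderConjugate.toReal_of_ne_top hr hs
  have hR := hRS.pos
  have hS := hRS.symm.pos
  have hs0 : s ≠ 0 := by rintro rfl; exact hS.ne' rfl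
  set κ : ℝ := p.toReal / r.toReal with hκ
  have hβ : (κ - 1) * s.toReal + 1 = (p.toReal - 1) / r.toReal * s.toReal := by
    have h1 : r.toReal⁻¹ * s.toReal = s.toReal - 1 := by
      rw [← div_eq_inv_mul, hRS.symm.div_conj_eq_sub_one]
    rw [hκ, sub_div, sub_mul, sub_mul, one_div, h1]
    ring
  have hβpos : 0 < (κ - 1) * s.toReal + 1 := by
    rw [hβ]
    exact mul_pos (div_pos hPQ.sub_one_pos hR) hS
  have hexp : κ⁻¹ * ((κ - 1) * s.toReal + 1) = q.toReal⁻¹ * s.toReal := by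
    rw [hβ, hκ, ← hPQ.one_sub_inv]
    field_simp
  obtain ⟨c, hc, hcX⟩ := exists_const_sum_mul_rpow_le
    (show -1 < (κ - 1) * s.toReal by linarith)
  refine ⟨c ^ s.toReal⁻¹, by positivity, fun X _ μ ω hμ f t ht h1 l hl =>
    supF_indicator_le hμ hs0 hs fun B hB => ?_⟩
  have hB' := hcX X (fun x => ω x * f x ^ r.toReal) t (μ B) ht B
    (fun σ B' hBB' hσ => (h1 σ B' hσ).trans (by
      gcongr
      exact hμ.mono _ _ (by exact_mod_cast hBB')))
    (ENNReal.ofReal (l ^ κ⁻¹)) (fun x hx => not_lt.1 (hB x hx))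
  calc ∑ x ∈ B, ω x * (t x ^ (κ - 1) * f x ^ (r.toReal - 1)) ^ s.toReal
      = ∑ x ∈ B, ω x * f x ^ r.toReal * t x ^ ((κ - 1) * s.toReal) := by
        refine Finset.sum_congr rfl fun x _ => ?_
        rw [ENNReal.mul_rpow_of_nonneg _ _ hS.le, ← ENNReal.rpow_mul, ← ENNReal.rpow_mul,
          hRS.sub_one_mul_conj, mul_assoc, mul_comm (t x ^ _)]
    _ ≤ _ := hB'
    _ = _ := by
        rw [ENNReal.ofReal_rpow_of_pos (by positivity), ← Real.rpow_mul hl.le, hexp,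
          ← ENNReal.ofReal_mul hc.le, ENNReal.ofReal_rpow_of_pos (by positivity),
          Real.mul_rpow (by positivity) (by positivity), Real.rpow_inv_rpow hc.le hS.ne',
          ← Real.rpow_mul hl.le]

theorem exists_hasDualWitness {p q r s : ℝ≥0∞} (hp0 : p ≠ 0) (hp : p ≠ ∞) (hq : q ≠ ∞)
    (hr : r ≠ ∞) (hpq : p⁻¹ + q⁻¹ = 1) (hrs : r⁻¹ + s⁻¹ = 1) :
    ∃ C, C ≠ ∞ ∧ HasDualWitness p r q s C := by
  obtain ⟨a, ha, haX⟩ := exists_const_supF_dual_le hp hq hr hpq hrs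
  refine ⟨ENNReal.ofReal a, ENNReal.ofReal_ne_top, fun X _ μ ω hμ hω f hf hf0 => ?_⟩
  have hr0 : r ≠ 0 := by rintro rfl; simp at hrs
  have hq0 : q ≠ 0 := by rintro rfl; simp at hpq
  have hP := ENNReal.toReal_pos hp0 hp
  have hQ := ENNReal.toReal_pos hq0 hq
  have hR := ENNReal.toReal_pos hr0 hr
  have hcpq : ENNReal.HolderConjugate p q := ENNReal.holderConjugate_iff.2 hpq
  have hPQ : p.toReal.HolderConjugate q.toReal := ENNReal.HolderConjugate.toReal_of_ne_top hp hq
  obtain ⟨t, ht, hv, h1, hN, hle⟩ := exists_levels hμ hω hp0 hp hr0 hr hf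
  have hP' : ∑ x, ω x * (f x * (t x ^ (p.toReal / r.toReal - 1) * f x ^ (r.toReal - 1))) =
      ∑ x, ω x * f x ^ r.toReal * t x ^ (p.toReal / r.toReal - 1) := by
    refine Finset.sum_congr rfl fun x _ => ?_
    rw [← mul_rpow_sub_one (one_le_toReal_of_inv_add_inv hrs hr) (f x)]
    ring
  have hg := LpF_le_of_levels (ω := ω) (s := s) hq0 hq hN ha
    (haX X inferInstance μ ω hμ f t ht h1)
  set N := ∑ x, ω x * f x ^ r.toReal * t x ^ (p.toReal / r.toReal - 1) with hNdef
  have hNt : N ≠ ∞ := by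
    refine ENNReal.sum_ne_top.2 fun x _ => ?_
    by_cases hx : t x = 0
    · simp [hv x hx]
    · exact ENNReal.mul_ne_top
        (ENNReal.mul_ne_top (hω x).2.ne (ENNReal.rpow_ne_top_of_nonneg hR.le (hf x)))
        (ENNReal.rpow_ne_top_of_ne_zero hx (ht x))
  have hN0 : N ≠ 0 := by
    intro h
    rw [h, ENNReal.zero_rpow_of_pos (inv_pos.2 hP)] at hle
    exact hf0 (nonpos_iff_eq_zero.1 hle)
  refine ⟨ne_top_of_le_ne_top (ENNReal.rpow_ne_top_of_nonneg (inv_nonneg.2 hP.le) hNt) hle,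
    fun x => t x ^ (p.toReal / r.toReal - 1) * f x ^ (r.toReal - 1), ?_,
    ne_top_of_le_ne_top (ENNReal.mul_ne_top ENNReal.ofReal_ne_top
      (ENNReal.rpow_ne_top_of_nonneg (inv_nonneg.2 hQ.le) hNt)) hg, ?_⟩
  · rwa [hP']
  · rw [hP']
    refine (mul_le_mul' hle hg).trans_eq ?_
    rw [mul_left_comm, ← ENNReal.rpow_add _ _ hN0 hNt, hPQ.inv_add_inv_eq_one, ENNReal.rpow_one]

theorem inv_add_inv_conjE {p : ℝ≥0∞} (hp : 1 ≤ p) : p⁻¹ + (conjE p)⁻¹ = 1 := by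
  rw [conjE, inv_inv, add_tsub_cancel_of_le (ENNReal.inv_le_one.2 hp)]

theorem conjE_one : conjE 1 = ∞ := by simp [conjE]

theorem conjE_top : conjE ∞ = 1 := by simp [conjE]

theorem conjE_ne_top {p : ℝ≥0∞} (hp : 1 < p) : conjE p ≠ ∞ := by
  rw [conjE, ENNReal.inv_ne_top]
  exact (tsub_pos_of_lt (ENNReal.inv_lt_one.2 hp)).ne'

theorem exists_hasDualWitness_conjE {p r : ℝ≥0∞}
    (hpr : (1 < p ∧ 1 ≤ r ∧ r ≠ ∞) ∨ (p = r ∧ (p = 1 ∨ p = ∞))) :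
    ∃ C, C ≠ ∞ ∧ HasDualWitness p r (conjE p) (conjE r) C := by
  rcases hpr with ⟨hp1, hr1, hr⟩ | ⟨rfl, rfl | rfl⟩
  · rcases eq_or_ne p ∞ with rfl | hp
    · rw [conjE_top]
      exact ⟨1, ENNReal.one_ne_top, hasDualWitness_top hr (inv_add_inv_conjE hr1)⟩
    · exact exists_hasDualWitness (zero_lt_one.trans hp1).ne' hp (conjE_ne_top hp1) hr
        (inv_add_inv_conjE hp1.le) (inv_add_inv_conjE hr1)
  · rw [conjE_one]
    exact ⟨1, ENNReal.one_ne_top, hasDualWitness_one_one⟩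
  · rw [conjE_top]
    exact ⟨1, ENNReal.one_ne_top, hasDualWitness_top_top⟩

/-- A dual witness can be normalized, which bounds the outer norm by the dual supremum. -/
theorem HasDualWitness.LpF_le {p q r s C : ℝ≥0∞} (hC : HasDualWitness p r q s C)
    (hpq : p⁻¹ + q⁻¹ = 1) (hrs : r⁻¹ + s⁻¹ = 1) {X : Type} [Fintype X] {μ : Set X → ℝ≥0∞}
    {ω : X → ℝ≥0∞} (hμ : IsFiniteOuter μ) (hω : ∀ x, 0 < ω x ∧ ω x < ∞) {f : X → ℝ≥0∞}
    (hf : ∀ x, f x ≠ ∞) :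
    LpF μ ω p r f ≤
      C * ⨆ (g : X → ℝ≥0∞) (_ : LpF μ ω q s g = 1), ∑ x, ω x * (f x * g x) := by
  rcases eq_or_ne (LpF μ ω p r f) 0 with hf0 | hf0
  · rw [hf0]
    exact bot_le
  have hq0 : q ≠ 0 := by rintro rfl; simp at hpq
  have hs0 : s ≠ 0 := by rintro rfl; simp at hrs
  obtain ⟨hft, g, hP, hg, hle⟩ := hC X inferInstance μ ω hμ hω f hf hf0
  have hg0 : LpF μ ω q s g ≠ 0 := by
    intro h
    have := sum_mul_le_LpF hμ hω hpq hrs hft hg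
    rw [h, mul_zero, mul_zero] at this
    exact hP (nonpos_iff_eq_zero.1 this)
  have hnorm : LpF μ ω q s (fun x => (LpF μ ω q s g)⁻¹ * g x) = 1 := by
    rw [LpF_const_mul hq0 hs0 (ENNReal.inv_ne_zero.2 hg) (ENNReal.inv_ne_top.2 hg0),
      ENNReal.inv_mul_cancel hg0 hg]
  calc LpF μ ω p r f ≤ C * (∑ x, ω x * (f x * g x)) / LpF μ ω q s g :=
        (ENNReal.le_div_iff_mul_le (Or.inl hg0) (Or.inl hg)).2 hle
    _ = C * ∑ x, ω x * (f x * ((LpF μ ω q s g)⁻¹ * g x)) := by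
        rw [div_eq_mul_inv, mul_assoc, Finset.sum_mul]
        congr 1
        exact Finset.sum_congr rfl fun x _ => by ring
    _ ≤ _ := by
        gcongr
        exact le_iSup₂_of_le (f := fun (g : X → ℝ≥0∞) (_ : LpF μ ω q s g = 1) =>
          ∑ x, ω x * (f x * g x)) _ hnorm le_rfl


/-- Uniform Köthe duality in the finite setting (Theorem 1.1(ii)): for `1 < p ≤ ∞`,
`1 ≤ r < ∞` or `p = r ∈ {1,∞}` there is a constant `C = C(p,r)`, uniform in the finite
outer measure setting `(X, μ, ω)`, such that the outer `L^p(ℓ^r)` quasi-norm of `f` is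
comparable with `sup { ‖fg‖_{L^1(X,ω)} : ‖g‖_{L^{p'}(ℓ^{r'})} = 1 }`. -/
theorem kothe_duality_finite (p r : ℝ≥0∞)
    (hpr : (1 < p ∧ 1 ≤ r ∧ r ≠ ∞) ∨ (p = r ∧ (p = 1 ∨ p = ∞))) :
    ∃ C : ℝ≥0∞, 0 < C ∧ C ≠ ∞ ∧
      ∀ (X : Type) (_ : Fintype X) (μ : Set X → ℝ≥0∞) (ω : X → ℝ≥0∞),
        μ ∅ = 0 →
        (∀ A B : Set X, A ⊆ B → μ A ≤ μ B) →
        (∀ A B : Set X, μ (A ∪ B) ≤ μ A + μ B) →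
        (∀ x : X, 0 < μ {x} ∧ μ {x} < ∞) →
        (∀ x : X, 0 < ω x ∧ ω x < ∞) →
        ∀ f : X → ℝ≥0∞, (∀ x, f x ≠ ∞) →
          C⁻¹ * (⨆ (g : X → ℝ≥0∞) (_ : LpF μ ω (conjE p) (conjE r) g = 1),
              ∑' x, ω x * (f x * g x)) ≤ LpF μ ω p r f ∧
          LpF μ ω p r f ≤
            C * ⨆ (g : X → ℝ≥0∞) (_ : LpF μ ω (conjE p) (conjE r) g = 1),
              ∑' x, ω x * (f x * g x) := by
  obtain ⟨C, hC, hwit⟩ := exists_hasDualWitness_conjE hpr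
  have hp1 : 1 ≤ p := by
    rcases hpr with ⟨h, -⟩ | ⟨-, rfl | rfl⟩
    exacts [h.le, le_rfl, le_top]
  have hr1 : 1 ≤ r := by
    rcases hpr with ⟨-, h, -⟩ | ⟨rfl, -⟩
    exacts [h, hp1]
  have hpq := inv_add_inv_conjE hp1
  have hrs := inv_add_inv_conjE hr1
  have hC0 : 8 + C ≠ 0 := by simp
  have hCt : 8 + C ≠ ∞ := ENNReal.add_ne_top.2 ⟨by norm_num, hC⟩
  refine ⟨8 + C, pos_iff_ne_zero.2 hC0, hCt, fun X _ μ ω h0 h1 h2 h3 hω f hf => ?_⟩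
  have hμ : IsFiniteOuter μ := ⟨h0, h1, h2, h3⟩
  simp only [tsum_fintype]
  constructor
  · rw [ENNReal.inv_mul_le_iff hC0 hCt]
    refine iSup₂_le fun g hg => ?_
    rcases eq_or_ne (LpF μ ω p r f) ∞ with hft | hft
    · rw [hft, ENNReal.mul_top hC0]
      exact le_top
    · refine (sum_mul_le_LpF hμ hω hpq hrs hft (by simp [hg])).trans ?_
      rw [hg, mul_one]
      gcongr
      exact le_self_add
  · refine (hwit.LpF_le hpq hrs hμ hω hf).trans ?_
    gcongr
    exact le_add_self

end
end

section
/- Uniform quasi-triangle inequality in the finite setting (Theorem 1.1(iii)): For every pair (p,r) with either 1 < p ≤ ∞ and 1 ≤ r < ∞, or p = r ∈ {1, ∞}, there exists a constant C = C(p,r) such that for every finite outer measure setting (X, μ, ω) and every sequence {f_n}_{n∈ℕ} of nonnegative functions on X, ‖Σ_{n∈ℕ} f_n‖_{L^p(ℓ^r)} ≤ C Σ_{n∈ℕ} ‖f_n‖_{L^p(ℓ^r)}. The constant C is independent of X, μ and ω. -/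
open MeasureTheory Set
open scoped ENNReal

noncomputable section

/-- A finite outer measure setting. -/
structure IsFiniteOuterSetting {X : Type} (μ : Set X → ℝ≥0∞) (ω : X → ℝ≥0∞) : Prop where
  empty : μ ∅ = 0
  mono : ∀ A B : Set X, A ⊆ B → μ A ≤ μ B
  union_le : ∀ A B : Set X, μ (A ∪ B) ≤ μ A + μ B
  singleton : ∀ x : X, 0 < μ {x} ∧ μ {x} < ∞
  weight : ∀ x : X, 0 < ω x ∧ ω x < ∞

/-- The integral of `g` over `A` against the weight `ω`. -/
def wsum {X : Type} (ω g : X → ℝ≥0∞) (A : Set X) : ℝ≥0∞ := ∑' x : A, ω x * g x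

/-- The integral `p ∫ l^(p-1) φ(l) dl` defining outer quasi-norms. -/
def layerInt (q : ℝ) (φ : ℝ≥0∞ → ℝ≥0∞) : ℝ≥0∞ :=
  ∫⁻ l in Ioi (0:ℝ), ENNReal.ofReal (q * l ^ (q - 1)) * φ (ENNReal.ofReal l)

section TwoPow

lemma two_rpow_ne_zero (t : ℝ) : (2 : ℝ≥0∞) ^ t ≠ 0 := by simp

lemma two_rpow_ne_top (t : ℝ) : (2 : ℝ≥0∞) ^ t ≠ ∞ := by simp

lemma two_rpow_add (s t : ℝ) : (2 : ℝ≥0∞) ^ (s + t) = 2 ^ s * 2 ^ t :=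
  ENNReal.rpow_add s t (by simp) (by simp)

lemma ofReal_two_rpow (t : ℝ) : ENNReal.ofReal ((2 : ℝ) ^ t) = 2 ^ t := by
  rw [← ENNReal.ofReal_rpow_of_pos (by norm_num)]; simp

lemma natCast_le_two_rpow {t : ℝ} (ht : 1 ≤ t) (n : ℕ) : (n : ℝ≥0∞) ≤ 2 ^ ((n : ℝ) * t) := by
  calc (n : ℝ≥0∞) ≤ ((2 ^ n : ℕ) : ℝ≥0∞) := by exact_mod_cast n.lt_two_pow_self.le
    _ = 2 ^ (n : ℝ) := by simp
    _ ≤ 2 ^ ((n : ℝ) * t) := by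
      apply ENNReal.rpow_le_rpow_of_exponent_le (by norm_num)
      nlinarith [n.cast_nonneg (α := ℝ)]

lemma tsum_two_rpow_neg_ne_top {t : ℝ} (ht : 0 < t) :
    ∑' i : ℕ, (2 : ℝ≥0∞) ^ (-((i : ℝ) * t)) ≠ ∞ := by
  have h : ∀ i : ℕ, (2 : ℝ≥0∞) ^ (-((i : ℝ) * t)) = (2 ^ (-t)) ^ i := fun i => by
    rw [← ENNReal.rpow_natCast, ← ENNReal.rpow_mul]; ring_nf
  simp_rw [h, ENNReal.tsum_geometric]
  rw [Ne, ENNReal.inv_eq_top, tsub_eq_zero_iff_le, not_le]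
  exact ENNReal.rpow_lt_one_of_one_lt_of_neg (by norm_num) (by linarith)

/-- A double sum along shifts of `ℤ` with geometrically decaying coefficients. -/
lemma tsum_tsum_shift (a : ℕ → ℝ≥0∞) (b : ℤ → ℝ≥0∞) :
    ∑' k : ℤ, ∑' i : ℕ, a i * b (k + i) = (∑' i, a i) * ∑' k, b k := by
  rw [ENNReal.tsum_comm, ← ENNReal.tsum_mul_right]
  refine tsum_congr fun i => ?_
  rw [ENNReal.tsum_mul_left, (Equiv.addRight (i : ℤ)).tsum_eq b |>.symm]
  rfl

/-- Membership in one dyadic level but not in all higher ones gives a last level. -/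
lemma exists_mem_diff_shift {X : Type} {D : ℤ → Set X} {x : X} {k : ℤ} (hk : x ∈ D k)
    (hJ : ∃ J, ∀ j ≥ J, D j = ∅) : ∃ i : ℕ, x ∈ D (k + i) \ D (k + i + 1) := by
  by_contra! h
  have hall : ∀ i : ℕ, x ∈ D (k + i) := by
    intro i
    induction i with
    | zero => simpa using hk
    | succ i ih =>
      by_contra hn
      exact h i ⟨ih, fun hm => hn (by push_cast; rwa [← add_assoc])⟩
  obtain ⟨J, hJ⟩ := hJ
  have := hall (J - k).toNat
  rw [hJ _ (by have := Int.self_le_toNat (J - k); omega)] at this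
  exact this

end TwoPow

section Layer

variable {φ : ℝ≥0∞ → ℝ≥0∞} {q : ℝ}

lemma tsum_le_layerInt (hq : 1 ≤ q) (hφ : Antitone φ) {s : ℝ} (hs : 0 < s) :
    ENNReal.ofReal s ^ q * ∑' j : ℤ, 2 ^ ((j : ℝ) * q) * φ (ENNReal.ofReal s * 2 ^ (j : ℝ)) ≤
      2 ^ q * layerInt q φ := by
  set u : ℤ → ℝ := fun j => s * 2 ^ ((j : ℝ) - 1) with hu
  have hu0 : ∀ j, 0 < u j := fun j => by positivity
  have hsucc : ∀ j : ℤ, u (Order.succ j) = 2 * u j := fun j => by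
    simp only [hu, Order.succ_eq_add_one]
    push_cast
    rw [show (j : ℝ) + 1 - 1 = 1 + (j - 1) by ring, Real.rpow_add (by norm_num)]
    simp; ring
  have hmono : Monotone u := fun a b h => by
    have : (a : ℝ) ≤ b := by exact_mod_cast h
    simp only [hu]
    gcongr
    norm_num
  have hlower : ∀ j : ℤ, ENNReal.ofReal s ^ q * (2 ^ ((j : ℝ) * q) *
      φ (ENNReal.ofReal s * 2 ^ (j : ℝ))) ≤
      2 ^ q * ∫⁻ l in Ioc (u j) (u (Order.succ j)),
        ENNReal.ofReal (q * l ^ (q - 1)) * φ (ENNReal.ofReal l) := by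
    intro j
    have h2 : ENNReal.ofReal s * 2 ^ (j : ℝ) = ENNReal.ofReal (2 * u j) := by
      rw [← ofReal_two_rpow, ← ENNReal.ofReal_mul hs.le]
      congr 1
      simp only [hu]
      rw [show (j : ℝ) = 1 + (j - 1) by ring, Real.rpow_add (by norm_num)]
      simp; ring
    have hmono' : ∫⁻ l in Ioc (u j) (u (Order.succ j)),
        ENNReal.ofReal (u j ^ (q - 1)) * φ (ENNReal.ofReal (2 * u j)) ≤
        ∫⁻ l in Ioc (u j) (u (Order.succ j)),
        ENNReal.ofReal (q * l ^ (q - 1)) * φ (ENNReal.ofReal l) := by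
      refine setLIntegral_mono' measurableSet_Ioc fun l hl => ?_
      rw [hsucc] at hl
      gcongr
      · have h1 : u j ^ (q - 1) ≤ l ^ (q - 1) :=
          Real.rpow_le_rpow (hu0 j).le hl.1.le (by linarith)
        have h3 : 0 ≤ l ^ (q - 1) := Real.rpow_nonneg ((hu0 j).trans hl.1).le _
        nlinarith
      · exact hφ (ENNReal.ofReal_le_ofReal hl.2)
    refine le_trans (le_of_eq ?_) (mul_le_mul_right hmono' _)
    rw [setLIntegral_const, Real.volume_Ioc, hsucc, show 2 * u j - u j = u j by ring,
      ENNReal.rpow_mul, ← mul_assoc, ← ENNReal.mul_rpow_of_nonneg _ _ (by linarith), h2,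
      ENNReal.ofReal_mul (by norm_num), ENNReal.mul_rpow_of_nonneg _ _ (by linarith),
      mul_right_comm (ENNReal.ofReal (u j ^ (q - 1))), ← ENNReal.ofReal_mul (by positivity),
      ENNReal.ofReal_rpow_of_pos (hu0 j)]
    have hpow : u j ^ q = u j ^ (q - 1) * u j := by
      rw [Real.rpow_sub_one (hu0 j).ne', div_mul_cancel₀ _ (hu0 j).ne']
    rw [hpow, ENNReal.ofReal_mul (Real.rpow_nonneg (hu0 j).le _)]
    simp [mul_assoc]
  rw [← ENNReal.tsum_mul_left]
  refine (ENNReal.tsum_le_tsum hlower).trans ?_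
  rw [ENNReal.tsum_mul_left, ← lintegral_iUnion (fun _ => measurableSet_Ioc)
    hmono.pairwise_disjoint_on_Ioc_succ]
  refine mul_le_mul_right (lintegral_mono_set ?_) _
  exact iUnion_subset fun j l hl => (hu0 j).trans hl.1

lemma le_layerInt (hq : 1 ≤ q) (hφ : Antitone φ) {s : ℝ} (hs : 0 < s) :
    ENNReal.ofReal s ^ q * φ (ENNReal.ofReal s) ≤ 2 ^ q * layerInt q φ := by
  refine le_trans ?_ (tsum_le_layerInt hq hφ hs)
  gcongr
  refine le_trans (le_of_eq ?_) (ENNReal.le_tsum (0 : ℤ))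
  simp

lemma layerInt_le_tsum (hq : 1 ≤ q) (hφ : Antitone φ) :
    layerInt q φ ≤ ENNReal.ofReal q * 2 ^ q * ∑' k : ℤ, 2 ^ ((k : ℝ) * q) * φ (2 ^ (k : ℝ)) := by
  have hcover : Ioi (0 : ℝ) ⊆ ⋃ k : ℤ, Ioc ((2 : ℝ) ^ k) (2 ^ (k + 1)) := fun l hl => by
    obtain ⟨k, hk⟩ := _root_.exists_mem_Ioc_zpow (K := ℝ) hl (y := 2) (by norm_num)
    exact mem_iUnion.2 ⟨k, hk⟩
  refine (lintegral_mono_set hcover).trans ((lintegral_iUnion_le _ _).trans ?_)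
  rw [← ENNReal.tsum_mul_left]
  refine ENNReal.tsum_le_tsum fun k => ?_
  have h0 : (0 : ℝ) < 2 ^ k := by positivity
  have h1 : (2 : ℝ) ^ (k + 1) = 2 * 2 ^ k := by rw [zpow_add₀ (by norm_num)]; simp; ring
  have hk : ENNReal.ofReal ((2 : ℝ) ^ k) = 2 ^ (k : ℝ) := by
    rw [← ofReal_two_rpow, Real.rpow_intCast]
  have hle : ∫⁻ l in Ioc ((2 : ℝ) ^ k) (2 ^ (k + 1)),
      ENNReal.ofReal (q * l ^ (q - 1)) * φ (ENNReal.ofReal l) ≤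
      ∫⁻ l in Ioc ((2 : ℝ) ^ k) (2 ^ (k + 1)),
      ENNReal.ofReal (q * (2 * 2 ^ k) ^ (q - 1)) * φ (2 ^ (k : ℝ)) := by
    refine setLIntegral_mono' measurableSet_Ioc fun l hl => ?_
    rw [h1] at hl
    gcongr
    · exact (h0.trans hl.1).le
    · exact hl.2
    · rw [← hk]; exact hφ (ENNReal.ofReal_le_ofReal hl.1.le)
  refine hle.trans ?_
  rw [setLIntegral_const, Real.volume_Ioc, h1, mul_right_comm, ← ENNReal.ofReal_mul (by positivity),
    ← mul_assoc]
  gcongr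
  rw [ENNReal.rpow_mul, ← hk, mul_assoc, mul_assoc, ← ENNReal.mul_rpow_of_nonneg _ _ (by linarith),
    ← ENNReal.ofReal_ofNat, ← ENNReal.ofReal_mul (by norm_num), ENNReal.ofReal_rpow_of_pos
    (by positivity), ← ENNReal.ofReal_mul (by linarith)]
  apply ENNReal.ofReal_le_ofReal
  gcongr
  calc (2 * 2 ^ k : ℝ) ^ (q - 1) * (2 * 2 ^ k - 2 ^ k)
      ≤ (2 * 2 ^ k : ℝ) ^ (q - 1) * (2 * 2 ^ k) := by gcongr; linarith
    _ = (2 * 2 ^ k : ℝ) ^ q := by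
      rw [Real.rpow_sub_one (by positivity), div_mul_cancel₀ _ (by positivity)]

end Layer

section WeightedSum

variable {X : Type} {ω g h : X → ℝ≥0∞} {A B : Set X}

lemma wsum_mono_set (hAB : A ⊆ B) : wsum ω g A ≤ wsum ω g B :=
  ENNReal.tsum_mono_subtype (fun x => ω x * g x) hAB

lemma wsum_mono (hgh : ∀ x ∈ A, g x ≤ h x) : wsum ω g A ≤ wsum ω h A :=
  ENNReal.tsum_le_tsum fun x => mul_le_mul_right (hgh x.1 x.2) _

lemma wsum_congr (hgh : ∀ x ∈ A, g x = h x) : wsum ω g A = wsum ω h A :=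
  tsum_congr fun x => by rw [hgh x.1 x.2]

lemma wsum_empty : wsum ω g ∅ = 0 := by simp [wsum]

lemma wsum_singleton (x : X) : wsum ω g {x} = ω x * g x := by simp [wsum]

lemma wsum_union_le : wsum ω g (A ∪ B) ≤ wsum ω g A + wsum ω g B :=
  ENNReal.tsum_union_le (fun x => ω x * g x) A B

lemma wsum_union (hAB : Disjoint A B) : wsum ω g (A ∪ B) = wsum ω g A + wsum ω g B :=
  Summable.tsum_union_disjoint (f := fun x => ω x * g x) hAB ENNReal.summable ENNReal.summable

lemma wsum_le_tsum {ι : Type*} {t : ι → Set X} (hA : A ⊆ ⋃ i, t i) :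
    wsum ω g A ≤ ∑' i, wsum ω g (t i) :=
  (wsum_mono_set hA).trans (ENNReal.tsum_iUnion_le_tsum (fun x => ω x * g x) t)

lemma tsum_wsum_le {ι : Type*} {t : ι → Set X} (ht : Pairwise (Function.onFun Disjoint t)) :
    ∑' i, wsum ω g (t i) ≤ wsum ω g univ := by
  refine le_trans (le_of_eq ?_) (wsum_mono_set (subset_univ (⋃ i, t i)))
  exact (ENNReal.tsum_biUnion (f := fun x => ω x * g x) fun i _ j _ hij => ht hij).symm

lemma wsum_tsum {ι : Type*} (f : ι → X → ℝ≥0∞) :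
    wsum ω (fun x => ∑' n, f n x) A = ∑' n, wsum ω (f n) A := by
  simp only [wsum, ← ENNReal.tsum_mul_left]
  exact ENNReal.tsum_comm

lemma wsum_add : wsum ω (fun x => g x + h x) A = wsum ω g A + wsum ω h A := by
  simp only [wsum, mul_add]
  exact ENNReal.tsum_add

lemma wsum_const_mul (c : ℝ≥0∞) : wsum ω (fun x => c * g x) A = c * wsum ω g A := by
  simp only [wsum, ← ENNReal.tsum_mul_left, mul_left_comm]

lemma wsum_lt_top [Finite X] (hω : ∀ x, ω x < ∞) (hg : ∀ x ∈ A, g x < ∞) : wsum ω g A < ∞ := by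
  classical
  have := Fintype.ofFinite A
  rw [wsum, tsum_fintype]
  exact ENNReal.sum_lt_top.2 fun x _ => ENNReal.mul_lt_top (hω _) (hg x.1 x.2)

end WeightedSum

section Setting

variable {X : Type} {μ : Set X → ℝ≥0∞} {ω : X → ℝ≥0∞}

lemma IsFiniteOuterSetting.pos (hμ : IsFiniteOuterSetting μ ω) {A : Set X} (hA : A.Nonempty) :
    0 < μ A :=
  let ⟨x, hx⟩ := hA
  (hμ.singleton x).1.trans_le (hμ.mono _ _ (singleton_subset_iff.2 hx))

lemma IsFiniteOuterSetting.eq_empty (hμ : IsFiniteOuterSetting μ ω) {A : Set X} (hA : μ A = 0) :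
    A = ∅ := by
  by_contra h
  exact (hμ.pos (nonempty_iff_ne_empty.2 h)).ne' hA

lemma slF_antitone (r : ℝ≥0∞) (f : X → ℝ≥0∞) : Antitone (slF μ ω r f) := fun _ _ h =>
  iInf_mono fun _ => iInf_mono' fun h' => ⟨h'.trans h, le_rfl⟩

variable [Finite X]

lemma IsFiniteOuterSetting.lt_top (hμ : IsFiniteOuterSetting μ ω) (A : Set X) : μ A < ∞ := by
  induction A, A.toFinite using Set.Finite.induction_on with
  | empty => simp [hμ.empty]
  | @insert a s _ _ ih =>
    rw [insert_eq]
    exact (hμ.union_le _ _).trans_lt (ENNReal.add_lt_top.2 ⟨(hμ.singleton a).2, ih⟩)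

lemma ellF_le_iff (hμ : IsFiniteOuterSetting μ ω) {r : ℝ≥0∞} (hr0 : r ≠ 0) (hr : r ≠ ∞)
    (f : X → ℝ≥0∞) (A : Set X) (lam : ℝ≥0∞) :
    ellF μ ω r f A ≤ lam ↔ wsum ω (fun x => f x ^ r.toReal) A ≤ lam ^ r.toReal * μ A := by
  have hρ : 0 < r.toReal := ENNReal.toReal_pos hr0 hr
  rw [ellF, if_neg hr, ENNReal.rpow_inv_le_iff hρ]
  change (μ A)⁻¹ * wsum ω (fun x => f x ^ r.toReal) A ≤ _ ↔ _
  rcases A.eq_empty_or_nonempty with rfl | hA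
  · simp [wsum_empty]
  · rw [mul_comm, ← div_eq_mul_inv,
      ENNReal.div_le_iff_le_mul (Or.inl (hμ.pos hA).ne') (Or.inl (hμ.lt_top A).ne)]

lemma supF_compl_indicator_le_iff (hμ : IsFiniteOuterSetting μ ω) {r : ℝ≥0∞} (hr0 : r ≠ 0)
    (hr : r ≠ ∞) (f : X → ℝ≥0∞) (D : Set X) (lam : ℝ≥0∞) :
    supF μ ω r (Dᶜ.indicator f) ≤ lam ↔
      ∀ B, Disjoint B D → wsum ω (fun x => f x ^ r.toReal) B ≤ lam ^ r.toReal * μ B := by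
  classical
  have hρ : 0 < r.toReal := ENNReal.toReal_pos hr0 hr
  rw [supF, iSup_le_iff]
  simp only [ellF_le_iff hμ hr0 hr]
  constructor
  · intro h B hB
    rw [← wsum_congr (g := fun x => Dᶜ.indicator f x ^ r.toReal)]
    · exact h B
    · intro x hx
      rw [indicator_of_mem (show x ∈ Dᶜ from hB.notMem_of_mem_left hx)]
  · intro h B
    have h1 : wsum ω (fun x => Dᶜ.indicator f x ^ r.toReal) (B ∩ D) = 0 := by
      rw [wsum_congr (h := fun _ => 0)]
      · simp [wsum]
      · intro x hx
        simp [hx.2, hρ]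
    have h2 : wsum ω (fun x => Dᶜ.indicator f x ^ r.toReal) (B \ D) =
        wsum ω (fun x => f x ^ r.toReal) (B \ D) := by
      refine wsum_congr fun x hx => ?_
      rw [indicator_of_mem (show x ∈ Dᶜ from hx.2)]
    calc wsum ω (fun x => Dᶜ.indicator f x ^ r.toReal) B
        ≤ _ := (congrArg _ (inter_union_sdiff B D).symm).trans_le wsum_union_le
      _ = wsum ω (fun x => f x ^ r.toReal) (B \ D) := by rw [h1, h2, zero_add]
      _ ≤ lam ^ r.toReal * μ (B \ D) := h _ disjoint_sdiff_left
      _ ≤ lam ^ r.toReal * μ B := by gcongr; exact hμ.mono _ _ sdiff_subset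

lemma slF_le_s2 (hμ : IsFiniteOuterSetting μ ω) {r : ℝ≥0∞} (hr0 : r ≠ 0) (hr : r ≠ ∞)
    {f : X → ℝ≥0∞} {D : Set X} {lam : ℝ≥0∞}
    (h : ∀ B, Disjoint B D → wsum ω (fun x => f x ^ r.toReal) B ≤ lam ^ r.toReal * μ B) :
    slF μ ω r f lam ≤ μ D :=
  iInf₂_le D ((supF_compl_indicator_le_iff hμ hr0 hr f D lam).2 h)

lemma exists_superlevel (hμ : IsFiniteOuterSetting μ ω) {r : ℝ≥0∞} (hr0 : r ≠ 0) (hr : r ≠ ∞)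
    (f : X → ℝ≥0∞) (lam : ℝ≥0∞) :
    ∃ D, μ D = slF μ ω r f lam ∧
      ∀ B, Disjoint B D → wsum ω (fun x => f x ^ r.toReal) B ≤ lam ^ r.toReal * μ B := by
  have hne : Nonempty {A : Set X // supF μ ω r (Aᶜ.indicator f) ≤ lam} := by
    refine ⟨univ, (supF_compl_indicator_le_iff hμ hr0 hr f univ lam).2 fun B hB => ?_⟩
    rw [disjoint_univ.1 hB, wsum_empty]
    exact zero_le
  obtain ⟨D, hD⟩ := exists_eq_ciInf_of_finite
    (f := fun A : {A : Set X // supF μ ω r (Aᶜ.indicator f) ≤ lam} => μ A)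
  exact ⟨D, by rw [hD, slF, iInf_subtype'],
    (supF_compl_indicator_le_iff hμ hr0 hr f D lam).1 D.2⟩

lemma exists_maximal_layer (hμ : IsFiniteOuterSetting μ ω) (g : X → ℝ≥0∞) (c : ℝ≥0∞)
    (E : Set X) :
    ∃ A, Disjoint A E ∧ c * μ A ≤ wsum ω g A ∧
      ∀ B, Disjoint B (E ∪ A) → wsum ω g B ≤ c * μ B := by
  obtain ⟨A, ⟨hAE, hA⟩, hmax⟩ := Set.Finite.exists_maximal
    (s := {A : Set X | Disjoint A E ∧ c * μ A ≤ wsum ω g A}) (Set.toFinite _)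
    ⟨∅, by simp [hμ.empty]⟩
  refine ⟨A, hAE, hA, fun B hB => ?_⟩
  rw [disjoint_union_right] at hB
  by_contra! hlt
  have hmem : A ∪ B ∈ {A : Set X | Disjoint A E ∧ c * μ A ≤ wsum ω g A} := by
    refine ⟨disjoint_union_left.2 ⟨hAE, hB.1⟩, ?_⟩
    rw [wsum_union hB.2.symm]
    calc c * μ (A ∪ B) ≤ c * (μ A + μ B) := by gcongr; exact hμ.union_le _ _
      _ = c * μ A + c * μ B := mul_add _ _ _
      _ ≤ _ := add_le_add hA hlt.le
  have hBA : B ⊆ A := subset_union_right.trans (hmax hmem subset_union_left)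
  rw [hB.2.eq_bot_of_le hBA] at hlt
  simp [wsum_empty] at hlt

/-- A finite function is dominated at all sufficiently large levels. -/
lemma exists_level (hμ : IsFiniteOuterSetting μ ω) {g : X → ℝ≥0∞} (hg : ∀ x, g x < ∞)
    {c : ℝ≥0∞} (hc : c ≠ 0) {t : ℝ} (ht : 1 ≤ t) :
    ∃ K : ℤ, ∀ k ≥ K, ∀ B, wsum ω g B ≤ c * 2 ^ ((k : ℝ) * t) * μ B := by
  have hB : ∀ B : Set X, ∃ n : ℕ, wsum ω g B ≤ c * n * μ B := by
    intro B
    rcases B.eq_empty_or_nonempty with rfl | hB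
    · simp [wsum_empty]
    · obtain ⟨n, hn⟩ := ENNReal.exists_nat_mul_gt (a := c * μ B)
        (mul_ne_zero hc (hμ.pos hB).ne')
        (wsum_lt_top (A := B) (fun x => (hμ.weight x).2) fun x _ => hg x).ne
      exact ⟨n, hn.le.trans_eq (by ring)⟩
  choose n hn using hB
  obtain ⟨N, hN⟩ := (Set.finite_range n).bddAbove
  refine ⟨N, fun k hk B => (hn B).trans ?_⟩
  gcongr
  have h1 : n B ≤ N := hN (mem_range_self B)
  calc (n B : ℝ≥0∞) ≤ N := by exact_mod_cast h1
    _ ≤ 2 ^ ((N : ℝ) * t) := natCast_le_two_rpow ht N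
    _ ≤ 2 ^ ((k : ℝ) * t) := by
      apply ENNReal.rpow_le_rpow_of_exponent_le (by norm_num)
      gcongr
      exact_mod_cast hk

/-- Greedy decomposition of a finite function into dyadic layers. -/
lemma exists_layers (hμ : IsFiniteOuterSetting μ ω) {g : X → ℝ≥0∞} (hg : ∀ x, g x < ∞)
    {t : ℝ} (ht : 1 ≤ t) :
    ∃ E : ℤ → Set X, Antitone E ∧ (∃ K, ∀ k ≥ K, E k = ∅) ∧
      (∀ k B, Disjoint B (E k) → wsum ω g B ≤ 2 ^ ((k : ℝ) * t) * μ B) ∧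
      ∀ k : ℤ, 2 ^ ((k : ℝ) * t) * μ (E k \ E (k + 1)) ≤ wsum ω g (E k \ E (k + 1)) := by
  obtain ⟨K, hK⟩ := exists_level hμ hg one_ne_zero ht
  simp only [one_mul] at hK
  choose A hAE hA hAB using fun c E => exists_maximal_layer hμ g c E
  let G : ℕ → Set X := fun n =>
    Nat.rec ∅ (fun n E => E ∪ A (2 ^ (((K - (n + 1) : ℤ) : ℝ) * t)) E) n
  have hG : ∀ n, G (n + 1) = G n ∪ A (2 ^ (((K - (n + 1) : ℤ) : ℝ) * t)) (G n) := fun n => rfl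
  have hmono : Monotone G := monotone_nat_of_le_succ fun n => by
    rw [hG]; exact subset_union_left
  refine ⟨fun k => G (K - k).toNat, fun a b h => hmono (by omega), ⟨K, fun k hk => ?_⟩,
    fun k B hB => ?_, fun k => ?_⟩
  · have : (K - k).toNat = 0 := by omega
    simp only [this]; rfl
  · rcases le_or_gt K k with hk | hk
    · exact hK k hk B
    · obtain ⟨n, hn⟩ : ∃ n : ℕ, K - k = n + 1 := ⟨(K - k - 1).toNat, by omega⟩
      have h1 : (K - k).toNat = n + 1 := by omega
      have h2 : K - (n + 1) = k := by omega
      simp only [h1, hG, h2] at hB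
      exact hAB _ _ B hB
  · rcases le_or_gt K k with hk | hk
    · have h1 : (K - k).toNat = 0 := by omega
      have h2 : G 0 = ∅ := rfl
      simp [h1, h2, hμ.empty]
    · obtain ⟨n, hn⟩ : ∃ n : ℕ, K - k = n + 1 := ⟨(K - k - 1).toNat, by omega⟩
      have h1 : (K - k).toNat = n + 1 := by omega
      have h3 : (K - (k + 1)).toNat = n := by omega
      have h2 : K - (n + 1) = k := by omega
      simp only [h1, h3, hG, h2]
      rw [union_sdiff_left, (hAE _ _).sdiff_eq_left]
      exact hA _ _

end Setting

section Duality

lemma mul_self_rpow_sub_one {ρ : ℝ} (hρ : 1 ≤ ρ) (w : ℝ≥0∞) : w * w ^ (ρ - 1) = w ^ ρ := by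
  conv_lhs => rw [← ENNReal.rpow_one w, ← ENNReal.rpow_mul, one_mul]
  rw [← ENNReal.rpow_add_of_nonneg _ _ zero_le_one (by linarith)]
  ring_nf

lemma mul_rpow_sub_one_le {ρ : ℝ} (hρ : 1 ≤ ρ) (u v : ℝ≥0∞) :
    u * v ^ (ρ - 1) ≤ u ^ ρ + v ^ ρ := by
  rcases le_total u v with huv | huv
  · calc u * v ^ (ρ - 1) ≤ v * v ^ (ρ - 1) := by gcongr
      _ ≤ _ := (mul_self_rpow_sub_one hρ v).trans_le le_add_self
  · calc u * v ^ (ρ - 1) ≤ u * u ^ (ρ - 1) := by gcongr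
      _ ≤ _ := (mul_self_rpow_sub_one hρ u).trans_le le_self_add

/-- A scaled Young inequality, replacing Hölder's inequality. -/
lemma wsum_mul_rpow_le {X : Type} {ω h F : X → ℝ≥0∞} {B : Set X} {ρ : ℝ} (hρ : 1 ≤ ρ)
    {α β m n : ℝ≥0∞} (hα : α ≠ 0) (hα' : α ≠ ∞) (hβ : β ≠ 0) (hβ' : β ≠ ∞)
    (hh : wsum ω (fun x => h x ^ ρ) B ≤ α ^ ρ * m)
    (hF : wsum ω (fun x => F x ^ ρ) B ≤ β ^ ρ * n) :
    wsum ω (fun x => h x * F x ^ (ρ - 1)) B ≤ α * β ^ (ρ - 1) * (m + n) := by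
  have hρ0 : 0 ≤ ρ := by linarith
  have hcancel : ∀ {γ c w : ℝ≥0∞}, γ ≠ 0 → γ ≠ ∞ → w ≤ γ ^ ρ * c → (γ⁻¹) ^ ρ * w ≤ c := by
    intro γ c w h0 h1 hw
    calc (γ⁻¹) ^ ρ * w ≤ (γ⁻¹) ^ ρ * (γ ^ ρ * c) := by gcongr
      _ = c := by
        rw [← mul_assoc, ← ENNReal.mul_rpow_of_nonneg _ _ hρ0, ENNReal.inv_mul_cancel h0 h1,
          ENNReal.one_rpow, one_mul]
  have hpt : ∀ x, h x * F x ^ (ρ - 1) ≤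
      α * β ^ (ρ - 1) * ((α⁻¹) ^ ρ * h x ^ ρ + (β⁻¹) ^ ρ * F x ^ ρ) := by
    intro x
    rw [← ENNReal.mul_rpow_of_nonneg _ _ hρ0, ← ENNReal.mul_rpow_of_nonneg _ _ hρ0]
    refine le_trans (le_of_eq ?_) (mul_le_mul_right (mul_rpow_sub_one_le hρ _ _) _)
    rw [mul_mul_mul_comm, ← ENNReal.mul_rpow_of_nonneg _ _ (by linarith),
      ENNReal.mul_inv_cancel_left hα hα', ENNReal.mul_inv_cancel_left hβ hβ']
  refine (wsum_mono fun x _ => hpt x).trans ?_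
  rw [wsum_const_mul, wsum_add, wsum_const_mul, wsum_const_mul]
  gcongr
  · exact hcancel hα hα' hh
  · exact hcancel hβ hβ' hF

lemma two_rpow_collect {a b c d e : ℝ} (he : a + 1 + b + c * d = e) (s m : ℝ≥0∞) :
    2 ^ a * (s * 2 ^ b * (2 ^ c) ^ d * (m + m)) = s * 2 ^ e * m := by
  rw [← he, two_rpow_add, two_rpow_add, two_rpow_add, ENNReal.rpow_mul, ENNReal.rpow_one]
  ring

variable {X : Type} {μ : Set X → ℝ≥0∞} {ω : X → ℝ≥0∞}

lemma tsum_wsum_layers_le (hμ : IsFiniteOuterSetting μ ω) {q ρ : ℝ} (hρ : 1 ≤ ρ)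
    {h F : X → ℝ≥0∞} {E D : ℤ → Set X} {s : ℝ≥0∞} (hs : s ≠ 0) (hs' : s ≠ ∞)
    (hE : ∀ (k : ℤ) B, Disjoint B (E k) →
      wsum ω (fun x => F x ^ ρ) B ≤ 2 ^ ((k : ℝ) * ρ) * μ B)
    (hD : ∀ (j : ℤ) B, Disjoint B (D j) →
      wsum ω (fun x => h x ^ ρ) B ≤ (s * 2 ^ (j : ℝ)) ^ ρ * μ B)
    (hJ : ∃ J, ∀ j ≥ J, D j = ∅) :
    ∑' k : ℤ, 2 ^ ((k : ℝ) * (q - ρ)) *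
        wsum ω (fun x => h x * F x ^ (ρ - 1)) (E k \ E (k + 1)) ≤
      2 ^ (ρ + 1) * (1 + ∑' i : ℕ, 2 ^ (-((i : ℝ) * (q - 1)))) * s *
        (∑' k : ℤ, 2 ^ ((k : ℝ) * q) * μ (E k \ E (k + 1)) +
          ∑' k : ℤ, 2 ^ ((k : ℝ) * q) * μ (D k)) := by
  have hpiece : ∀ (k j : ℤ) (B : Set X) (m : ℝ≥0∞), B ⊆ E k \ E (k + 1) → Disjoint B (D j) →
      μ B ≤ m → wsum ω (fun x => h x * F x ^ (ρ - 1)) B ≤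
        s * 2 ^ (j : ℝ) * (2 ^ ((k : ℝ) + 1)) ^ (ρ - 1) * (m + m) := by
    intro k j B m hBE hBD hm
    refine wsum_mul_rpow_le hρ (mul_ne_zero hs (two_rpow_ne_zero _))
      (ENNReal.mul_ne_top hs' (two_rpow_ne_top _)) (two_rpow_ne_zero _) (two_rpow_ne_top _)
      ((hD j B hBD).trans (by gcongr)) ?_
    refine (hE (k + 1) B (disjoint_sdiff_left.mono_left hBE)).trans ?_
    rw [ENNReal.rpow_mul]
    push_cast
    gcongr
  have hlayer : ∀ k : ℤ, 2 ^ ((k : ℝ) * (q - ρ)) *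
      wsum ω (fun x => h x * F x ^ (ρ - 1)) (E k \ E (k + 1)) ≤
      s * 2 ^ (ρ + 1) * (2 ^ ((k : ℝ) * q) * μ (E k \ E (k + 1))) +
      ∑' i : ℕ, s * 2 ^ (ρ + 1) * (2 ^ (-((i : ℝ) * (q - 1))) *
        (2 ^ (((k + i : ℤ) : ℝ) * q) * μ (D (k + i)))) := by
    intro k
    have hsplit : E k \ E (k + 1) ⊆ (E k \ E (k + 1)) \ D k ∪
        ⋃ i : ℕ, (E k \ E (k + 1)) ∩ (D (k + i) \ D (k + i + 1)) := by
      intro x hx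
      by_cases hxD : x ∈ D k
      · obtain ⟨i, hi⟩ := exists_mem_diff_shift hxD hJ
        exact Or.inr (mem_iUnion.2 ⟨i, hx, hi⟩)
      · exact Or.inl ⟨hx, hxD⟩
    refine (mul_le_mul_right ((wsum_mono_set hsplit).trans (wsum_union_le.trans
      (add_le_add_right (wsum_le_tsum subset_rfl) _))) _).trans ?_
    rw [mul_add, ← ENNReal.tsum_mul_left]
    refine add_le_add ?_ (ENNReal.tsum_le_tsum fun i => ?_)
    · refine (mul_le_mul_right (hpiece k k _ (μ (E k \ E (k + 1))) sdiff_subset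
        disjoint_sdiff_left (hμ.mono _ _ sdiff_subset)) _).trans ?_
      rw [two_rpow_collect rfl, mul_assoc, mul_assoc, ← mul_assoc (2 ^ (ρ + 1)), ← two_rpow_add]
      exact mul_le_mul_right (mul_le_mul_left (ENNReal.rpow_le_rpow_of_exponent_le
        (by norm_num) (by linarith)) _) _
    · refine (mul_le_mul_right (hpiece k (k + i + 1) _ (μ (D (k + i))) inter_subset_left
        (disjoint_sdiff_left.mono_left inter_subset_right)
        (hμ.mono _ _ (inter_subset_right.trans sdiff_subset))) _).trans (le_of_eq ?_)
      rw [two_rpow_collect rfl, mul_assoc, mul_assoc, ← mul_assoc (2 ^ (-_) : ℝ≥0∞),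
        ← two_rpow_add, ← mul_assoc (2 ^ (ρ + 1)), ← two_rpow_add]
      congr 3
      push_cast
      ring
  refine (ENNReal.tsum_le_tsum hlayer).trans ?_
  rw [ENNReal.tsum_add, ENNReal.tsum_mul_left]
  simp_rw [ENNReal.tsum_mul_left]
  rw [tsum_tsum_shift (fun i : ℕ => 2 ^ (-((i : ℝ) * (q - 1))))
    (fun k : ℤ => 2 ^ ((k : ℝ) * q) * μ (D k))]
  set G := ∑' i : ℕ, (2 : ℝ≥0∞) ^ (-((i : ℝ) * (q - 1)))
  set N := ∑' k : ℤ, 2 ^ ((k : ℝ) * q) * μ (E k \ E (k + 1))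
  set M := ∑' k : ℤ, 2 ^ ((k : ℝ) * q) * μ (D k)
  calc s * 2 ^ (ρ + 1) * N + s * 2 ^ (ρ + 1) * (G * M)
      ≤ s * 2 ^ (ρ + 1) * N + s * 2 ^ (ρ + 1) * (G * M) +
        (s * 2 ^ (ρ + 1) * (G * N) + s * 2 ^ (ρ + 1) * M) := le_self_add
    _ = _ := by ring

end Duality

section Layers

variable {X : Type} {μ : Set X → ℝ≥0∞} {ω : X → ℝ≥0∞} {E : ℤ → Set X}

lemma pairwise_disjoint_layers (hE : Antitone E) :
    Pairwise (Function.onFun Disjoint fun k => E k \ E (k + 1)) := by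
  have key : ∀ a b : ℤ, a < b → Disjoint (E a \ E (a + 1)) (E b \ E (b + 1)) := fun a b hab =>
    disjoint_left.2 fun x ha hb => ha.2 (hE (show a + 1 ≤ b by omega) hb.1)
  intro a b hab
  rcases hab.lt_or_gt with h | h
  · exact key a b h
  · exact (key b a h).symm

lemma measure_le_tsum_layers (hμ : IsFiniteOuterSetting μ ω) (hK : ∃ K, ∀ k ≥ K, E k = ∅)
    (k : ℤ) : μ (E k) ≤ ∑' i : ℕ, μ (E (k + i) \ E (k + i + 1)) := by
  have hn : ∀ n : ℕ, μ (E k) ≤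
      ∑ i ∈ Finset.range n, μ (E (k + i) \ E (k + i + 1)) + μ (E (k + n)) := by
    intro n
    induction n with
    | zero => simp
    | succ n ih =>
      refine ih.trans ?_
      rw [Finset.sum_range_succ, add_assoc]
      gcongr
      refine le_trans (hμ.mono _ _ ?_) (hμ.union_le _ _)
      rw [Nat.cast_succ, ← add_assoc, sdiff_union_self]
      exact subset_union_left
  obtain ⟨K, hK⟩ := hK
  refine (hn (K - k).toNat).trans ?_
  rw [hK _ (by have := Int.self_le_toNat (K - k); omega), hμ.empty, add_zero]
  exact ENNReal.sum_le_tsum _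

variable [Finite X]

lemma tsum_layers_ne_top (hμ : IsFiniteOuterSetting μ ω) (hE : Antitone E) {c : ℤ → ℝ≥0∞}
    (hc : ∀ k, c k ≠ ∞) : ∑' k : ℤ, c k * μ (E k \ E (k + 1)) ≠ ∞ := by
  have hfin : {k : ℤ | (E k \ E (k + 1)).Nonempty}.Finite := by
    choose x hx using fun k : {k : ℤ // (E k \ E (k + 1)).Nonempty} => k.2
    refine Finite.of_injective x fun a b hab => Subtype.ext ?_
    by_contra hne
    exact (pairwise_disjoint_layers hE hne).notMem_of_mem_left (hx a) (hab ▸ hx b)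
  rw [tsum_eq_sum (s := hfin.toFinset)]
  · exact (ENNReal.sum_lt_top.2 fun k _ =>
      ENNReal.mul_lt_top (hc k).lt_top (hμ.lt_top _)).ne
  · intro k hk
    simp only [Finite.mem_toFinset, mem_ofPred_eq, not_nonempty_iff_eq_empty] at hk
    rw [hk, hμ.empty, mul_zero]

lemma layerInt_slF_le (hμ : IsFiniteOuterSetting μ ω) {r : ℝ≥0∞} (hr0 : r ≠ 0) (hr : r ≠ ∞)
    {q : ℝ} (hq : 1 ≤ q) {F : X → ℝ≥0∞} (hK : ∃ K, ∀ k ≥ K, E k = ∅)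
    (hE : ∀ (k : ℤ) B, Disjoint B (E k) →
      wsum ω (fun x => F x ^ r.toReal) B ≤ 2 ^ ((k : ℝ) * r.toReal) * μ B) :
    layerInt q (slF μ ω r F) ≤ ENNReal.ofReal q * 2 ^ q *
      ((∑' i : ℕ, 2 ^ (-((i : ℝ) * q))) * ∑' k : ℤ, 2 ^ ((k : ℝ) * q) * μ (E k \ E (k + 1))) := by
  refine (layerInt_le_tsum hq (slF_antitone r F)).trans ?_
  rw [← tsum_tsum_shift (fun i : ℕ => 2 ^ (-((i : ℝ) * q)))
    (fun k : ℤ => 2 ^ ((k : ℝ) * q) * μ (E k \ E (k + 1)))]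
  gcongr with k
  calc 2 ^ ((k : ℝ) * q) * slF μ ω r F (2 ^ (k : ℝ))
      ≤ 2 ^ ((k : ℝ) * q) * ∑' i : ℕ, μ (E (k + i) \ E (k + i + 1)) := by
        gcongr
        refine le_trans (slF_le_s2 hμ hr0 hr fun B hB => ?_) (measure_le_tsum_layers hμ hK k)
        rw [← ENNReal.rpow_mul]
        exact hE k B hB
    _ = _ := by
        rw [← ENNReal.tsum_mul_left]
        refine tsum_congr fun i => ?_
        rw [← mul_assoc, ← two_rpow_add]
        congr 2
        push_cast
        ring

end Layers

section Bounds

variable {X : Type} {μ : Set X → ℝ≥0∞} {ω : X → ℝ≥0∞} {r : ℝ≥0∞} {q : ℝ}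

lemma apply_le_of_wsum_singleton_le (hμ : IsFiniteOuterSetting μ ω) {ρ : ℝ} (hρ : 0 < ρ)
    {f : X → ℝ≥0∞} {x : X} {s : ℝ≥0∞}
    (h : wsum ω (fun x => f x ^ ρ) {x} ≤ s ^ ρ * μ {x}) :
    f x ≤ s * (μ {x} / ω x) ^ ρ⁻¹ := by
  rw [wsum_singleton, mul_comm, ← ENNReal.le_div_iff_mul_le (Or.inl (hμ.weight x).1.ne')
    (Or.inl (hμ.weight x).2.ne), mul_div_assoc] at h
  have := ENNReal.rpow_le_rpow h (inv_nonneg.2 hρ.le)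
  rwa [ENNReal.rpow_rpow_inv hρ.ne', ENNReal.mul_rpow_of_nonneg _ _ (inv_nonneg.2 hρ.le),
    ENNReal.rpow_rpow_inv hρ.ne'] at this

lemma weight_quotient_ne_top (hμ : IsFiniteOuterSetting μ ω) {ρ : ℝ} (hρ : 0 < ρ) (x : X) :
    (μ {x} / ω x) ^ ρ⁻¹ ≠ ∞ :=
  ENNReal.rpow_ne_top_of_nonneg (inv_nonneg.2 hρ.le)
    (ENNReal.div_ne_top (hμ.singleton x).2.ne (hμ.weight x).1.ne')

lemma tsum_apply_lt_top {f : ℕ → X → ℝ≥0∞} {a : ℕ → ℝ≥0∞} {x : X}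
    {K : ℝ≥0∞} (hK : K ≠ ∞) (hf : ∀ n, f n x ≤ K * a n) (ha : ∑' n, a n ≠ ∞) :
    ∑' n, f n x < ∞ := by
  refine (ENNReal.tsum_le_tsum hf).trans_lt ?_
  rw [ENNReal.tsum_mul_left]
  exact ENNReal.mul_lt_top hK.lt_top ha.lt_top

variable [Finite X]

lemma exists_apply_le (hμ : IsFiniteOuterSetting μ ω) (hr0 : r ≠ 0) (hr : r ≠ ∞) (hq : 1 ≤ q)
    (x : X) :
    ∃ K : ℝ≥0∞, K ≠ ∞ ∧ ∀ (f : X → ℝ≥0∞) (a : ℝ≥0∞), a ≠ 0 → a ≠ ∞ →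
      layerInt q (slF μ ω r f) ≤ a ^ q → f x ≤ K * a := by
  have hρ : 0 < r.toReal := ENNReal.toReal_pos hr0 hr
  have hq0 : 0 ≤ q := by linarith
  obtain ⟨t, ht⟩ := ENNReal.exists_nat_mul_gt (a := μ {x}) (b := 2 ^ q)
    (hμ.singleton x).1.ne' (two_rpow_ne_top q)
  have ht0 : (t : ℝ≥0∞) ≠ 0 := by
    intro h
    simp [h] at ht
  have ht1 : (1 : ℝ≥0∞) ≤ t := by
    exact_mod_cast Nat.one_le_iff_ne_zero.2 (by exact_mod_cast ht0)
  refine ⟨t * (μ {x} / ω x) ^ r.toReal⁻¹,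
    ENNReal.mul_ne_top (ENNReal.natCast_ne_top t) (weight_quotient_ne_top hμ hρ x),
    fun f a ha ha' hf => ?_⟩
  have hta : (t : ℝ≥0∞) * a ≠ ∞ := ENNReal.mul_ne_top (ENNReal.natCast_ne_top t) ha'
  obtain ⟨D, hD, hDB⟩ := exists_superlevel hμ hr0 hr f (t * a)
  have hx : x ∉ D := by
    intro hxD
    have h1 := le_layerInt hq (slF_antitone (μ := μ) (ω := ω) r f)
      (s := ((t : ℝ≥0∞) * a).toReal) (ENNReal.toReal_pos (mul_ne_zero ht0 ha) hta)
    rw [ENNReal.ofReal_toReal hta, ← hD] at h1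
    have h2 : a ^ q * (t * μ {x}) ≤ a ^ q * 2 ^ q :=
      calc a ^ q * (t * μ {x}) ≤ a ^ q * (t ^ q * μ D) := by
            gcongr
            · simpa using ENNReal.rpow_le_rpow_of_exponent_le ht1 hq
            · exact hμ.mono _ _ (singleton_subset_iff.2 hxD)
        _ = (t * a) ^ q * μ D := by rw [ENNReal.mul_rpow_of_nonneg _ _ hq0]; ring
        _ ≤ 2 ^ q * a ^ q := h1.trans (by gcongr)
        _ = a ^ q * 2 ^ q := mul_comm _ _
    rw [ENNReal.mul_le_mul_iff_right (mt (ENNReal.rpow_eq_zero_iff_of_pos (by linarith)).1 ha)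
      (ENNReal.rpow_ne_top_of_nonneg hq0 ha')] at h2
    exact absurd h2 (not_le.2 ht)
  refine (apply_le_of_wsum_singleton_le hμ hρ
    (hDB {x} (disjoint_singleton_left.2 hx))).trans (le_of_eq (by ring))

/-- Superlevel sets of a finite function at all dyadic multiples of a level `s`. -/
lemma exists_superlevels (hμ : IsFiniteOuterSetting μ ω) (hr1 : 1 ≤ r) (hr : r ≠ ∞)
    {h : X → ℝ≥0∞} (hh : ∀ x, h x < ∞) {s : ℝ≥0∞} (hs : s ≠ 0) :
    ∃ D : ℤ → Set X, (∀ j : ℤ, μ (D j) = slF μ ω r h (s * 2 ^ (j : ℝ))) ∧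
      (∀ (j : ℤ) B, Disjoint B (D j) →
        wsum ω (fun x => h x ^ r.toReal) B ≤ (s * 2 ^ (j : ℝ)) ^ r.toReal * μ B) ∧
      ∃ J, ∀ j ≥ J, D j = ∅ := by
  have hr0 : r ≠ 0 := (zero_lt_one.trans_le hr1).ne'
  have hρ : 1 ≤ r.toReal := by
    simpa using ENNReal.toReal_mono hr hr1
  choose D hD hDB using fun j : ℤ => exists_superlevel hμ hr0 hr h (s * 2 ^ (j : ℝ))
  refine ⟨D, hD, hDB, ?_⟩
  obtain ⟨J, hJ⟩ := exists_level hμ (g := fun x => h x ^ r.toReal) (c := s ^ r.toReal)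
    (fun x => ENNReal.rpow_lt_top_of_nonneg (by linarith) (hh x).ne)
    (mt (ENNReal.rpow_eq_zero_iff_of_pos (by linarith)).1 hs) hρ
  refine ⟨J, fun j hj => hμ.eq_empty (le_antisymm ?_ zero_le)⟩
  rw [hD, ← hμ.empty]
  refine slF_le_s2 hμ hr0 hr fun B _ => ?_
  rw [ENNReal.mul_rpow_of_nonneg _ _ (by linarith), ← ENNReal.rpow_mul]
  exact hJ j hj B

lemma wsum_univ_le_layerInt (hμ : IsFiniteOuterSetting μ ω) {h : X → ℝ≥0∞}
    (hh : ∀ x, h x < ∞) : wsum ω h univ ≤ 4 * layerInt 1 (slF μ ω 1 h) := by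
  obtain ⟨D, hD, hDB, hJ⟩ := exists_superlevels hμ le_rfl ENNReal.one_ne_top hh one_ne_zero
  simp only [ENNReal.toReal_one, ENNReal.rpow_one, one_mul] at hD hDB
  have hrest : wsum ω h (⋃ j, D j)ᶜ = 0 := by
    have hle : ∀ n : ℕ, wsum ω h (⋃ j, D j)ᶜ ≤ 2⁻¹ ^ n * μ univ := by
      intro n
      refine (hDB (-n) _ (disjoint_compl_left.mono_right (subset_iUnion D _))).trans ?_
      have : (2 : ℝ≥0∞) ^ (((-n : ℤ)) : ℝ) = 2⁻¹ ^ n := by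
        push_cast
        rw [ENNReal.rpow_neg, ENNReal.rpow_natCast, ENNReal.inv_pow]
      rw [this]
      gcongr
      exact hμ.mono _ _ (subset_univ _)
    have hlim : Filter.Tendsto (fun n : ℕ => (2⁻¹ : ℝ≥0∞) ^ n * μ univ) Filter.atTop
        (nhds (0 * μ univ)) :=
      ENNReal.Tendsto.mul_const
        (ENNReal.tendsto_pow_atTop_nhds_zero_of_lt_one (by norm_num)) (Or.inr (hμ.lt_top _).ne)
    rw [zero_mul] at hlim
    exact le_antisymm (ge_of_tendsto' hlim hle) zero_le
  have hcover : (univ : Set X) ⊆ (⋃ j, D j)ᶜ ∪ ⋃ j : ℤ, D j \ D (j + 1) := by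
    intro x _
    by_cases hx : x ∈ ⋃ j, D j
    · obtain ⟨k, hk⟩ := mem_iUnion.1 hx
      obtain ⟨i, hi⟩ := exists_mem_diff_shift hk hJ
      exact Or.inr (mem_iUnion.2 ⟨k + i, hi⟩)
    · exact Or.inl hx
  have hlayer := tsum_le_layerInt le_rfl (slF_antitone (μ := μ) (ω := ω) 1 h) one_pos
  simp only [ENNReal.ofReal_one, one_mul, mul_one, ENNReal.rpow_one]
    at hlayer
  calc wsum ω h univ ≤ ∑' j : ℤ, wsum ω h (D j \ D (j + 1)) := by
        refine (wsum_mono_set hcover).trans (wsum_union_le.trans ?_)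
        rw [hrest, zero_add]
        exact wsum_le_tsum subset_rfl
    _ ≤ ∑' j : ℤ, 2 * (2 ^ (j : ℝ) * slF μ ω 1 h (2 ^ (j : ℝ))) := by
        refine ENNReal.tsum_le_tsum fun j => (hDB (j + 1) _ disjoint_sdiff_left).trans ?_
        rw [← hD]
        push_cast
        rw [two_rpow_add, ENNReal.rpow_one, mul_comm (2 ^ (j : ℝ) : ℝ≥0∞) 2, mul_assoc]
        gcongr
        exact hμ.mono _ _ sdiff_subset
    _ ≤ 4 * layerInt 1 (slF μ ω 1 h) := by
        rw [ENNReal.tsum_mul_left]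
        refine (mul_le_mul_right hlayer 2).trans (le_of_eq ?_)
        rw [← mul_assoc]
        norm_num

end Bounds

section Triangle

variable {X : Type} [Finite X] {μ : Set X → ℝ≥0∞} {ω : X → ℝ≥0∞} {r : ℝ≥0∞} {q : ℝ}

lemma tsum_lt_top_of_layerInt_le (hμ : IsFiniteOuterSetting μ ω) (hr1 : 1 ≤ r) (hr : r ≠ ∞)
    (hq : 1 ≤ q) {f : ℕ → X → ℝ≥0∞} {a : ℕ → ℝ≥0∞} (ha : ∀ n, a n ≠ 0)
    (hS : ∑' n, a n ≠ ∞) (hf : ∀ n, layerInt q (slF μ ω r (f n)) ≤ a n ^ q) (x : X) :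
    ∑' n, f n x < ∞ := by
  obtain ⟨K, hK, hle⟩ := exists_apply_le hμ (zero_lt_one.trans_le hr1).ne' hr hq x
  exact tsum_apply_lt_top hK
    (fun n => hle (f n) (a n) (ha n) (ENNReal.ne_top_of_tsum_ne_top hS n) (hf n)) hS

lemma layerInt_tsum_le {C₀ : ℝ≥0∞} (hμ : IsFiniteOuterSetting μ ω) (hr1 : 1 ≤ r)
    (hr : r ≠ ∞) (hq : 1 < q)
    (hC₀ : C₀ = 2 ^ (r.toReal + 1) * (1 + ∑' i : ℕ, 2 ^ (-((i : ℝ) * (q - 1)))))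
    {f : ℕ → X → ℝ≥0∞} {a : ℕ → ℝ≥0∞} (ha : ∀ n, a n ≠ 0) (hS : ∑' n, a n ≠ ∞)
    (hf : ∀ n, layerInt q (slF μ ω r (f n)) ≤ a n ^ q) :
    layerInt q (slF μ ω r fun x => ∑' n, f n x) ≤
      ENNReal.ofReal q * 2 ^ q * ((∑' i : ℕ, 2 ^ (-((i : ℝ) * q))) *
        (2 * (2 * C₀ * ∑' n, a n)) ^ q) := by
  have hq0 : 0 ≤ q := by linarith
  have hr0 : r ≠ 0 := (zero_lt_one.trans_le hr1).ne'
  have hρ : 1 ≤ r.toReal := by simpa using ENNReal.toReal_mono hr hr1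
  set ρ := r.toReal with hρdef
  have hC0 : C₀ ≠ 0 := by rw [hC₀]; simp
  have hCtop : C₀ ≠ ∞ := by
    rw [hC₀]
    exact ENNReal.mul_ne_top (two_rpow_ne_top _)
      (ENNReal.add_ne_top.2 ⟨ENNReal.one_ne_top, tsum_two_rpow_neg_ne_top (by linarith)⟩)
  set F : X → ℝ≥0∞ := fun x => ∑' n, f n x with hFdef
  have hF : ∀ x, F x < ∞ := tsum_lt_top_of_layerInt_le hμ hr1 hr hq.le ha hS hf
  have hfF : ∀ n x, f n x < ∞ := fun n x => (ENNReal.le_tsum n).trans_lt (hF x)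
  obtain ⟨E, hEanti, hEK, hE, hEN⟩ := exists_layers hμ (g := fun x => F x ^ ρ)
    (fun x => ENNReal.rpow_lt_top_of_nonneg (by linarith) (hF x).ne) hρ
  set N := ∑' k : ℤ, 2 ^ ((k : ℝ) * q) * μ (E k \ E (k + 1)) with hN
  have hNtop : N ≠ ∞ := tsum_layers_ne_top hμ hEanti fun k => two_rpow_ne_top _
  set S := ∑' n, a n with hSdef
  have hS0 : S ≠ 0 := fun h => ha 0 (ENNReal.tsum_eq_zero.1 h 0)
  set L := 2 * C₀ * S with hL
  have hL0 : L ≠ 0 := mul_ne_zero (mul_ne_zero two_ne_zero hC0) hS0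
  have hLtop : L ≠ ∞ := ENNReal.mul_ne_top (ENNReal.mul_ne_top (by simp) hCtop) hS
  have hterm : ∀ n, ∑' k : ℤ, 2 ^ ((k : ℝ) * (q - ρ)) *
      wsum ω (fun x => f n x * F x ^ (ρ - 1)) (E k \ E (k + 1)) ≤
      C₀ * (a n / L) * (N + (2 * L) ^ q) := by
    intro n
    set s := a n / L with hs
    have hs0 : s ≠ 0 := ENNReal.div_ne_zero.2 ⟨ha n, hLtop⟩
    have hs_top : s ≠ ∞ := ENNReal.div_ne_top (ENNReal.ne_top_of_tsum_ne_top hS n) hL0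
    obtain ⟨D, hD, hDB, hJ⟩ := exists_superlevels hμ hr1 hr (hfF n) hs0
    refine (tsum_wsum_layers_le hμ hρ hs0 hs_top hE hDB hJ).trans ?_
    rw [← hC₀]
    gcongr
    have h1 := tsum_le_layerInt hq.le (slF_antitone (μ := μ) (ω := ω) r (f n))
      (ENNReal.toReal_pos hs0 hs_top)
    rw [ENNReal.ofReal_toReal hs_top] at h1
    simp_rw [← hD] at h1
    rw [← ENNReal.mul_le_mul_iff_right (mt (ENNReal.rpow_eq_zero_iff_of_pos (by linarith)).1 hs0)
      (ENNReal.rpow_ne_top_of_nonneg hq0 hs_top)]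
    refine h1.trans ((mul_le_mul_right (hf n) _).trans (le_of_eq ?_))
    rw [← ENNReal.mul_rpow_of_nonneg _ _ hq0, ← ENNReal.mul_rpow_of_nonneg _ _ hq0, hs,
      mul_left_comm, ENNReal.div_mul_cancel hL0 hLtop]
  have hsum : N ≤ C₀ * (S / L) * (N + (2 * L) ^ q) := by
    calc N ≤ ∑' k : ℤ, 2 ^ ((k : ℝ) * (q - ρ)) * wsum ω (fun x => F x ^ ρ) (E k \ E (k + 1)) := by
          refine ENNReal.tsum_le_tsum fun k => ?_
          refine le_trans (le_of_eq ?_) (mul_le_mul_right (hEN k) _)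
          rw [← mul_assoc, ← two_rpow_add]
          ring_nf
      _ = ∑' k : ℤ, ∑' n, 2 ^ ((k : ℝ) * (q - ρ)) *
            wsum ω (fun x => f n x * F x ^ (ρ - 1)) (E k \ E (k + 1)) := by
          refine tsum_congr fun k => ?_
          rw [ENNReal.tsum_mul_left, ← wsum_tsum]
          congr 1
          refine wsum_congr fun x _ => ?_
          rw [ENNReal.tsum_mul_right, ← mul_self_rpow_sub_one hρ]
      _ = ∑' n, ∑' k : ℤ, 2 ^ ((k : ℝ) * (q - ρ)) *
            wsum ω (fun x => f n x * F x ^ (ρ - 1)) (E k \ E (k + 1)) := ENNReal.tsum_comm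
      _ ≤ ∑' n, C₀ * (a n / L) * (N + (2 * L) ^ q) := ENNReal.tsum_le_tsum hterm
      _ = C₀ * (S / L) * (N + (2 * L) ^ q) := by
          rw [ENNReal.tsum_mul_right, ENNReal.tsum_mul_left]
          simp_rw [div_eq_mul_inv]
          rw [ENNReal.tsum_mul_right]
  have hhalf : 2 * (C₀ * (S / L)) = 1 := by
    rw [← mul_assoc, ← mul_div_assoc, ← hL, ENNReal.div_self hL0 hLtop]
  have hNle : N ≤ (2 * L) ^ q := by
    refine (ENNReal.add_le_add_iff_left hNtop).1 ?_
    calc N + N = 2 * N := (two_mul N).symm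
      _ ≤ 2 * (C₀ * (S / L) * (N + (2 * L) ^ q)) := by gcongr
      _ = N + (2 * L) ^ q := by rw [← mul_assoc, hhalf, one_mul]
  refine (layerInt_slF_le hμ hr0 hr hq.le hEK hE).trans ?_
  gcongr

lemma layerInt_one_tsum_le (hμ : IsFiniteOuterSetting μ ω)
    {f : ℕ → X → ℝ≥0∞} {a : ℕ → ℝ≥0∞} (ha : ∀ n, a n ≠ 0) (hS : ∑' n, a n ≠ ∞)
    (hf : ∀ n, layerInt 1 (slF μ ω 1 (f n)) ≤ a n) :
    layerInt 1 (slF μ ω 1 fun x => ∑' n, f n x) ≤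
      2 * (∑' i : ℕ, 2 ^ (-(i : ℝ))) * (4 * ∑' n, a n) := by
  set F : X → ℝ≥0∞ := fun x => ∑' n, f n x with hFdef
  have hF : ∀ x, F x < ∞ :=
    tsum_lt_top_of_layerInt_le hμ le_rfl ENNReal.one_ne_top le_rfl ha hS (by simpa using hf)
  have hfF : ∀ n x, f n x < ∞ := fun n x => (ENNReal.le_tsum n).trans_lt (hF x)
  obtain ⟨E, hEanti, hEK, hE, hEN⟩ := exists_layers hμ hF le_rfl
  have hle := layerInt_slF_le hμ one_ne_zero ENNReal.one_ne_top le_rfl (F := F) hEK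
    (by simpa using hE)
  simp only [ENNReal.ofReal_one, ENNReal.rpow_one, one_mul, mul_one] at hle hEN
  refine hle.trans ?_
  rw [← mul_assoc]
  gcongr
  calc ∑' k : ℤ, 2 ^ (k : ℝ) * μ (E k \ E (k + 1))
      ≤ ∑' k : ℤ, wsum ω F (E k \ E (k + 1)) := ENNReal.tsum_le_tsum hEN
    _ ≤ wsum ω F univ := tsum_wsum_le (pairwise_disjoint_layers hEanti)
    _ = ∑' n, wsum ω (f n) univ := wsum_tsum f
    _ ≤ ∑' n, 4 * a n := ENNReal.tsum_le_tsum fun n =>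
        (wsum_univ_le_layerInt hμ (hfF n)).trans (mul_le_mul_right (hf n) _)
    _ = 4 * ∑' n, a n := ENNReal.tsum_mul_left

lemma supF_tsum_le (hμ : IsFiniteOuterSetting μ ω) (hr1 : 1 ≤ r) (hr : r ≠ ∞)
    {f : ℕ → X → ℝ≥0∞} {a : ℕ → ℝ≥0∞} (ha : ∀ n, a n ≠ 0) (hS : ∑' n, a n ≠ ∞)
    (hf : ∀ n, supF μ ω r (f n) ≤ a n) :
    supF μ ω r (fun x => ∑' n, f n x) ≤ 2 * ∑' n, a n := by
  have hr0 : r ≠ 0 := (zero_lt_one.trans_le hr1).ne'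
  have hρ : 1 ≤ r.toReal := by simpa using ENNReal.toReal_mono hr hr1
  have hfA : ∀ n A, wsum ω (fun x => f n x ^ r.toReal) A ≤ a n ^ r.toReal * μ A := fun n A =>
    (ellF_le_iff hμ hr0 hr _ _ _).1 ((le_iSup (ellF μ ω r (f n)) A).trans (hf n))
  have hF : ∀ x, ∑' n, f n x < ∞ := fun x => tsum_apply_lt_top
    (weight_quotient_ne_top hμ (by linarith) x)
    (fun n => (apply_le_of_wsum_singleton_le hμ (by linarith) (hfA n {x})).trans_eq
      (mul_comm _ _)) hS
  set F : X → ℝ≥0∞ := fun x => ∑' n, f n x with hFdef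
  set S := ∑' n, a n with hSdef
  have hS0 : 2 * S ≠ 0 := mul_ne_zero two_ne_zero fun h => ha 0 (ENNReal.tsum_eq_zero.1 h 0)
  have hS_top : 2 * S ≠ ∞ := ENNReal.mul_ne_top (by simp) hS
  refine iSup_le fun A => (ellF_le_iff hμ hr0 hr _ _ _).2 ?_
  set M := wsum ω (fun x => F x ^ r.toReal) A with hM
  have hMtop : M ≠ ∞ := (wsum_lt_top (fun x => (hμ.weight x).2) fun x _ =>
    ENNReal.rpow_lt_top_of_nonneg (by linarith) (hF x).ne).ne
  have hT0 : (2 * S) ^ r.toReal ≠ 0 :=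
    mt (ENNReal.rpow_eq_zero_iff_of_pos (by linarith)).1 hS0
  have hTtop : (2 * S) ^ r.toReal ≠ ∞ := ENNReal.rpow_ne_top_of_nonneg (by linarith) hS_top
  have hMT : M = (2 * S) ^ r.toReal * (M / (2 * S) ^ r.toReal) :=
    (ENNReal.mul_div_cancel hT0 hTtop).symm
  have hsum : M ≤ S * (2 * S) ^ (r.toReal - 1) * (μ A + M / (2 * S) ^ r.toReal) := by
    calc M = ∑' n, wsum ω (fun x => f n x * F x ^ (r.toReal - 1)) A := by
          rw [← wsum_tsum]
          refine wsum_congr fun x _ => ?_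
          rw [ENNReal.tsum_mul_right, ← mul_self_rpow_sub_one hρ]
      _ ≤ ∑' n, a n * (2 * S) ^ (r.toReal - 1) * (μ A + M / (2 * S) ^ r.toReal) :=
          ENNReal.tsum_le_tsum fun n => wsum_mul_rpow_le hρ (ha n)
            (ENNReal.ne_top_of_tsum_ne_top hS n) hS0 hS_top (hfA n A) hMT.le
      _ = _ := by rw [ENNReal.tsum_mul_right, ENNReal.tsum_mul_right]
  refine (ENNReal.add_le_add_iff_left hMtop).1 ?_
  calc M + M = 2 * M := (two_mul M).symm
    _ ≤ 2 * (S * (2 * S) ^ (r.toReal - 1) * (μ A + M / (2 * S) ^ r.toReal)) := by gcongr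
    _ = (2 * S) ^ r.toReal * (μ A + M / (2 * S) ^ r.toReal) := by
        rw [← mul_self_rpow_sub_one hρ (2 * S)]; ring
    _ = M + (2 * S) ^ r.toReal * μ A := by rw [mul_add, ← hMT, add_comm]

end Triangle

lemma supF_top_tsum_le {X : Type} {μ : Set X → ℝ≥0∞} {ω : X → ℝ≥0∞}
    (f : ℕ → X → ℝ≥0∞) :
    supF μ ω ∞ (fun x => ∑' n, f n x) ≤ ∑' n, supF μ ω ∞ (f n) := by
  refine iSup_le fun A => ?_
  rw [ellF, if_pos rfl]
  refine iSup₂_le fun x hx => ENNReal.tsum_le_tsum fun n => ?_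
  refine le_trans ?_ (le_iSup (ellF μ ω ∞ (f n)) A)
  rw [ellF, if_pos rfl]
  exact le_iSup₂ (f := fun x (_ : x ∈ A) => f n x) x hx

/-- It suffices to bound by sums of strictly positive majorants. -/
lemma le_mul_tsum_of_forall_majorant {C T : ℝ≥0∞} {b : ℕ → ℝ≥0∞} (hC0 : C ≠ 0) (hC : C ≠ ∞)
    (h : ∀ a : ℕ → ℝ≥0∞, (∀ n, a n ≠ 0) → (∀ n, b n ≤ a n) → ∑' n, a n ≠ ∞ →
      T ≤ C * ∑' n, a n) : T ≤ C * ∑' n, b n := by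
  refine ENNReal.le_of_forall_pos_le_add fun ε hε htop => ?_
  have hb : ∑' n, b n ≠ ∞ := fun hb => by
    rw [hb, ENNReal.mul_top hC0] at htop
    exact htop.ne rfl
  have hεC : (ε : ℝ≥0∞) / C ≠ 0 := ENNReal.div_ne_zero.2 ⟨by exact_mod_cast hε.ne', hC⟩
  obtain ⟨δ, hδ, hsum⟩ := ENNReal.exists_pos_sum_of_countable hεC ℕ
  have hadd : ∑' n, (b n + δ n) = ∑' n, b n + ∑' n, (δ n : ℝ≥0∞) := ENNReal.tsum_add
  calc T ≤ C * ∑' n, (b n + δ n) := h _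
        (fun n h0 => (hδ n).ne' (by exact_mod_cast (add_eq_zero.1 h0).2))
        (fun n => le_self_add) (by rw [hadd]; exact ENNReal.add_ne_top.2 ⟨hb, hsum.ne_top⟩)
    _ ≤ C * ∑' n, b n + C * (ε / C) := by rw [hadd, mul_add]; gcongr
    _ = C * ∑' n, b n + ε := by rw [ENNReal.mul_div_cancel hC0 hC]

lemma LpF_eq_layerInt {X : Type} {μ : Set X → ℝ≥0∞} {ω : X → ℝ≥0∞} {p : ℝ≥0∞} (hp : p ≠ ∞)
    (r : ℝ≥0∞) (f : X → ℝ≥0∞) :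
    LpF μ ω p r f = layerInt p.toReal (slF μ ω r f) ^ p.toReal⁻¹ := if_neg hp

/-- Uniform quasi-triangle inequality in the finite setting (Theorem 1.1(iii)):
for `1 < p ≤ ∞`, `1 ≤ r < ∞` or `p = r ∈ {1,∞}` there is a constant `C = C(p,r)`,
uniform in the finite outer measure setting `(X, μ, ω)`, such that
`‖Σ_n f_n‖_{L^p(ℓ^r)} ≤ C Σ_n ‖f_n‖_{L^p(ℓ^r)}` for every sequence of nonnegative
functions. -/
theorem triangle_inequality_finite (p r : ℝ≥0∞)
    (hpr : (1 < p ∧ 1 ≤ r ∧ r ≠ ∞) ∨ (p = r ∧ (p = 1 ∨ p = ∞))) :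
    ∃ C : ℝ≥0∞, 0 < C ∧ C ≠ ∞ ∧
      ∀ (X : Type) (_ : Fintype X) (μ : Set X → ℝ≥0∞) (ω : X → ℝ≥0∞),
        μ ∅ = 0 →
        (∀ A B : Set X, A ⊆ B → μ A ≤ μ B) →
        (∀ A B : Set X, μ (A ∪ B) ≤ μ A + μ B) →
        (∀ x : X, 0 < μ {x} ∧ μ {x} < ∞) →
        (∀ x : X, 0 < ω x ∧ ω x < ∞) →
        ∀ f : ℕ → X → ℝ≥0∞,
          LpF μ ω p r (fun x => ∑' n, f n x) ≤ C * ∑' n, LpF μ ω p r (f n) := by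
  rcases hpr with ⟨hp1, hr1, hr⟩ | ⟨rfl, rfl | rfl⟩
  · by_cases hp : p = ∞
    · subst hp
      refine ⟨2, by norm_num, by norm_num, fun X _ μ ω h1 h2 h3 h4 h5 f => ?_⟩
      have hμ : IsFiniteOuterSetting μ ω := ⟨h1, h2, h3, h4, h5⟩
      simp only [LpF, if_true]
      exact le_mul_tsum_of_forall_majorant two_ne_zero (by norm_num) fun a ha hle hS =>
        supF_tsum_le hμ hr1 hr ha hS hle
    · have hq : 1 < p.toReal := by simpa using ENNReal.toReal_strict_mono hp hp1
      obtain ⟨C₀, hC₀⟩ : ∃ C₀ : ℝ≥0∞, C₀ =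
        2 ^ (r.toReal + 1) * (1 + ∑' i : ℕ, 2 ^ (-((i : ℝ) * (p.toReal - 1)))) := ⟨_, rfl⟩
      obtain ⟨C₁, hC₁⟩ : ∃ C₁ : ℝ≥0∞, C₁ =
        ENNReal.ofReal p.toReal * 2 ^ p.toReal * ∑' i : ℕ, 2 ^ (-((i : ℝ) * p.toReal)) := ⟨_, rfl⟩
      have hC₀0 : C₀ ≠ 0 := by rw [hC₀]; simp
      have hC₀t : C₀ ≠ ∞ := by
        rw [hC₀]
        exact ENNReal.mul_ne_top (two_rpow_ne_top _)
          (ENNReal.add_ne_top.2 ⟨ENNReal.one_ne_top, tsum_two_rpow_neg_ne_top (by linarith)⟩)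
      have hC₁0 : C₁ ≠ 0 := by
        rw [hC₁]
        refine mul_ne_zero (mul_ne_zero (by simp; linarith) (two_rpow_ne_zero _)) fun h => ?_
        exact two_rpow_ne_zero _ (ENNReal.tsum_eq_zero.1 h 0)
      have hC₁t : C₁ ≠ ∞ := by
        rw [hC₁]
        exact ENNReal.mul_ne_top (ENNReal.mul_ne_top ENNReal.ofReal_ne_top (two_rpow_ne_top _))
          (tsum_two_rpow_neg_ne_top (by linarith))
      have hC0 : C₁ ^ p.toReal⁻¹ * (2 * (2 * C₀)) ≠ 0 := mul_ne_zero
        (mt (ENNReal.rpow_eq_zero_iff_of_pos (inv_pos.2 (by linarith))).1 hC₁0)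
        (mul_ne_zero two_ne_zero (mul_ne_zero two_ne_zero hC₀0))
      have hCt : C₁ ^ p.toReal⁻¹ * (2 * (2 * C₀)) ≠ ∞ := ENNReal.mul_ne_top
        (ENNReal.rpow_ne_top_of_nonneg (inv_nonneg.2 (by linarith)) hC₁t)
        (ENNReal.mul_ne_top (by norm_num) (ENNReal.mul_ne_top (by norm_num) hC₀t))
      refine ⟨_, pos_iff_ne_zero.2 hC0, hCt, fun X _ μ ω h1 h2 h3 h4 h5 f => ?_⟩
      have hμ : IsFiniteOuterSetting μ ω := ⟨h1, h2, h3, h4, h5⟩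
      refine le_mul_tsum_of_forall_majorant hC0 hCt fun a ha hle hS => ?_
      simp only [LpF_eq_layerInt hp, ENNReal.rpow_inv_le_iff (zero_lt_one.trans hq)] at hle ⊢
      refine (layerInt_tsum_le hμ hr1 hr hq hC₀ ha hS hle).trans (le_of_eq ?_)
      rw [← mul_assoc, ← hC₁, mul_assoc (C₁ ^ _), ENNReal.mul_rpow_of_nonneg (C₁ ^ _) _
        (by linarith), ENNReal.rpow_inv_rpow (by linarith), mul_assoc 2 (2 * C₀)]
  · obtain ⟨G, hG⟩ : ∃ G : ℝ≥0∞, G = ∑' i : ℕ, 2 ^ (-(i : ℝ)) := ⟨_, rfl⟩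
    have hG0 : G ≠ 0 := fun h =>
      two_rpow_ne_zero _ (ENNReal.tsum_eq_zero.1 (hG.symm.trans h) 0)
    have hGt : G ≠ ∞ := by
      rw [hG]
      simpa using tsum_two_rpow_neg_ne_top one_pos
    have hC0 : 2 * G * 4 ≠ 0 := mul_ne_zero (mul_ne_zero two_ne_zero hG0) (by norm_num)
    have hCt : 2 * G * 4 ≠ ∞ :=
      ENNReal.mul_ne_top (ENNReal.mul_ne_top (by norm_num) hGt) (by norm_num)
    refine ⟨_, pos_iff_ne_zero.2 hC0, hCt, fun X _ μ ω h1 h2 h3 h4 h5 f => ?_⟩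
    have hμ : IsFiniteOuterSetting μ ω := ⟨h1, h2, h3, h4, h5⟩
    refine le_mul_tsum_of_forall_majorant hC0 hCt fun a ha hle hS => ?_
    simp only [LpF_eq_layerInt ENNReal.one_ne_top, ENNReal.toReal_one, inv_one,
      ENNReal.rpow_one] at hle ⊢
    refine (layerInt_one_tsum_le hμ ha hS hle).trans (le_of_eq ?_)
    rw [← hG, mul_assoc (2 * G)]
  · refine ⟨1, one_pos, ENNReal.one_ne_top, fun X _ μ ω _ _ _ _ _ f => ?_⟩
    simp only [LpF, if_true, one_mul]
    exact supF_top_tsum_le f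

end
end

section
/- Collapsing of exponents in the upper half space (Theorem 1.2(i)): For every 0 < p ≤ ∞ there exists a constant C = C(p) such that for every d ≥ 1 and every nonnegative Borel function f on X = ℝ^d × (0,∞), (1/C) ‖f‖_{L^p(X,ω)} ≤ ‖f‖_{L^p(ℓ^p)} ≤ C ‖f‖_{L^p(X,ω)}, where ‖f‖_{L^p(X,ω)} = (∫_X f(y,t)^p t^{-1} dy dt)^{1/p} for p < ∞ and ‖f‖_{L^∞(X,ω)} is the essential supremum of f on X. -/
open MeasureTheory Set
open scoped ENNReal

noncomputable section

/-- The outer `ℓ^r` size associated with an outer measure `μ` and a Borel measure `ν`: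
for `r < ∞`, `ℓ^r(f)(A) = (μ(A)⁻¹ ∫_A f^r dν)^{1/r}`; for `r = ∞` the `ν`-essential
supremum of `f` on `A`. -/
def ellSize {X : Type*} [MeasurableSpace X] (μ : Set X → ℝ≥0∞) (ν : MeasureTheory.Measure X)
    (r : ℝ≥0∞) (f : X → ℝ≥0∞) (A : Set X) : ℝ≥0∞ :=
  if r = ∞ then essSup f (ν.restrict A)
  else ((μ A)⁻¹ * ∫⁻ x in A, f x ^ r.toReal ∂ν) ^ r.toReal⁻¹

/-- The outer `L^∞(ℓ^r)` quasi-norm: supremum of the size over Borel sets. -/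
def outerSup {X : Type*} [MeasurableSpace X] (μ : Set X → ℝ≥0∞) (ν : MeasureTheory.Measure X)
    (r : ℝ≥0∞) (f : X → ℝ≥0∞) : ℝ≥0∞ :=
  ⨆ (A : Set X) (_ : MeasurableSet A), ellSize μ ν r f A

/-- The super level measure `μ(ℓ^r(f) > λ)`. -/
def superLevel {X : Type*} [MeasurableSpace X] (μ : Set X → ℝ≥0∞) (ν : MeasureTheory.Measure X)
    (r : ℝ≥0∞) (f : X → ℝ≥0∞) (lam : ℝ≥0∞) : ℝ≥0∞ :=
  ⨅ (A : Set X) (_ : MeasurableSet A)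
    (_ : outerSup μ ν r (Aᶜ.indicator f) ≤ lam), μ A

/-- The outer `L^p(ℓ^r)` quasi-norm,
`‖f‖_{L^p(ℓ^r)} = (∫_0^∞ p λ^{p-1} μ(ℓ^r(f) > λ) dλ)^{1/p}` for `p < ∞`. -/
def outerLp {X : Type*} [MeasurableSpace X] (μ : Set X → ℝ≥0∞) (ν : MeasureTheory.Measure X)
    (p r : ℝ≥0∞) (f : X → ℝ≥0∞) : ℝ≥0∞ :=
  if p = ∞ then outerSup μ ν r f
  else (∫⁻ l in Ioi (0:ℝ),
      ENNReal.ofReal (p.toReal * l ^ (p.toReal - 1)) *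
        superLevel μ ν r f (ENNReal.ofReal l)) ^ p.toReal⁻¹

/-- The weak outer `L^{p,∞}(ℓ^r)` quasi-norm,
`‖f‖_{L^{p,∞}(ℓ^r)} = (sup_{λ>0} λ^p μ(ℓ^r(f) > λ))^{1/p}` for `p < ∞`. -/
def outerLpWeak {X : Type*} [MeasurableSpace X] (μ : Set X → ℝ≥0∞) (ν : MeasureTheory.Measure X)
    (p r : ℝ≥0∞) (f : X → ℝ≥0∞) : ℝ≥0∞ :=
  if p = ∞ then outerSup μ ν r f
  else (⨆ (lam : ℝ≥0∞) (_ : 0 < lam), lam ^ p.toReal * superLevel μ ν r f lam) ^ p.toReal⁻¹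

/-- The upper half space `ℝ^d × ℝ` (only the part `t > 0` carries mass). -/
abbrev UHS (d : ℕ) : Type := (Fin d → ℝ) × ℝ

/-- The measure `t⁻¹ dy dt` on the upper half space (vanishing on `{t ≤ 0}`). -/
def uhsMeasure (d : ℕ) : MeasureTheory.Measure (UHS d) :=
  (MeasureTheory.volume : MeasureTheory.Measure (Fin d → ℝ)).prod
    (MeasureTheory.volume.withDensity fun t => ENNReal.ofReal t⁻¹)

/-- The open dyadic box `(x,0) + (0,2^j)^{d+1}` with `x = 2^j k`, `k ∈ ℤ^d`. -/
def dyadicBox (d : ℕ) (j : ℤ) (k : Fin d → ℤ) : Set (UHS d) :=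
  {q | (∀ i, q.1 i ∈ Ioo ((2:ℝ) ^ j * k i) ((2:ℝ) ^ j * k i + (2:ℝ) ^ j)) ∧
    q.2 ∈ Ioo 0 ((2:ℝ) ^ j)}

/-- The pre-measure of a dyadic box of scale `2^j`: the volume `2^{jd}` of its base. -/
def dyadicVol (d : ℕ) (j : ℤ) : ℝ≥0∞ := ENNReal.ofReal ((2:ℝ) ^ j) ^ d

/-- The outer measure on the upper half space generated by covering with dyadic boxes. -/
def dyadicOuter (d : ℕ) (A : Set (UHS d)) : ℝ≥0∞ :=
  ⨅ (C : Set (ℤ × (Fin d → ℤ))) (_ : A ⊆ ⋃ e ∈ C, dyadicBox d e.1 e.2),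
    ∑' e : C, dyadicVol d e.1.1

/-- The classical `L^p(X,ω)` norm on the upper half space, `ω = t⁻¹ dy dt`. -/
def uhsLp (d : ℕ) (p : ℝ≥0∞) (f : UHS d → ℝ≥0∞) : ℝ≥0∞ :=
  if p = ∞ then essSup f (uhsMeasure d)
  else (∫⁻ q, f q ^ p.toReal ∂uhsMeasure d) ^ p.toReal⁻¹

/-- Any measurable set `A₀` can be enlarged, without increasing `m Aᶜ + s μ(A)`, to a set `A`
off which `m` is dominated by `s μ`. -/
lemma exists_carleson_superset {X : Type*} [MeasurableSpace X] (μ : OuterMeasure X)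
    (m : Measure X) [IsFiniteMeasure m] (s : ℝ≥0∞) {A₀ : Set X} (hA₀ : MeasurableSet A₀) :
    ∃ A : Set X, MeasurableSet A ∧ (∀ B, MeasurableSet B → m (B \ A) ≤ s * μ B) ∧
      m Aᶜ + s * μ A ≤ m A₀ᶜ + s * μ A₀ := by
  have greedy : ∀ A : Set X, ∃ B : Set X, MeasurableSet B ∧ s * μ B ≤ m (B \ A) ∧
      ∀ B', MeasurableSet B' → s * μ B' ≤ m (B' \ A) → m (B' \ A) ≤ 2 * m (B \ A) := by
    intro A
    obtain ⟨S, hS⟩ : ∃ S : ℝ≥0∞, S = ⨆ (B : Set X)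
      (_ : MeasurableSet B ∧ s * μ B ≤ m (B \ A)), m (B \ A) := ⟨_, rfl⟩
    have hle : ∀ B', MeasurableSet B' → s * μ B' ≤ m (B' \ A) → m (B' \ A) ≤ S :=
      fun B' h1 h2 => hS ▸ le_iSup₂ (f := fun (B : Set X)
        (_ : MeasurableSet B ∧ s * μ B ≤ m (B \ A)) => m (B \ A)) B' ⟨h1, h2⟩
    by_cases h0 : S = 0
    · refine ⟨∅, MeasurableSet.empty, by simp, fun B' h1 h2 => ?_⟩
      have := hle B' h1 h2
      rw [h0] at this
      exact this.trans zero_le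
    · have hfin : S ≠ ∞ :=
        hS ▸ ((iSup₂_le fun B _ => measure_mono (subset_univ _)).trans_lt (measure_lt_top m univ)).ne
      have hlt : S / 2 < S := ENNReal.half_lt_self h0 hfin
      rw [hS] at hlt
      obtain ⟨B, hlt⟩ := lt_iSup_iff.1 hlt
      obtain ⟨hB, hlt⟩ := lt_iSup_iff.1 hlt
      rw [← hS] at hlt
      refine ⟨B, hB.1, hB.2, fun B' h1 h2 => (hle B' h1 h2).trans ?_⟩
      have := ENNReal.div_le_iff_le_mul (a := S) (b := 2) (c := m (B \ A)) (by simp) (by simp)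
      rw [mul_comm]
      exact this.1 hlt.le
  choose next next_meas next_le next_max using greedy
  let a : ℕ → Set X := fun n => Nat.rec A₀ (fun _ A => A ∪ next A) n
  have a_succ : ∀ n, a (n + 1) = a n ∪ next (a n) := fun n => rfl
  have a_meas : ∀ n, MeasurableSet (a n) := by
    intro n
    induction n with
    | zero => exact hA₀
    | succ n ih => rw [a_succ]; exact ih.union (next_meas _)
  have a_mono : Monotone a := monotone_nat_of_le_succ fun n => by
    rw [a_succ]; exact subset_union_left
  let D : ℕ → Set X := fun n => next (a n) \ a n
  have D_meas : ∀ n, MeasurableSet (D n) := fun n => (next_meas _).diff (a_meas n)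
  have D_sub : ∀ n, D n ⊆ a (n + 1) := fun n x hx => by rw [a_succ]; exact Or.inr hx.1
  have D_disj : Pairwise (Function.onFun Disjoint D) := by
    rw [pairwise_disjoint_on]
    intro i j hij
    rw [Set.disjoint_left]
    exact fun x hi hj => hj.2 (a_mono hij (D_sub i hi))
  have D_sum : m (⋃ n, D n) = ∑' n, m (D n) := measure_iUnion D_disj D_meas
  refine ⟨⋃ n, a n, MeasurableSet.iUnion a_meas, ?_, ?_⟩
  · intro B hB
    by_contra! hcon
    have key : ∀ n, m (B \ ⋃ n, a n) ≤ 2 * m (D n) := fun n => by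
      have hmono : m (B \ ⋃ n, a n) ≤ m (B \ a n) :=
        measure_mono (sdiff_subset_sdiff_right (subset_iUnion a n))
      exact hmono.trans (next_max _ B hB (hcon.le.trans hmono))
    have hlim : Filter.Tendsto (fun n => 2 * m (D n)) Filter.atTop (nhds 0) := by
      have h := ENNReal.tendsto_atTop_zero_of_tsum_ne_top (D_sum ▸ measure_ne_top m _)
      simpa using ENNReal.Tendsto.const_mul (a := 2) h (Or.inr (by simp))
    have : m (B \ ⋃ n, a n) ≤ 0 := ge_of_tendsto' hlim key
    exact not_lt_of_ge (this.trans zero_le) hcon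
  · have hcover : (⋃ n, a n) ⊆ A₀ ∪ ⋃ n, next (a n) := by
      refine iUnion_subset fun n => ?_
      induction n with
      | zero => exact subset_union_left
      | succ n ih =>
        rw [a_succ]
        exact union_subset ih ((subset_iUnion (fun n => next (a n)) n).trans subset_union_right)
    have hμ : s * μ (⋃ n, a n) ≤ s * μ A₀ + m (⋃ n, D n) := by
      calc s * μ (⋃ n, a n) ≤ s * (μ A₀ + ∑' n, μ (next (a n))) := by
            gcongr
            exact (measure_mono hcover).trans
              ((measure_union_le _ _).trans (by gcongr; exact measure_iUnion_le _))
        _ = s * μ A₀ + ∑' n, s * μ (next (a n)) := by rw [mul_add, ENNReal.tsum_mul_left]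
        _ ≤ s * μ A₀ + m (⋃ n, D n) := by
            rw [D_sum]
            gcongr with n
            exact next_le _
    have hm : m (⋃ n, a n)ᶜ + m (⋃ n, D n) ≤ m A₀ᶜ := by
      rw [← measure_union _ (MeasurableSet.iUnion D_meas)]
      · refine measure_mono (union_subset (compl_subset_compl.2 (subset_iUnion a 0)) ?_)
        exact iUnion_subset fun n x hx hx0 => hx.2 (a_mono (Nat.zero_le n) hx0)
      · rw [Set.disjoint_left]
        intro x hx hx'
        obtain ⟨n, hn⟩ := mem_iUnion.1 hx'
        exact hx (mem_iUnion.2 ⟨n + 1, D_sub n hn⟩)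
    calc m (⋃ n, a n)ᶜ + s * μ (⋃ n, a n) ≤ m (⋃ n, a n)ᶜ + (s * μ A₀ + m (⋃ n, D n)) := by gcongr
      _ = (m (⋃ n, a n)ᶜ + m (⋃ n, D n)) + s * μ A₀ := by ring
      _ ≤ _ := by gcongr

/-- The least outer measure of a measurable set off which `m` is dominated by `s μ`. -/
def carlesonLevel {X : Type*} [MeasurableSpace X] (μ : OuterMeasure X) (m : Measure X)
    (s : ℝ≥0∞) : ℝ≥0∞ :=
  ⨅ (A : Set X) (_ : MeasurableSet A) (_ : ∀ B, MeasurableSet B → m (B \ A) ≤ s * μ B), μ A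

lemma carlesonLevel_antitone {X : Type*} [MeasurableSpace X] (μ : OuterMeasure X)
    (m : Measure X) : Antitone (carlesonLevel μ m) := by
  intro s t hst
  refine le_iInf fun A => le_iInf fun hA => le_iInf fun h => ?_
  refine iInf_le_of_le A (iInf_le_of_le hA (iInf_le_of_le (fun B hB => (h B hB).trans ?_) le_rfl))
  gcongr

/-- The `K`-functional type quantity `inf_A (m Aᶜ + s μ(A))`. -/
def coverCost {X : Type*} [MeasurableSpace X] (μ : OuterMeasure X) (m : Measure X)
    (s : ℝ≥0∞) : ℝ≥0∞ :=
  ⨅ (A : Set X) (_ : MeasurableSet A), m Aᶜ + s * μ A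

lemma coverCost_le {X : Type*} [MeasurableSpace X] (μ : OuterMeasure X) (m : Measure X)
    (s : ℝ≥0∞) : coverCost μ m s ≤ m univ :=
  iInf_le_of_le ∅ (iInf_le_of_le MeasurableSet.empty (by simp))

lemma mul_carlesonLevel_add_coverCost_le {X : Type*} [MeasurableSpace X] (μ : OuterMeasure X)
    (m : Measure X) [IsFiniteMeasure m] (s h : ℝ≥0∞) :
    h * carlesonLevel μ m (s + h) + coverCost μ m s ≤ coverCost μ m (s + h) := by
  refine le_iInf fun A₀ => le_iInf fun hA₀ => ?_
  obtain ⟨A, hA, hB, hle⟩ := exists_carleson_superset μ m (s + h) hA₀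
  have h1 : carlesonLevel μ m (s + h) ≤ μ A :=
    iInf_le_of_le A (iInf_le_of_le hA (iInf_le_of_le hB le_rfl))
  have h2 : coverCost μ m s ≤ m Aᶜ + s * μ A := iInf_le_of_le A (iInf_le_of_le hA le_rfl)
  calc h * carlesonLevel μ m (s + h) + coverCost μ m s ≤ h * μ A + (m Aᶜ + s * μ A) := by gcongr
    _ = m Aᶜ + (s + h) * μ A := by ring
    _ ≤ _ := hle

lemma tsum_int_le_of_telescope {u c : ℤ → ℝ≥0∞} {T : ℝ≥0∞} (h : ∀ k, u k + c k ≤ c (k + 1))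
    (hT : ∀ k, c k ≤ T) : ∑' k, u k ≤ T := by
  have key : ∀ (a : ℤ) (n : ℕ), ∑ i ∈ Finset.range n, u (a + i) + c a ≤ c (a + n) := by
    intro a n
    induction n with
    | zero => simp
    | succ n ih =>
      rw [Finset.sum_range_succ]
      calc ∑ i ∈ Finset.range n, u (a + i) + u (a + n) + c a
          = u (a + n) + (∑ i ∈ Finset.range n, u (a + i) + c a) := by ring
        _ ≤ u (a + n) + c (a + n) := by gcongr
        _ ≤ c (a + (n + 1 : ℕ)) := by
          have := h (a + n)
          rwa [add_assoc] at this
  rw [ENNReal.tsum_eq_iSup_sum' fun n : ℕ => (Finset.range (2 * n)).image fun i : ℕ => -(n : ℤ) + i]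
  · refine iSup_le fun n => ?_
    rw [Finset.sum_image (by intro i _ j _ hij; simpa using hij)]
    exact (le_self_add.trans (key _ _)).trans (hT _)
  · intro t
    obtain ⟨n, hn⟩ : ∃ n : ℕ, ∀ k ∈ t, k.natAbs < n :=
      ⟨t.sup Int.natAbs + 1, fun k hk => Nat.lt_succ_of_le (Finset.le_sup (f := Int.natAbs) hk)⟩
    refine ⟨n, fun k hk => Finset.mem_image.2 ⟨(k + n).toNat, ?_, ?_⟩⟩
    · have := hn k hk
      rw [Finset.mem_range]; omega
    · have := hn k hk
      omega

/-- The measure of the `k`-th dyadic interval `(2^k, 2^(k+1)]` under `p l^(p-1) dl`. -/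
def dyadicWeight (p : ℝ) (k : ℤ) : ℝ≥0∞ :=
  ENNReal.ofReal (((2:ℝ) ^ (k + 1)) ^ p - ((2:ℝ) ^ k) ^ p)

/-- The dyadic levels `(2^k)^p`. -/
def dyadicLevel (p : ℝ) (k : ℤ) : ℝ≥0∞ := ENNReal.ofReal ((2:ℝ) ^ k) ^ p

lemma dyadicLevel_eq_ofReal (p : ℝ) (k : ℤ) :
    dyadicLevel p k = ENNReal.ofReal (((2:ℝ) ^ k) ^ p) :=
  ENNReal.ofReal_rpow_of_pos (by positivity)

lemma two_zpow_add_one_rpow (p : ℝ) (k : ℤ) :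
    ((2:ℝ) ^ (k + 1)) ^ p = 2 ^ p * ((2:ℝ) ^ k) ^ p := by
  rw [zpow_add_one₀ two_ne_zero, mul_comm, Real.mul_rpow (by positivity) (by positivity)]

lemma dyadicLevel_add_weight {p : ℝ} (hp : 0 < p) (k : ℤ) :
    dyadicLevel p k + dyadicWeight p k = dyadicLevel p (k + 1) := by
  have h1 : (1:ℝ) ≤ 2 ^ p := Real.one_le_rpow (by norm_num) hp.le
  have h2 : (0:ℝ) ≤ ((2:ℝ) ^ k) ^ p := by positivity
  rw [dyadicLevel_eq_ofReal, dyadicLevel_eq_ofReal, dyadicWeight, ← ENNReal.ofReal_add h2]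
  · congr 1; ring
  · rw [two_zpow_add_one_rpow]; nlinarith

lemma dyadicWeight_add_one {p : ℝ} (k : ℤ) :
    dyadicWeight p (k + 1) = ENNReal.ofReal (2 ^ p) * dyadicWeight p k := by
  rw [dyadicWeight, dyadicWeight, ← ENNReal.ofReal_mul (by positivity),
    two_zpow_add_one_rpow p (k + 1), two_zpow_add_one_rpow p k]
  congr 1; ring

lemma dyadicLevel_add_two {p : ℝ} (hp : 0 < p) (k : ℤ) :
    dyadicLevel p (k + 1 + 1) =
      ENNReal.ofReal ((2 ^ p * 2 ^ p) / (2 ^ p - 1)) * dyadicWeight p k := by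
  have h1 : (1:ℝ) < 2 ^ p := Real.one_lt_rpow (by norm_num) hp
  have h3 : (0:ℝ) < 2 ^ p - 1 := by linarith
  rw [dyadicLevel_eq_ofReal, dyadicWeight, ← ENNReal.ofReal_mul (by positivity),
    two_zpow_add_one_rpow p (k + 1), two_zpow_add_one_rpow p k]
  congr 1
  field_simp

lemma lintegral_Ioc_two_zpow {p : ℝ} (hp : 0 < p) (k : ℤ) :
    ∫⁻ l in Ioc ((2:ℝ) ^ k) ((2:ℝ) ^ (k + 1)), ENNReal.ofReal (p * l ^ (p - 1)) =
      dyadicWeight p k := by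
  have hle : (2:ℝ) ^ k ≤ (2:ℝ) ^ (k + 1) := zpow_le_zpow_right₀ (by norm_num) (by omega)
  have hpos : (0:ℝ) < 2 ^ k := by positivity
  have hint : IntervalIntegrable (fun l : ℝ => p * l ^ (p - 1)) volume ((2:ℝ) ^ k)
      ((2:ℝ) ^ (k + 1)) := (intervalIntegral.intervalIntegrable_rpow' (by linarith)).const_mul p
  rw [← ofReal_integral_eq_lintegral_ofReal, ← intervalIntegral.integral_of_le hle,
    intervalIntegral.integral_const_mul, integral_rpow (Or.inl (by linarith)), dyadicWeight]
  · congr 1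
    rw [sub_add_cancel]
    field_simp
  · exact (intervalIntegrable_iff_integrableOn_Ioc_of_le hle).1 hint
  · refine (ae_restrict_iff' measurableSet_Ioc).2 (Filter.Eventually.of_forall fun l hl => ?_)
    have : 0 < l := hpos.trans hl.1
    simp only [Pi.zero_apply]
    positivity

lemma iUnion_Ioc_two_zpow : ⋃ k : ℤ, Ioc ((2:ℝ) ^ k) ((2:ℝ) ^ (k + 1)) = Ioi 0 := by
  ext x
  simp only [mem_iUnion, mem_Ioi]
  refine ⟨fun ⟨k, hk⟩ => lt_trans (by positivity) hk.1, fun hx => ?_⟩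
  exact exists_mem_Ioc_zpow hx (by norm_num)

lemma pairwise_disjoint_Ioc_two_zpow :
    Pairwise (Function.onFun Disjoint fun k : ℤ => Ioc ((2:ℝ) ^ k) ((2:ℝ) ^ (k + 1))) := by
  rw [pairwise_disjoint_on]
  intro i j hij
  rw [Set.disjoint_left]
  intro x hi hj
  have : (2:ℝ) ^ (i + 1) ≤ 2 ^ j := zpow_le_zpow_right₀ (by norm_num) (by omega)
  exact absurd (hi.2.trans this) (not_le.2 hj.1)

lemma lintegral_Ioi_eq_tsum (g : ℝ → ℝ≥0∞) :
    ∫⁻ l in Ioi (0:ℝ), g l = ∑' k : ℤ, ∫⁻ l in Ioc ((2:ℝ) ^ k) ((2:ℝ) ^ (k + 1)), g l := by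
  rw [← iUnion_Ioc_two_zpow, lintegral_iUnion (fun _ => measurableSet_Ioc)
    pairwise_disjoint_Ioc_two_zpow]

lemma lintegral_antitone_le_tsum {M : ℝ≥0∞ → ℝ≥0∞} (hM : Antitone M) {p : ℝ} (hp : 0 < p) :
    ∫⁻ l in Ioi (0:ℝ), ENNReal.ofReal (p * l ^ (p - 1)) * M (ENNReal.ofReal l ^ p) ≤
      ∑' k, dyadicWeight p k * M (dyadicLevel p k) := by
  rw [lintegral_Ioi_eq_tsum]
  gcongr with k
  rw [← lintegral_Ioc_two_zpow hp, ← lintegral_mul_const _ (by fun_prop)]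
  refine setLIntegral_mono' measurableSet_Ioc fun l hl => ?_
  gcongr
  apply hM
  rw [dyadicLevel]
  gcongr
  exact hl.1.le

lemma tsum_le_lintegral_antitone {M : ℝ≥0∞ → ℝ≥0∞} (hM : Antitone M) {p : ℝ} (hp : 0 < p) :
    ∑' k, dyadicWeight p k * M (dyadicLevel p (k + 1)) ≤
      ∫⁻ l in Ioi (0:ℝ), ENNReal.ofReal (p * l ^ (p - 1)) * M (ENNReal.ofReal l ^ p) := by
  rw [lintegral_Ioi_eq_tsum]
  gcongr with k
  rw [← lintegral_Ioc_two_zpow hp, ← lintegral_mul_const _ (by fun_prop)]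
  refine setLIntegral_mono' measurableSet_Ioc fun l hl => ?_
  gcongr
  apply hM
  rw [dyadicLevel]
  gcongr
  exact hl.2

lemma lintegral_carlesonLevel_le {X : Type*} [MeasurableSpace X] (μ : OuterMeasure X)
    (m : Measure X) [IsFiniteMeasure m] {p : ℝ} (hp : 0 < p) :
    ∫⁻ l in Ioi (0:ℝ), ENNReal.ofReal (p * l ^ (p - 1)) *
        carlesonLevel μ m (ENNReal.ofReal l ^ p) ≤ ENNReal.ofReal (2 ^ p) * m univ := by
  refine (lintegral_antitone_le_tsum (carlesonLevel_antitone μ m) hp).trans ?_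
  rw [← (Equiv.addRight (1:ℤ)).tsum_eq]
  simp only [Equiv.coe_addRight, dyadicWeight_add_one, mul_assoc]
  rw [ENNReal.tsum_mul_left]
  gcongr
  refine tsum_int_le_of_telescope (c := fun k => coverCost μ m (dyadicLevel p k)) (fun k => ?_)
    fun k => coverCost_le μ m _
  rw [← dyadicLevel_add_weight hp]
  exact mul_carlesonLevel_add_coverCost_le μ m _ _

lemma measure_univ_le_tsum_carlesonLevel {X ι : Type*} [MeasurableSpace X] [Countable ι]
    (μ : OuterMeasure X) (m : Measure X) (hμ : ∀ B, μ B = 0 → B = ∅) (E : ι → Set X)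
    (hE : ∀ i, MeasurableSet (E i)) (hEfin : ∀ i, μ (E i) ≠ ∞) (hcover : m (⋃ i, E i)ᶜ = 0)
    {p : ℝ} (hp : 0 < p) :
    m univ ≤ ∑' k, dyadicLevel p (k + 1) * carlesonLevel μ m (dyadicLevel p k) := by
  refine ENNReal.le_of_forall_pos_le_add fun δ hδ hfin => ?_
  obtain ⟨ε, hε, hεsum⟩ :=
    ENNReal.exists_pos_sum_of_countable' (ENNReal.coe_ne_zero.2 hδ.ne') ℤ
  have lev_top : ∀ k, dyadicLevel p k ≠ ∞ := fun k => by
    rw [dyadicLevel_eq_ofReal]; exact ENNReal.ofReal_ne_top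
  have lev_zero : ∀ k, dyadicLevel p k ≠ 0 := fun k => by
    rw [dyadicLevel_eq_ofReal]
    have : (0:ℝ) < ((2:ℝ) ^ k) ^ p := by positivity
    simpa using this
  have choice : ∀ k, ∃ A, MeasurableSet A ∧
      (∀ B, MeasurableSet B → m (B \ A) ≤ dyadicLevel p k * μ B) ∧
      dyadicLevel p (k + 1) * μ A ≤
        dyadicLevel p (k + 1) * carlesonLevel μ m (dyadicLevel p k) + ε k := by
    intro k
    have hlt : carlesonLevel μ m (dyadicLevel p k) <
        carlesonLevel μ m (dyadicLevel p k) + ε k / dyadicLevel p (k + 1) := by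
      refine ENNReal.lt_add_right ?_ (ENNReal.div_pos (hε k).ne' (lev_top _)).ne'
      intro htop
      have := ENNReal.ne_top_of_tsum_ne_top hfin.ne k
      rw [htop, ENNReal.mul_top (lev_zero _)] at this
      exact this rfl
    conv_lhs at hlt => rw [carlesonLevel]
    simp only [iInf_lt_iff] at hlt
    obtain ⟨A, hA, hB, hlt⟩ := hlt
    refine ⟨A, hA, hB, ?_⟩
    calc dyadicLevel p (k + 1) * μ A ≤ dyadicLevel p (k + 1) *
          (carlesonLevel μ m (dyadicLevel p k) + ε k / dyadicLevel p (k + 1)) := by gcongr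
      _ = _ := by rw [mul_add, ENNReal.mul_div_cancel (lev_zero _) (lev_top _)]
  choose A hA hdom hcost using choice
  set T : ℝ≥0∞ :=
    ∑' k, dyadicLevel p (k + 1) * carlesonLevel μ m (dyadicLevel p k) + δ with hT
  have hTtop : T ≠ ∞ := ENNReal.add_ne_top.2 ⟨hfin.ne, ENNReal.coe_ne_top⟩
  have hsum : ∑' k, dyadicLevel p (k + 1) * μ (A k) ≤ T := by
    calc _ ≤ ∑' k, (dyadicLevel p (k + 1) * carlesonLevel μ m (dyadicLevel p k) + ε k) :=
          ENNReal.tsum_le_tsum hcost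
      _ ≤ T := by rw [ENNReal.tsum_add, hT]; gcongr
  have lev_lim : Filter.Tendsto (fun n : ℕ => dyadicLevel p n) Filter.atTop (nhds ∞) := by
    simp only [dyadicLevel_eq_ofReal]
    refine ENNReal.tendsto_ofReal_atTop.comp ((tendsto_rpow_atTop hp).comp ?_)
    simpa using tendsto_pow_atTop_atTop_of_one_lt (r := (2:ℝ)) (by norm_num)
  have lev_lim' : Filter.Tendsto (fun n : ℕ => dyadicLevel p (-(n : ℤ))) Filter.atTop
      (nhds 0) := by
    simp only [dyadicLevel]
    have h : Filter.Tendsto (fun n : ℕ => (2:ℝ) ^ (-(n : ℤ))) Filter.atTop (nhds 0) := by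
      simpa [Function.comp_def] using tendsto_inv_atTop_zero.comp
        (tendsto_pow_atTop_atTop_of_one_lt (r := (2:ℝ)) (by norm_num))
    have h2 := (ENNReal.tendsto_ofReal h).ennrpow_const p
    simpa [hp] using h2
  have hexit : ∀ k x, x ∈ A k → ∃ j, x ∈ A j \ A (j + 1) := by
    intro k x hx
    by_contra! hcon
    have hall : ∀ n, k ≤ n → x ∈ A n := fun n hn =>
      Int.leInduction (motive := fun n _ => x ∈ A n) hx
        (fun n _ ih => by_contra fun h => hcon n ⟨ih, h⟩) n hn
    have hbound : ∀ n : ℕ, dyadicLevel p n * μ {x} ≤ T := by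
      intro n
      set N : ℤ := max k n
      have hmem : x ∈ A N := hall N (le_max_left _ _)
      calc dyadicLevel p n * μ {x} ≤ dyadicLevel p (N + 1) * μ (A N) := by
            gcongr
            · rw [dyadicLevel, dyadicLevel]
              gcongr
              · norm_num
              · omega
            · simpa using hmem
        _ ≤ _ := ENNReal.le_tsum N
        _ ≤ T := hsum
    have hx0 : μ {x} ≠ 0 := fun h => by simpa using hμ _ h
    have hlim := ENNReal.Tendsto.mul_const (b := μ {x}) lev_lim (Or.inl (by simp))
    rw [ENNReal.top_mul hx0] at hlim
    exact hTtop (top_le_iff.1 (le_of_tendsto' hlim hbound))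
  have hnull : ∀ i, m (E i \ ⋃ k, A k) = 0 := by
    intro i
    have hb : ∀ n : ℕ, m (E i \ ⋃ k, A k) ≤ dyadicLevel p (-(n : ℤ)) * μ (E i) := fun n =>
      (measure_mono (sdiff_subset_sdiff_right (subset_iUnion A _))).trans (hdom _ _ (hE i))
    have hlim := ENNReal.Tendsto.mul_const (b := μ (E i)) lev_lim' (Or.inr (hEfin i))
    rw [zero_mul] at hlim
    exact le_antisymm (ge_of_tendsto' hlim hb) zero_le
  have hsub : (univ : Set X) ⊆
      ((⋃ i, E i)ᶜ ∪ ⋃ i, E i \ ⋃ k, A k) ∪ ⋃ k, A k \ A (k + 1) := by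
    intro x _
    by_cases h1 : x ∈ ⋃ i, E i
    · by_cases h2 : x ∈ ⋃ k, A k
      · obtain ⟨k, hk⟩ := mem_iUnion.1 h2
        exact Or.inr (mem_iUnion.2 (hexit k x hk))
      · obtain ⟨i, hi⟩ := mem_iUnion.1 h1
        exact Or.inl (Or.inr (mem_iUnion.2 ⟨i, hi, h2⟩))
    · exact Or.inl (Or.inl h1)
  have hnull' : m ((⋃ i, E i)ᶜ ∪ ⋃ i, E i \ ⋃ k, A k) = 0 :=
    measure_union_null hcover (measure_iUnion_null hnull)
  calc m univ ≤ m ((⋃ i, E i)ᶜ ∪ ⋃ i, E i \ ⋃ k, A k) + m (⋃ k, A k \ A (k + 1)) :=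
        (measure_mono hsub).trans (measure_union_le _ _)
    _ ≤ ∑' k, m (A k \ A (k + 1)) := by rw [hnull', zero_add]; exact measure_iUnion_le _
    _ ≤ ∑' k, dyadicLevel p (k + 1) * μ (A k) :=
        ENNReal.tsum_le_tsum fun k => hdom (k + 1) (A k) (hA k)
    _ ≤ T := hsum

lemma measure_univ_le_lintegral_carlesonLevel {X ι : Type*} [MeasurableSpace X] [Countable ι]
    (μ : OuterMeasure X) (m : Measure X) (hμ : ∀ B, μ B = 0 → B = ∅) (E : ι → Set X)
    (hE : ∀ i, MeasurableSet (E i)) (hEfin : ∀ i, μ (E i) ≠ ∞) (hcover : m (⋃ i, E i)ᶜ = 0)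
    {p : ℝ} (hp : 0 < p) :
    m univ ≤ ENNReal.ofReal ((2 ^ p * 2 ^ p) / (2 ^ p - 1)) *
      ∫⁻ l in Ioi (0:ℝ), ENNReal.ofReal (p * l ^ (p - 1)) *
        carlesonLevel μ m (ENNReal.ofReal l ^ p) := by
  refine (measure_univ_le_tsum_carlesonLevel μ m hμ E hE hEfin hcover hp).trans ?_
  rw [← (Equiv.addRight (1:ℤ)).tsum_eq]
  simp only [Equiv.coe_addRight, dyadicLevel_add_two hp, mul_assoc]
  rw [ENNReal.tsum_mul_left]
  gcongr
  exact tsum_le_lintegral_antitone (carlesonLevel_antitone μ m) hp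

lemma outerSup_indicator_compl_le_iff {X : Type*} [MeasurableSpace X] (μ : OuterMeasure X)
    (ν : Measure X) (hμ : ∀ B, μ B = 0 → B = ∅) {p : ℝ≥0∞} (hp : 0 < p.toReal) (f : X → ℝ≥0∞)
    {lam : ℝ≥0∞} (hlam : lam ≠ 0) {A : Set X} (hA : MeasurableSet A) :
    outerSup μ ν p (Aᶜ.indicator f) ≤ lam ↔ ∀ B, MeasurableSet B →
      ν.withDensity (fun x => f x ^ p.toReal) (B \ A) ≤ lam ^ p.toReal * μ B := by
  have hptop : p ≠ ∞ := fun h => by simp [h] at hp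
  have hint : ∀ B, MeasurableSet B → ∫⁻ x in B, Aᶜ.indicator f x ^ p.toReal ∂ν =
      ν.withDensity (fun x => f x ^ p.toReal) (B \ A) := by
    intro B hB
    have : (fun x => Aᶜ.indicator f x ^ p.toReal) = Aᶜ.indicator fun x => f x ^ p.toReal := by
      ext x
      by_cases hx : x ∈ A <;> simp [hx, hp]
    rw [this, withDensity_apply _ (hB.diff hA), setLIntegral_indicator hA.compl, inter_comm,
      Set.sdiff_eq]
  simp only [outerSup, iSup_le_iff, ellSize, if_neg hptop]
  refine forall₂_congr fun B hB => ?_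
  rw [ENNReal.rpow_inv_le_iff hp, hint B hB]
  constructor
  · intro h
    by_cases h0 : μ B = 0
    · simp [hμ B h0]
    by_cases htop : μ B = ∞
    · rw [htop, ENNReal.mul_top]
      · exact le_top
      · simp [ENNReal.rpow_eq_zero_iff, hlam, hp.le]
    · rwa [mul_comm, ← div_eq_mul_inv, ENNReal.div_le_iff h0 htop] at h
  · intro h
    rw [mul_comm, ← div_eq_mul_inv]
    exact ENNReal.div_le_of_le_mul h

lemma outerLp_eq_lintegral_carlesonLevel {X : Type*} [MeasurableSpace X] (μ : OuterMeasure X)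
    (ν : Measure X) (hμ : ∀ B, μ B = 0 → B = ∅) {p : ℝ≥0∞} (hp : 0 < p.toReal)
    (f : X → ℝ≥0∞) :
    outerLp μ ν p p f = (∫⁻ l in Ioi (0:ℝ), ENNReal.ofReal (p.toReal * l ^ (p.toReal - 1)) *
      carlesonLevel μ (ν.withDensity fun x => f x ^ p.toReal)
        (ENNReal.ofReal l ^ p.toReal)) ^ p.toReal⁻¹ := by
  have hptop : p ≠ ∞ := fun h => by simp [h] at hp
  rw [outerLp, if_neg hptop]
  congr 1
  refine setLIntegral_congr_fun measurableSet_Ioi fun l hl => ?_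
  have hl0 : ENNReal.ofReal l ≠ 0 := by simpa using hl
  simp only [superLevel, carlesonLevel]
  congr 1
  refine iInf_congr fun A => iInf_congr fun hA => ?_
  exact iInf_congr_Prop (outerSup_indicator_compl_le_iff μ ν hμ hp f hl0 hA) fun _ => rfl

lemma outerSup_top {X : Type*} [MeasurableSpace X] (μ : Set X → ℝ≥0∞) (ν : Measure X)
    (f : X → ℝ≥0∞) : outerSup μ ν ∞ f = essSup f ν := by
  simp only [outerSup, ellSize, if_true]
  refine le_antisymm (iSup₂_le fun A _ => essSup_mono_measure ?_) ?_
  · exact Measure.absolutelyContinuous_of_le Measure.restrict_le_self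
  · refine le_iSup₂_of_le univ MeasurableSet.univ ?_
    rw [Measure.restrict_univ]

/-- `dyadicOuter` as a bundled outer measure. -/
def dyadicOuterMeasure (d : ℕ) : OuterMeasure (UHS d) where
  measureOf := dyadicOuter d
  empty := le_antisymm (iInf_le_of_le ∅ (iInf_le_of_le (empty_subset _) (by simp))) zero_le
  mono := fun h => le_iInf fun C => le_iInf fun hC =>
    iInf_le_of_le C (iInf_le_of_le (h.trans hC) le_rfl)
  iUnion_nat := by
    intro s _
    refine ENNReal.le_of_forall_pos_le_add fun δ hδ hfin => ?_
    obtain ⟨ε, hε, hεsum⟩ :=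
      ENNReal.exists_pos_sum_of_countable' (ENNReal.coe_ne_zero.2 hδ.ne') ℕ
    have choice : ∀ n, ∃ C : Set (ℤ × (Fin d → ℤ)), s n ⊆ ⋃ e ∈ C, dyadicBox d e.1 e.2 ∧
        ∑' e : C, dyadicVol d e.1.1 ≤ dyadicOuter d (s n) + ε n := by
      intro n
      have hlt := ENNReal.lt_add_right (ENNReal.ne_top_of_tsum_ne_top hfin.ne n) (hε n).ne'
      conv_lhs at hlt => rw [dyadicOuter]
      simp only [iInf_lt_iff] at hlt
      obtain ⟨C, hC, hlt⟩ := hlt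
      exact ⟨C, hC, hlt.le⟩
    choose C hC hcost using choice
    have hcover : ⋃ n, s n ⊆ ⋃ e ∈ ⋃ n, C n, dyadicBox d e.1 e.2 := by
      rw [biUnion_iUnion]
      exact iUnion_mono hC
    calc dyadicOuter d (⋃ n, s n) ≤ ∑' e : ⋃ n, C n, dyadicVol d e.1.1 :=
          iInf_le_of_le _ (iInf_le_of_le hcover le_rfl)
      _ ≤ ∑' n, ∑' e : C n, dyadicVol d e.1.1 :=
          ENNReal.tsum_iUnion_le_tsum (fun e : ℤ × (Fin d → ℤ) => dyadicVol d e.1) C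
      _ ≤ ∑' n, (dyadicOuter d (s n) + ε n) := ENNReal.tsum_le_tsum hcost
      _ ≤ _ := by rw [ENNReal.tsum_add]; gcongr

lemma eq_empty_of_dyadicOuter_eq_zero {d : ℕ} {B : Set (UHS d)} (h : dyadicOuter d B = 0) :
    B = ∅ := by
  by_contra! hne
  obtain ⟨q, hq⟩ := hne
  have hbox : ∀ C : Set (ℤ × (Fin d → ℤ)), B ⊆ ⋃ e ∈ C, dyadicBox d e.1 e.2 →
      ∃ e ∈ C, q ∈ dyadicBox d e.1 e.2 := fun C hC => by simpa using hC hq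
  have hq0 : 0 < q.2 := by
    by_contra! hle
    have : (1 : ℝ≥0∞) ≤ dyadicOuter d B := le_iInf fun C => le_iInf fun hC => by
      obtain ⟨e, _, he⟩ := hbox C hC
      exact absurd he.2.1 (not_lt.2 hle)
    simp [h] at this
  have : ENNReal.ofReal q.2 ^ d ≤ dyadicOuter d B := le_iInf fun C => le_iInf fun hC => by
    obtain ⟨e, heC, he⟩ := hbox C hC
    refine le_trans ?_ (ENNReal.le_tsum (⟨e, heC⟩ : C))
    simp only [dyadicVol]
    gcongr
    exact he.2.2.le
  rw [h, nonpos_iff_eq_zero] at this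
  exact absurd (eq_zero_of_pow_eq_zero this) (by simpa using hq0)

lemma measurableSet_dyadicBox (d : ℕ) (j : ℤ) (k : Fin d → ℤ) :
    MeasurableSet (dyadicBox d j k) := by
  have : dyadicBox d j k = (⋂ i, (fun q : UHS d => q.1 i) ⁻¹'
      Ioo ((2:ℝ) ^ j * k i) ((2:ℝ) ^ j * k i + (2:ℝ) ^ j)) ∩ Prod.snd ⁻¹' Ioo 0 ((2:ℝ) ^ j) := by
    ext q; simp [dyadicBox]
  rw [this]
  exact (MeasurableSet.iInter fun i => measurableSet_Ioo.preimage (by fun_prop)).inter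
    (measurableSet_Ioo.preimage measurable_snd)

lemma dyadicOuter_dyadicBox_ne_top (d : ℕ) (j : ℤ) (k : Fin d → ℤ) :
    dyadicOuter d (dyadicBox d j k) ≠ ∞ := by
  have : dyadicOuter d (dyadicBox d j k) ≤ dyadicVol d j :=
    iInf_le_of_le {(j, k)} (iInf_le_of_le (by simp) (by
      rw [tsum_singleton (j, k) fun e : ℤ × (Fin d → ℤ) => dyadicVol d e.1]))
  exact (this.trans_lt (ENNReal.pow_lt_top ENNReal.ofReal_lt_top)).ne

lemma uhsMeasure_compl_iUnion_dyadicBox (d : ℕ) :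
    uhsMeasure d (⋃ e : ℤ × (Fin d → ℤ), dyadicBox d e.1 e.2)ᶜ = 0 := by
  have hsub : (⋃ e : ℤ × (Fin d → ℤ), dyadicBox d e.1 e.2)ᶜ ⊆
      (univ ×ˢ Iic 0) ∪ ⋃ (i : Fin d) (j : ℤ) (n : ℤ),
        {y : Fin d → ℝ | y i = (2:ℝ) ^ j * n} ×ˢ univ := by
    intro q hq
    by_contra hcon
    simp only [mem_union, mem_iUnion, mem_prod, mem_univ, true_and, and_true, mem_Iic,
      mem_ofPred_eq, not_or, not_le, not_exists] at hcon
    obtain ⟨hq0, hne⟩ := hcon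
    obtain ⟨j, hj⟩ : ∃ j : ℤ, q.2 < (2:ℝ) ^ j := by
      obtain ⟨n, hn⟩ := pow_unbounded_of_one_lt q.2 (one_lt_two (α := ℝ))
      exact ⟨n, by simpa using hn⟩
    have hpos : (0:ℝ) < 2 ^ j := by positivity
    refine hq (mem_iUnion.2 ⟨(j, fun i => ⌊q.1 i / 2 ^ j⌋), fun i => ⟨?_, ?_⟩, hq0, hj⟩)
    · refine lt_of_le_of_ne ?_ fun h => hne i j _ h.symm
      have := Int.floor_le (q.1 i / 2 ^ j)
      rwa [le_div_iff₀ hpos, mul_comm] at this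
    · have := Int.lt_floor_add_one (q.1 i / 2 ^ j)
      rw [div_lt_iff₀ hpos] at this
      simp only
      linarith
  refine measure_mono_null hsub (measure_union_null ?_ ?_)
  · rw [uhsMeasure, Measure.prod_prod, withDensity_apply _ measurableSet_Iic,
      setLIntegral_eq_zero measurableSet_Iic, mul_zero]
    intro t ht
    simpa using ht
  · refine measure_iUnion_null fun i => measure_iUnion_null fun j => measure_iUnion_null fun n => ?_
    rw [uhsMeasure, Measure.prod_prod, volume_pi, Measure.pi_hyperplane, zero_mul]

/-- Collapsing of exponents in the upper half space (Theorem 1.2(i)): for every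
`0 < p ≤ ∞` there is a constant `C = C(p)` such that for every `d ≥ 1` and every
nonnegative Borel function `f` on `ℝ^d × (0,∞)`,
`C⁻¹ ‖f‖_{L^p(X,ω)} ≤ ‖f‖_{L^p(ℓ^p)} ≤ C ‖f‖_{L^p(X,ω)}`. -/
theorem collapsing_upper_half_space (p : ℝ≥0∞) (hp : 0 < p) :
    ∃ C : ℝ≥0∞, 0 < C ∧ C ≠ ∞ ∧
      ∀ d : ℕ, 1 ≤ d →
        ∀ f : UHS d → ℝ≥0∞, Measurable f →
          C⁻¹ * uhsLp d p f ≤ outerLp (dyadicOuter d) (uhsMeasure d) p p f ∧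
          outerLp (dyadicOuter d) (uhsMeasure d) p p f ≤ C * uhsLp d p f := by
  by_cases hptop : p = ∞
  · subst hptop
    refine ⟨1, one_pos, ENNReal.one_ne_top, fun d _ f _ => ?_⟩
    simp [outerLp, uhsLp, outerSup_top]
  have hpr : 0 < p.toReal := ENNReal.toReal_pos hp.ne' hptop
  set r := p.toReal
  set K : ℝ≥0∞ := ENNReal.ofReal (2 ^ r) + ENNReal.ofReal ((2 ^ r * 2 ^ r) / (2 ^ r - 1))
  have hKtop : K ≠ ∞ := ENNReal.add_ne_top.2 ⟨ENNReal.ofReal_ne_top, ENNReal.ofReal_ne_top⟩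
  have hKpos : 0 < K := by
    refine lt_of_lt_of_le ?_ le_self_add
    rw [ENNReal.ofReal_pos]
    positivity
  have hCpos : 0 < K ^ r⁻¹ := ENNReal.rpow_pos hKpos hKtop
  have hCtop : K ^ r⁻¹ ≠ ∞ := ENNReal.rpow_ne_top_of_nonneg (by positivity) hKtop
  refine ⟨K ^ r⁻¹, hCpos, hCtop, fun d _ f hf => ?_⟩
  have hzero : ∀ B, dyadicOuterMeasure d B = 0 → B = ∅ := fun B h =>
    eq_empty_of_dyadicOuter_eq_zero h
  have houter : outerLp (dyadicOuter d) (uhsMeasure d) p p f = _ :=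
    outerLp_eq_lintegral_carlesonLevel (dyadicOuterMeasure d) (uhsMeasure d) hzero hpr f
  set m := (uhsMeasure d).withDensity fun x => f x ^ r with hm
  have hmuniv : uhsLp d p f = m univ ^ r⁻¹ := by
    rw [uhsLp, if_neg hptop, hm, withDensity_apply _ MeasurableSet.univ, Measure.restrict_univ]
  rw [houter, hmuniv]
  constructor
  · rw [mul_comm, ← div_eq_mul_inv]
    refine ENNReal.div_le_of_le_mul ?_
    rw [← ENNReal.mul_rpow_of_nonneg _ _ (by positivity), mul_comm _ K]
    gcongr
    refine (measure_univ_le_lintegral_carlesonLevel (dyadicOuterMeasure d) m hzero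
      (fun e : ℤ × (Fin d → ℤ) => dyadicBox d e.1 e.2)
      (fun e => measurableSet_dyadicBox d e.1 e.2)
      (fun e => dyadicOuter_dyadicBox_ne_top d e.1 e.2)
      (withDensity_absolutelyContinuous _ _ (uhsMeasure_compl_iUnion_dyadicBox d)) hpr).trans ?_
    gcongr
    exact le_add_self
  · by_cases hfin : m univ = ∞
    · rw [hfin, ENNReal.top_rpow_of_pos (inv_pos.2 hpr), ENNReal.mul_top hCpos.ne']
      exact le_top
    · have : IsFiniteMeasure m := ⟨lt_top_iff_ne_top.2 hfin⟩
      rw [← ENNReal.mul_rpow_of_nonneg _ _ (by positivity)]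
      gcongr
      refine (lintegral_carlesonLevel_le (dyadicOuterMeasure d) m hpr).trans ?_
      gcongr
      exact le_self_add

end
end
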